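/- arXiv:1610.07101 — 6 statements merged into one kernel-verified Lean document; each statement's English description precedes it below -/
import Mathlib

section
/- Let X₁, X₂, … be a strictly stationary associated sequence of mean-zero, square-integrable real random variables such that σ² := Var(X₁) + 2·∑_{j=2}^{∞} Cov(X₁, X_j) is finite. Then S_n/√n converges in distribution, as n → ∞, to the centered Gaussian law with variance σ². -/
open MeasureTheory ProbabilityTheory Filter Topology

noncomputable section

/-- Covariance of two real random variables: `Cov(X,Y) = E(XY) - E(X)E(Y)`. -/
def cov {Ω : Type*} [MeasurableSpace Ω] (μ : Measure Ω) (X Y : Ω → ℝ) : ℝ :=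
  (∫ ω, X ω * Y ω ∂μ) - (∫ ω, X ω ∂μ) * (∫ ω, Y ω ∂μ)

/-- A function `h : ℝⁿ → ℝ` is coordinatewise nondecreasing. -/
def CoordwiseMono {n : ℕ} (h : (Fin n → ℝ) → ℝ) : Prop :=
  ∀ x y : Fin n → ℝ, (∀ i, x i ≤ y i) → h x ≤ h y

/-- A finite family `(X₁,…,Xₙ)` of real random variables is associated if for all
coordinatewise nondecreasing `h, g` for which the covariance exists,
`Cov(h(X₁,…,Xₙ), g(X₁,…,Xₙ)) ≥ 0`. -/
def IsAssociated {Ω : Type*} [MeasurableSpace Ω] (μ : Measure Ω) {n : ℕ}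
    (X : Fin n → Ω → ℝ) : Prop :=
  ∀ h g : (Fin n → ℝ) → ℝ, CoordwiseMono h → CoordwiseMono g →
    Integrable (fun ω => h (fun i => X i ω)) μ →
    Integrable (fun ω => g (fun i => X i ω)) μ →
    Integrable (fun ω => h (fun i => X i ω) * g (fun i => X i ω)) μ →
    0 ≤ cov μ (fun ω => h (fun i => X i ω)) (fun ω => g (fun i => X i ω))

/-- An infinite sequence of real random variables is associated if every finite
subfamily is associated. -/
def IsAssociatedSeq {Ω : Type*} [MeasurableSpace Ω] (μ : Measure Ω) (X : ℕ → Ω → ℝ) : Prop :=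
  ∀ (k : ℕ) (φ : Fin k → ℕ), IsAssociated μ (fun i => X (φ i))

/-- Convergence in distribution of a sequence of real random variables to a law `ν`:
integrals of bounded continuous functions converge. -/
def TendstoInDistrib {Ω : Type*} [MeasurableSpace Ω] (μ : Measure Ω)
    (Z : ℕ → Ω → ℝ) (ν : Measure ℝ) : Prop :=
  ∀ f : ℝ → ℝ, Continuous f → (∃ C, ∀ x, |f x| ≤ C) →
    Tendsto (fun n => ∫ ω, f (Z n ω) ∂μ) atTop (𝓝 (∫ x, f x ∂ν))


lemma newman_abs_cov {Ω : Type*} [MeasurableSpace Ω] (μ : Measure Ω) [IsProbabilityMeasure μ]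
    (A B : Ω → ℝ) (hA : MemLp A 2 μ) (hB : MemLp B 2 μ)
    (H : ∀ f g : ℝ → ℝ, Monotone f → Monotone g → MemLp (fun ω => f (A ω)) 2 μ →
      MemLp (fun ω => g (B ω)) 2 μ → 0 ≤ covariance (fun ω => f (A ω)) (fun ω => g (B ω)) μ)
    (f g : ℝ → ℝ) (L : ℝ) (hf : ∀ x y, |f x - f y| ≤ L * |x - y|)
    (hg : ∀ x y, |g x - g y| ≤ L * |x - y|)
    (hfA : MemLp (fun ω => f (A ω)) 2 μ) (hgB : MemLp (fun ω => g (B ω)) 2 μ) :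
    |covariance (fun ω => f (A ω)) (fun ω => g (B ω)) μ| ≤ L ^ 2 * covariance A B μ := by
  have mono1 : ∀ f : ℝ → ℝ, (∀ x y, |f x - f y| ≤ L * |x - y|) →
      Monotone (fun x => L * x + f x) := by
    intro f hf x y hxy
    have h1 := hf x y
    rw [abs_of_nonpos (by linarith : x - y ≤ 0)] at h1
    have := le_abs_self (f x - f y)
    simp only; linarith
  have mono2 : ∀ f : ℝ → ℝ, (∀ x y, |f x - f y| ≤ L * |x - y|) →
      Monotone (fun x => L * x - f x) := by
    intro f hf x y hxy
    have h1 := hf x y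
    rw [abs_of_nonpos (by linarith : x - y ≤ 0)] at h1
    have := neg_abs_le (f x - f y)
    simp only; linarith
  have hLA : MemLp (fun ω => L * A ω) 2 μ := hA.const_mul L
  have hLB : MemLp (fun ω => L * B ω) 2 μ := hB.const_mul L
  have addl : ∀ {U V W : Ω → ℝ}, MemLp U 2 μ → MemLp V 2 μ → MemLp W 2 μ →
      covariance (fun ω => U ω + V ω) W μ = covariance U W μ + covariance V W μ :=
    fun hU hV hW => covariance_add_left hU hV hW
  have addr : ∀ {U V W : Ω → ℝ}, MemLp U 2 μ → MemLp V 2 μ → MemLp W 2 μ →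
      covariance U (fun ω => V ω + W ω) μ = covariance U V μ + covariance U W μ :=
    fun hU hV hW => covariance_add_right hU hV hW
  have hBp : MemLp (fun ω => L * B ω + g (B ω)) 2 μ := hLB.add hgB
  have hBs : MemLp (fun ω => L * B ω - g (B ω)) 2 μ := hLB.sub hgB
  have e1 := H _ _ (mono1 f hf) (mono1 g hg) (hLA.add hfA) (hLB.add hgB)
  have e2 := H _ _ (mono2 f hf) (mono2 g hg) (hLA.sub hfA) (hLB.sub hgB)
  have e3 := H _ _ (mono1 f hf) (mono2 g hg) (hLA.add hfA) (hLB.sub hgB)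
  have e4 := H _ _ (mono2 f hf) (mono1 g hg) (hLA.sub hfA) (hLB.add hgB)
  rw [addl hLA hfA hBp, addr hLA hLB hgB,
    addr hfA hLB hgB] at e1
  rw [covariance_fun_sub_left hLA hfA hBs, covariance_fun_sub_right hLA hLB hgB,
    covariance_fun_sub_right hfA hLB hgB] at e2
  rw [addl hLA hfA hBs, covariance_fun_sub_right hLA hLB hgB,
    covariance_fun_sub_right hfA hLB hgB] at e3
  rw [covariance_fun_sub_left hLA hfA hBp, addr hLA hLB hgB,
    addr hfA hLB hgB] at e4
  have hh : covariance (fun ω => L * A ω) (fun ω => L * B ω) μ = L ^ 2 * covariance A B μ := by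
    rw [covariance_const_mul_left, covariance_const_mul_right]; ring
  rw [hh] at e1 e2 e3 e4
  rw [abs_le]
  constructor <;> linarith

lemma newman_charFun {Ω : Type*} [MeasurableSpace Ω] (μ : Measure Ω) [IsProbabilityMeasure μ]
    (A B : Ω → ℝ) (hAm : Measurable A) (hBm : Measurable B)
    (hA : MemLp A 2 μ) (hB : MemLp B 2 μ)
    (H : ∀ f g : ℝ → ℝ, Monotone f → Monotone g → MemLp (fun ω => f (A ω)) 2 μ →
      MemLp (fun ω => g (B ω)) 2 μ → 0 ≤ covariance (fun ω => f (A ω)) (fun ω => g (B ω)) μ)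
    (s : ℝ) :
    ‖charFun (μ.map (fun ω => A ω + B ω)) s - charFun (μ.map A) s * charFun (μ.map B) s‖
      ≤ 4 * s ^ 2 * covariance A B μ := by
  have hlip : ∀ (h : ℝ → ℝ), (∀ x y, |h x - h y| ≤ |x - y|) →
      ∀ x y, |h (s * x) - h (s * y)| ≤ |s| * |x - y| := by
    intro h hh x y
    refine (hh _ _).trans ?_
    rw [← mul_sub, abs_mul]
  have hcos : ∀ x y : ℝ, |Real.cos x - Real.cos y| ≤ |x - y| := fun x y =>
    Real.abs_cos_sub_cos_le x y
  have hsin : ∀ x y : ℝ, |Real.sin x - Real.sin y| ≤ |x - y| := fun x y =>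
    Real.abs_sin_sub_sin_le x y
  have mc : ∀ Y : Ω → ℝ, Measurable Y → MemLp (fun ω => Real.cos (s * Y ω)) 2 μ := by
    intro Y hY
    refine MemLp.of_bound (by fun_prop) 1 (ae_of_all _ fun ω => ?_)
    exact Real.abs_cos_le_one _
  have ms : ∀ Y : Ω → ℝ, Measurable Y → MemLp (fun ω => Real.sin (s * Y ω)) 2 μ := by
    intro Y hY
    refine MemLp.of_bound (by fun_prop) 1 (ae_of_all _ fun ω => ?_)
    exact Real.abs_sin_le_one _
  have c1 := newman_abs_cov μ A B hA hB H (fun x => Real.cos (s * x)) (fun x => Real.cos (s * x))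
    |s| (hlip _ hcos) (hlip _ hcos) (mc A hAm) (mc B hBm)
  have c2 := newman_abs_cov μ A B hA hB H (fun x => Real.sin (s * x)) (fun x => Real.sin (s * x))
    |s| (hlip _ hsin) (hlip _ hsin) (ms A hAm) (ms B hBm)
  have c3 := newman_abs_cov μ A B hA hB H (fun x => Real.cos (s * x)) (fun x => Real.sin (s * x))
    |s| (hlip _ hcos) (hlip _ hsin) (mc A hAm) (ms B hBm)
  have c4 := newman_abs_cov μ A B hA hB H (fun x => Real.sin (s * x)) (fun x => Real.cos (s * x))
    |s| (hlip _ hsin) (hlip _ hcos) (ms A hAm) (mc B hBm)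
  have hcf : ∀ Y : Ω → ℝ, Measurable Y → charFun (μ.map Y) s =
      ((∫ ω, Real.cos (s * Y ω) ∂μ : ℝ) : ℂ) + ((∫ ω, Real.sin (s * Y ω) ∂μ : ℝ) : ℂ) * Complex.I := by
    intro Y hY
    rw [charFun_apply_real, integral_map hY.aemeasurable (by fun_prop), ← integral_complex_ofReal,
      ← integral_complex_ofReal, ← integral_mul_const, ← integral_add]
    · refine integral_congr_ae (ae_of_all _ fun ω => ?_)
      simp only []
      rw [Complex.exp_mul_I]; push_cast; rfl
    · exact ((mc Y hY).integrable (by norm_num)).ofReal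
    · exact ((ms Y hY).integrable (by norm_num)).ofReal.mul_const _
  rw [hcf (fun ω => A ω + B ω) (hAm.add hBm), hcf A hAm, hcf B hBm]
  have i1 := (mc A hAm).integrable_mul (mc B hBm)
  have i2 := (ms A hAm).integrable_mul (ms B hBm)
  have i3 := (mc A hAm).integrable_mul (ms B hBm)
  have i4 := (ms A hAm).integrable_mul (mc B hBm)
  have ec : ∫ ω, Real.cos (s * (A ω + B ω)) ∂μ =
      (∫ ω, ((fun ω => Real.cos (s * A ω)) * (fun ω => Real.cos (s * B ω))) ω ∂μ)
      - ∫ ω, ((fun ω => Real.sin (s * A ω)) * (fun ω => Real.sin (s * B ω))) ω ∂μ := by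
    rw [← integral_sub i1 i2]
    refine integral_congr_ae (ae_of_all _ fun ω => ?_)
    simp only [Pi.mul_apply, mul_add, Real.cos_add]
  have es : ∫ ω, Real.sin (s * (A ω + B ω)) ∂μ =
      (∫ ω, ((fun ω => Real.sin (s * A ω)) * (fun ω => Real.cos (s * B ω))) ω ∂μ)
      + ∫ ω, ((fun ω => Real.cos (s * A ω)) * (fun ω => Real.sin (s * B ω))) ω ∂μ := by
    rw [← integral_add i4 i3]
    refine integral_congr_ae (ae_of_all _ fun ω => ?_)
    simp only [Pi.mul_apply, mul_add, Real.sin_add]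
  rw [ec, es]
  rw [covariance_eq_sub (mc A hAm) (mc B hBm)] at c1
  rw [covariance_eq_sub (ms A hAm) (ms B hBm)] at c2
  rw [covariance_eq_sub (mc A hAm) (ms B hBm)] at c3
  rw [covariance_eq_sub (ms A hAm) (mc B hBm)] at c4
  generalize (∫ ω, ((fun ω => Real.cos (s * A ω)) * (fun ω => Real.cos (s * B ω))) ω ∂μ) = m1 at *
  generalize (∫ ω, ((fun ω => Real.sin (s * A ω)) * (fun ω => Real.sin (s * B ω))) ω ∂μ) = m2 at *
  generalize (∫ ω, ((fun ω => Real.cos (s * A ω)) * (fun ω => Real.sin (s * B ω))) ω ∂μ) = m3 at *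
  generalize (∫ ω, ((fun ω => Real.sin (s * A ω)) * (fun ω => Real.cos (s * B ω))) ω ∂μ) = m4 at *
  generalize (∫ ω, Real.cos (s * A ω) ∂μ) = a1 at *
  generalize (∫ ω, Real.cos (s * B ω) ∂μ) = b1 at *
  generalize (∫ ω, Real.sin (s * A ω) ∂μ) = a2 at *
  generalize (∫ ω, Real.sin (s * B ω) ∂μ) = b2 at *
  rw [sq_abs] at c1 c2 c3 c4
  refine (Complex.norm_le_abs_re_add_abs_im _).trans ?_
  simp only [Complex.add_re, Complex.sub_re, Complex.mul_re, Complex.mul_im, Complex.ofReal_re,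
    Complex.ofReal_im, Complex.I_re, Complex.I_im, Complex.add_im, Complex.sub_im]
  have r : ∀ u v w : ℝ, |u| ≤ w → ∀ z, |v| ≤ z → |u - v| ≤ w + z := fun u v w h z h' =>
    (abs_sub _ _).trans (add_le_add h h')
  have f1 := r _ _ _ c1 _ c2
  have f2 := (abs_add_le (m3 - a1 * b2) (m4 - a2 * b1)).trans (add_le_add c3 c4)
  have g1 := (congrArg abs (show (m1 - m2 + ((m4+m3)*0 - 0*1) - ((a1 + (a2*0-0*1))*(b1+(b2*0-0*1)) - (0 + (a2*1+0*0))*(0+(b2*1+0*0)))) = (m1 - a1*b1) - (m2 - a2*b2) by ring)).le.trans f1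
  have g2 := (congrArg abs (show (m4+m3) - (a1*b2 + a2*b1) = (m3 - a1*b2) + (m4 - a2*b1) by ring)).le.trans f2
  ring_nf at g1 g2 ⊢
  linarith

lemma taylor_charFun_gen {Ω : Type*} [MeasurableSpace Ω] (P : Measure Ω) [IsProbabilityMeasure P]
    (Y : Ω → ℝ) (hY : Measurable Y) (hL : MemLp Y 2 P) (h0 : ∫ ω, Y ω ∂P = 0) :
    (fun t : ℝ => charFun (P.map Y) t - (1 - (variance Y P : ℂ) * (t : ℂ) ^ 2 / 2))
      =o[𝓝 0] fun t : ℝ => t ^ 2 := by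
  have hint : MemLp id 2 (P.map Y) := by
    rw [memLp_map_measure_iff (by fun_prop) hY.aemeasurable]; exact hL
  have : IsProbabilityMeasure (P.map Y) := Measure.isProbabilityMeasure_map hY.aemeasurable
  have hv : variance Y P = ∫ ω, (Y ^ 2) ω ∂P := by
    rw [variance_of_integral_eq_zero hY.aemeasurable h0]; rfl
  have h := taylor_isLittleO_univ (f := charFun (P.map Y)) (x₀ := 0) (n := 2)
    (contDiff_charFun hint)
  simp only [taylorWithinEval_charFun_two_zero hY.aemeasurable hint, h0] at h
  rw [hv]
  simpa using h

lemma charFun_pow_limit (φ : ℝ → ℂ) (v : ℝ)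
    (hφ : (fun t : ℝ => φ t - (1 - (v : ℂ) * (t : ℂ) ^ 2 / 2)) =o[𝓝 0] fun t : ℝ => t ^ 2)
    (p r : ℕ) (hp : 0 < p) (t : ℝ) :
    Tendsto (fun m : ℕ => φ (t / Real.sqrt ((r + m * p : ℕ) : ℝ)) ^ m) atTop
      (𝓝 (Complex.exp (-((v / p : ℝ) : ℂ) * t ^ 2 / 2))) := by
  have hN : Tendsto (fun m : ℕ => ((r + m * p : ℕ) : ℝ)) atTop atTop := by
    refine tendsto_natCast_atTop_atTop.comp (tendsto_atTop_mono (fun m => ?_) tendsto_id)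
    simp only [id]; nlinarith
  have hs : Tendsto (fun m : ℕ => t / Real.sqrt ((r + m * p : ℕ) : ℝ)) atTop (𝓝 0) :=
    tendsto_const_nhds.div_atTop (Real.tendsto_sqrt_atTop.comp hN)
  have hratio : Tendsto (fun m : ℕ => (m : ℝ) * (t / Real.sqrt ((r + m * p : ℕ) : ℝ)) ^ 2) atTop
      (𝓝 (t ^ 2 / p)) := by
    have h1 : Tendsto (fun m : ℕ => t ^ 2 * ((r : ℝ) / m + p)⁻¹) atTop (𝓝 (t ^ 2 * (0 + (p:ℝ))⁻¹)) := by
      refine tendsto_const_nhds.mul (Tendsto.inv₀ ?_ ?_)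
      · exact (tendsto_const_div_atTop_nhds_zero_nat (r : ℝ)).add_const _
      · positivity
    rw [zero_add, ← div_eq_mul_inv] at h1
    refine h1.congr' ?_
    filter_upwards [eventually_gt_atTop 0] with m hm
    have hm' : (0 : ℝ) < m := by exact_mod_cast hm
    rw [div_pow, Real.sq_sqrt (by positivity)]
    push_cast
    field_simp
  have heq : (fun m : ℕ => φ (t / Real.sqrt ((r + m * p : ℕ) : ℝ)) ^ m) =
      fun m : ℕ => (1 + (φ (t / Real.sqrt ((r + m * p : ℕ) : ℝ)) - 1)) ^ m := by
    ext m; congr 1; ring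
  rw [heq]
  apply Complex.tendsto_one_add_pow_exp_of_tendsto
  have ho := hφ.comp_tendsto hs
  have hz : Tendsto (fun m : ℕ => (m : ℂ) * (φ (t / Real.sqrt ((r + m * p : ℕ) : ℝ)) -
      (1 - (v : ℂ) * ((t / Real.sqrt ((r + m * p : ℕ) : ℝ) : ℝ) : ℂ) ^ 2 / 2))) atTop (𝓝 0) := by
    have h2 := (Asymptotics.isBigO_refl (fun m : ℕ => (m : ℝ)) atTop).mul_isLittleO ho.norm_left
    have h3 := h2.trans_isBigO (hratio.isBigO_one ℝ)
    have h4 := (Asymptotics.isLittleO_one_iff ℝ).1 (h3.norm_left)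
    rw [tendsto_zero_iff_norm_tendsto_zero]
    simpa using h4
  have hc : Tendsto (fun m : ℕ => -((v : ℂ) * (((m : ℝ) * (t / Real.sqrt ((r + m * p : ℕ) : ℝ)) ^ 2 : ℝ) : ℂ) / 2))
      atTop (𝓝 (-((v : ℂ) * ((t ^ 2 / p : ℝ) : ℂ) / 2))) := by
    have := (Complex.continuous_ofReal.tendsto _).comp hratio
    exact ((tendsto_const_nhds.mul this).div_const _).neg
  have hfin := hz.add hc
  have e : (0 + -((v : ℂ) * ((t ^ 2 / p : ℝ) : ℂ) / 2)) = -((v / p : ℝ) : ℂ) * t ^ 2 / 2 := by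
    push_cast; ring
  rw [e] at hfin
  refine hfin.congr fun m => ?_
  push_cast
  ring

lemma clt_abstract (φ : ℕ → ℝ → ℂ) (V : ℕ → ℝ) (σ : ℝ)
    (hφ1 : ∀ n s, ‖φ n s‖ ≤ 1) (hφc : ∀ n, ContinuousAt (φ n) 0) (hφ0 : ∀ n, φ n 0 = 1)
    (hT : ∀ n, (fun t : ℝ => φ n t - (1 - (V n : ℂ) * (t : ℂ) ^ 2 / 2)) =o[𝓝 0] fun t : ℝ => t ^ 2)
    (K : ∀ a b s, ‖φ (a + b) s - φ a s * φ b s‖ ≤ 2 * s ^ 2 * (V (a + b) - V a - V b))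
    (hV : Tendsto (fun n : ℕ => V n / n) atTop (𝓝 σ)) (t : ℝ) :
    Tendsto (fun n : ℕ => φ n (t / Real.sqrt n)) atTop
      (𝓝 (Complex.exp (-(σ : ℂ) * t ^ 2 / 2))) := by
  have K' : ∀ r p m s, ‖φ (r + m * p) s - φ r s * φ p s ^ m‖ ≤
      2 * s ^ 2 * (V (r + m * p) - V r - m * V p) := by
    intro r p m s
    induction m with
    | zero => simp
    | succ m ih =>
      have h1 := K (r + m * p) p s
      have e : r + (m + 1) * p = r + m * p + p := by ring
      rw [e]
      have h2 : φ (r + m * p + p) s - φ r s * φ p s ^ (m + 1) =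
        (φ (r + m * p + p) s - φ (r + m * p) s * φ p s) +
          (φ (r + m * p) s - φ r s * φ p s ^ m) * φ p s := by ring
      rw [h2]
      refine (norm_add_le _ _).trans ?_
      rw [norm_mul]
      have h3 : ‖φ (r + m * p) s - φ r s * φ p s ^ m‖ * ‖φ p s‖ ≤
        ‖φ (r + m * p) s - φ r s * φ p s ^ m‖ := mul_le_of_le_one_right (norm_nonneg _) (hφ1 _ _)
      push_cast
      linarith
  rw [Metric.tendsto_atTop']
  intro ε hε
  -- choose p
  have hp1 : Tendsto (fun p : ℕ => 2 * t ^ 2 * (σ - V p / p) +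
      ‖Complex.exp (-((V p / p : ℝ) : ℂ) * t ^ 2 / 2) - Complex.exp (-(σ : ℂ) * t ^ 2 / 2)‖) atTop
      (𝓝 (2 * t ^ 2 * (σ - σ) +
      ‖Complex.exp (-(σ : ℂ) * t ^ 2 / 2) - Complex.exp (-(σ : ℂ) * t ^ 2 / 2)‖)) := by
    have hc : Continuous fun x : ℝ => 2 * t ^ 2 * (σ - x) +
      ‖Complex.exp (-(x : ℂ) * t ^ 2 / 2) - Complex.exp (-(σ : ℂ) * t ^ 2 / 2)‖ := by fun_prop
    exact (hc.tendsto σ).comp hV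
  rw [sub_self, sub_self, norm_zero, mul_zero, add_zero] at hp1
  obtain ⟨p, hpe, hp⟩ := ((hp1.eventually_lt_const hε).and (eventually_gt_atTop 0)).exists
  have hp' : (0 : ℝ) < p := by exact_mod_cast hp
  have hr : ∀ r : ℕ, ∀ᶠ m : ℕ in atTop,
      dist (φ (r + m * p) (t / Real.sqrt ((r + m * p : ℕ) : ℝ)))
        (Complex.exp (-(σ : ℂ) * t ^ 2 / 2)) < ε := by
    intro r
    have hNn : Tendsto (fun m : ℕ => r + m * p) atTop atTop := by
      refine tendsto_atTop_mono (fun m => ?_) tendsto_id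
      simp only [id]; nlinarith
    have hN : Tendsto (fun m : ℕ => ((r + m * p : ℕ) : ℝ)) atTop atTop :=
      tendsto_natCast_atTop_atTop.comp hNn
    have hs : Tendsto (fun m : ℕ => t / Real.sqrt ((r + m * p : ℕ) : ℝ)) atTop (𝓝 0) :=
      tendsto_const_nhds.div_atTop (Real.tendsto_sqrt_atTop.comp hN)
    have hlim1 := charFun_pow_limit (φ p) (V p) (hT p) p r hp t
    have hlim2 : Tendsto (fun m : ℕ => φ r (t / Real.sqrt ((r + m * p : ℕ) : ℝ))) atTop (𝓝 1) := by
      have := (hφc r).tendsto.comp hs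
      rwa [hφ0] at this
    have hlim3 : Tendsto (fun m : ℕ => 2 * (t / Real.sqrt ((r + m * p : ℕ) : ℝ)) ^ 2 *
        (V (r + m * p) - V r - m * V p)) atTop (𝓝 (2 * t ^ 2 * (σ - V p / p))) := by
      have q1 := hV.comp hNn
      have q2 : Tendsto (fun m : ℕ => V r / ((r + m * p : ℕ) : ℝ)) atTop (𝓝 0) :=
        tendsto_const_nhds.div_atTop hN
      have q3 : Tendsto (fun m : ℕ => V p * ((r : ℝ) / m + p)⁻¹) atTop
          (𝓝 (V p * (0 + (p:ℝ))⁻¹)) := by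
        refine tendsto_const_nhds.mul (Tendsto.inv₀ ?_ ?_)
        · exact (tendsto_const_div_atTop_nhds_zero_nat (r : ℝ)).add_const _
        · positivity
      have q4 := ((q1.sub q2).sub q3).const_mul (2 * t ^ 2)
      rw [zero_add, ← div_eq_mul_inv, sub_zero] at q4
      refine q4.congr' ?_
      filter_upwards [eventually_gt_atTop 0] with m hm
      have hm' : (0 : ℝ) < m := by exact_mod_cast hm
      rw [div_pow, Real.sq_sqrt (by positivity)]
      simp only [Function.comp]
      push_cast
      field_simp
    have hlim4 := (hlim2.mul hlim1).sub_const (Complex.exp (-(σ : ℂ) * t ^ 2 / 2))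
    rw [one_mul] at hlim4
    have hlim5 := hlim3.add hlim4.norm
    filter_upwards [hlim5.eventually_lt_const hpe] with m hm
    rw [dist_eq_norm]
    refine lt_of_le_of_lt ?_ hm
    refine le_trans ?_ (add_le_add_left (K' r p m _) _)
    refine le_trans (le_of_eq ?_) (norm_add_le _ _)
    congr 1
    ring
  have hall : ∀ᶠ m : ℕ in atTop, ∀ r ∈ Finset.range p,
      dist (φ (r + m * p) (t / Real.sqrt ((r + m * p : ℕ) : ℝ)))
        (Complex.exp (-(σ : ℂ) * t ^ 2 / 2)) < ε :=
    (Filter.eventually_all_finset _).2 fun r _ => hr r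
  obtain ⟨M, hM⟩ := eventually_atTop.1 hall
  refine ⟨M * p, fun n hn => ?_⟩
  have h1 : M ≤ n / p := (Nat.le_div_iff_mul_le hp).2 hn.le
  have h2 := hM _ h1 (n % p) (Finset.mem_range.2 (Nat.mod_lt _ hp))
  have e : n % p + n / p * p = n := Nat.mod_add_div' n p
  rwa [e] at h2

/-- **Newman's stationary CLT for associated sequences.**
If `X₀, X₁, …` is a strictly stationary associated sequence of centered, square-integrable
random variables such that `σ² = Var(X₀) + 2 ∑_{j≥1} Cov(X₀, Xⱼ)` is finite, then
`Sₙ/√n` converges in distribution to `N(0, σ²)`. -/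
theorem stationary_clt_associated
    {Ω : Type*} [MeasurableSpace Ω] (μ : Measure Ω) [IsProbabilityMeasure μ]
    (X : ℕ → Ω → ℝ)
    (hmeas : ∀ i, Measurable (X i))
    (hL2 : ∀ i, MemLp (X i) 2 μ)
    (hmean : ∀ i, ∫ ω, X i ω ∂μ = 0)
    (hassoc : IsAssociatedSeq μ X)
    (hstat : ∀ k n : ℕ,
      μ.map (fun ω => fun i : Fin n => X (i.1 + k) ω)
        = μ.map (fun ω => fun i : Fin n => X i.1 ω))
    (hsum : Summable (fun j : ℕ => cov μ (X 0) (X (j + 1))))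
    (σ2 : NNReal)
    (hσ : (σ2 : ℝ) = variance (X 0) μ + 2 * ∑' j : ℕ, cov μ (X 0) (X (j + 1))) :
    TendstoInDistrib μ
      (fun n ω => (∑ i ∈ Finset.range n, X i ω) / Real.sqrt n)
      (gaussianReal 0 σ2) := by
  have hX2 : ∀ (n k : ℕ), MemLp (fun ω => ∑ i ∈ Finset.range n, X (i + k) ω) 2 μ := fun n k =>
    memLp_finsetSum _ fun i _ => hL2 (i + k)
  have hXm : ∀ (n k : ℕ), Measurable (fun ω => ∑ i ∈ Finset.range n, X (i + k) ω) := fun n k =>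
    Finset.measurable_fun_sum _ fun i _ => hmeas (i + k)
  have hS2 : ∀ (n : ℕ), MemLp (fun ω => ∑ i ∈ Finset.range n, X i ω) 2 μ := fun n => hX2 n 0
  have hSm : ∀ (n : ℕ), Measurable (fun ω => ∑ i ∈ Finset.range n, X i ω) := fun n => hXm n 0
  have hS0 : ∀ (n : ℕ), ∫ ω, ∑ i ∈ Finset.range n, X i ω ∂μ = 0 := by
    intro n
    rw [integral_finsetSum _ fun i _ => (hL2 i).integrable (by norm_num)]
    exact Finset.sum_eq_zero fun i _ => hmean i
  -- stationarity
  have hG : ∀ (k n : ℕ) (G : (Fin n → ℝ) → ℝ), Measurable G →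
      μ.map (fun ω => G (fun i => X (i.1 + k) ω)) = μ.map (fun ω => G (fun i => X i.1 ω)) := by
    intro k n G hGm
    have h1 : Measurable (fun ω => fun i : Fin n => X (i.1 + k) ω) :=
      measurable_pi_lambda _ fun i => hmeas _
    have h2 : Measurable (fun ω => fun i : Fin n => X i.1 ω) :=
      measurable_pi_lambda _ fun i => hmeas _
    have h := congrArg (Measure.map G) (hstat k n)
    rw [Measure.map_map hGm h1, Measure.map_map hGm h2] at h
    exact h
  have hmapS : ∀ k n : ℕ, μ.map (fun ω => ∑ i ∈ Finset.range n, X (i + k) ω) =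
      μ.map (fun ω => ∑ i ∈ Finset.range n, X i ω) := by
    intro k n
    have h := hG k n (fun x => ∑ i, x i) (by fun_prop)
    simpa only [Finset.sum_range] using h
  have hid : ∀ k n : ℕ, IdentDistrib (fun ω => ∑ i ∈ Finset.range n, X (i + k) ω)
      (fun ω => ∑ i ∈ Finset.range n, X i ω) μ μ := fun k n =>
    ⟨(hXm n k).aemeasurable, (hSm n).aemeasurable, hmapS k n⟩
  -- positivity of covariances
  have H : ∀ a b : ℕ, ∀ f g : ℝ → ℝ, Monotone f → Monotone g →
      MemLp (fun ω => f (∑ i ∈ Finset.range a, X i ω)) 2 μ →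
      MemLp (fun ω => g (∑ i ∈ Finset.range b, X (i + a) ω)) 2 μ →
      0 ≤ covariance (fun ω => f (∑ i ∈ Finset.range a, X i ω))
        (fun ω => g (∑ i ∈ Finset.range b, X (i + a) ω)) μ := by
    intro a b f g hf hg mf mg
    have ef : (fun ω => f (∑ i ∈ Finset.range a, X i ω)) =
        fun ω => f (∑ i : Fin a, X ((Fin.castAdd b i : Fin (a + b)) : ℕ) ω) := by
      ext ω; simp [Finset.sum_range]
    have eg : (fun ω => g (∑ i ∈ Finset.range b, X (i + a) ω)) =
        fun ω => g (∑ i : Fin b, X ((Fin.natAdd a i : Fin (a + b)) : ℕ) ω) := by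
      ext ω; simp [Finset.sum_range, add_comm]
    rw [covariance_eq_sub mf mg]
    rw [ef] at mf ⊢
    rw [eg] at mg ⊢
    exact hassoc (a + b) (fun i => i.1) (fun x => f (∑ i : Fin a, x (Fin.castAdd b i)))
      (fun x => g (∑ i : Fin b, x (Fin.natAdd a i)))
      (fun x y hxy => hf (Finset.sum_le_sum fun i _ => hxy _))
      (fun x y hxy => hg (Finset.sum_le_sum fun i _ => hxy _))
      (mf.integrable (by norm_num)) (mg.integrable (by norm_num)) (mf.integrable_mul mg)
  have hsplit : ∀ a b : ℕ, (fun ω => ∑ i ∈ Finset.range (a + b), X i ω) =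
      fun ω => (∑ i ∈ Finset.range a, X i ω) + ∑ i ∈ Finset.range b, X (i + a) ω := by
    intro a b; ext ω
    rw [Finset.sum_range_add]
    simp only [add_comm]
  have hVadd : ∀ a b : ℕ, variance (fun ω => ∑ i ∈ Finset.range (a + b), X i ω) μ =
      variance (fun ω => ∑ i ∈ Finset.range a, X i ω) μ +
      2 * covariance (fun ω => ∑ i ∈ Finset.range a, X i ω)
        (fun ω => ∑ i ∈ Finset.range b, X (i + a) ω) μ +
      variance (fun ω => ∑ i ∈ Finset.range b, X i ω) μ := by
    intro a b
    rw [hsplit, ← (hid a b).variance_eq]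
    exact variance_add (hS2 a) (hX2 b a)
  -- covariances by stationarity
  have hcov : ∀ i d : ℕ, covariance (X i) (X (i + d)) μ = cov μ (X 0) (X d) := by
    intro i d
    have h := hG i (d + 1) (fun x => x 0 * x (Fin.last d)) (by fun_prop)
    rw [covariance_eq_sub (hL2 _) (hL2 _), cov, hmean, hmean, hmean, hmean]
    congr 1
    have h' : IdentDistrib (fun ω => X (0 + i) ω * X (d + i) ω) (fun ω => X 0 ω * X d ω) μ μ :=
      ⟨((hmeas _).mul (hmeas _)).aemeasurable, ((hmeas _).mul (hmeas _)).aemeasurable, by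
        simpa using h⟩
    have h2 := h'.integral_eq
    rw [zero_add, add_comm d i] at h2
    exact h2
  have hinc : ∀ n : ℕ, variance (fun ω => ∑ i ∈ Finset.range (n + 1), X i ω) μ -
      variance (fun ω => ∑ i ∈ Finset.range n, X i ω) μ =
      variance (X 0) μ + 2 * ∑ j ∈ Finset.range n, cov μ (X 0) (X (j + 1)) := by
    intro n
    rw [hVadd n 1]
    have e : covariance (fun ω => ∑ i ∈ Finset.range n, X i ω)
        (fun ω => ∑ i ∈ Finset.range 1, X (i + n) ω) μ =
        ∑ j ∈ Finset.range n, cov μ (X 0) (X (j + 1)) := by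
      simp only [Finset.sum_range_one, zero_add]
      rw [covariance_fun_sum_left' (fun i _ => hL2 i) (hL2 n), ← Finset.sum_range_reflect]
      refine Finset.sum_congr rfl fun j hj => ?_
      have hj' := Finset.mem_range.1 hj
      have := hcov (n - 1 - j) (j + 1)
      rwa [show n - 1 - j + (j + 1) = n by omega] at this
    rw [e]
    simp only [Finset.sum_range_one]
    change _ + _ + variance (X 0) μ - _ = _
    ring
  have hVlim : Tendsto (fun n : ℕ => variance (fun ω => ∑ i ∈ Finset.range n, X i ω) μ / n)
      atTop (𝓝 (σ2 : ℝ)) := by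
    have h1 : Tendsto (fun n : ℕ => variance (X 0) μ +
        2 * ∑ j ∈ Finset.range n, cov μ (X 0) (X (j + 1))) atTop (𝓝 (σ2 : ℝ)) := by
      rw [hσ]
      exact (hsum.hasSum.tendsto_sum_nat.const_mul 2).const_add _
    have h2 := h1.cesaro
    refine h2.congr fun n => ?_
    rw [← Finset.sum_congr rfl fun i _ => hinc i,
      Finset.sum_range_sub (fun n => variance (fun ω => ∑ i ∈ Finset.range n, X i ω) μ)]
    have : variance (fun ω => ∑ i ∈ Finset.range 0, X i ω) μ = 0 := by
      simp only [Finset.sum_range_zero]; exact variance_zero μ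
    rw [this, sub_zero, inv_mul_eq_div]
  have hprob : ∀ n : ℕ, IsProbabilityMeasure (μ.map (fun ω => ∑ i ∈ Finset.range n, X i ω)) :=
    fun n => Measure.isProbabilityMeasure_map (hSm n).aemeasurable
  have hmain := clt_abstract (fun n => charFun (μ.map (fun ω => ∑ i ∈ Finset.range n, X i ω)))
    (fun n => variance (fun ω => ∑ i ∈ Finset.range n, X i ω) μ) σ2
    (fun n s => by have := hprob n; exact norm_charFun_le_one s)
    (fun n => by have := hprob n; exact continuous_charFun.continuousAt)
    (fun n => by have := hprob n; simp)
    (fun n => taylor_charFun_gen μ _ (hSm n) (hS2 n) (hS0 n))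
    (fun a b s => by
      have h := newman_charFun μ _ _ (hSm a) (hXm b a) (hS2 a) (hX2 b a) (H a b) s
      rw [hmapS a b, ← hsplit] at h
      refine h.trans (le_of_eq ?_)
      simp only [hVadd a b]
      ring)
    hVlim
  -- Levy
  have hZm : ∀ n : ℕ, Measurable (fun ω => (∑ i ∈ Finset.range n, X i ω) / Real.sqrt n) :=
    fun n => (hSm n).div_const _
  let Q : ℕ → ProbabilityMeasure ℝ := fun n =>
    ⟨μ.map (fun ω => (∑ i ∈ Finset.range n, X i ω) / Real.sqrt n),
      Measure.isProbabilityMeasure_map (hZm n).aemeasurable⟩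
  let Q0 : ProbabilityMeasure ℝ := ⟨gaussianReal 0 σ2, inferInstance⟩
  have hQ : Tendsto Q atTop (𝓝 Q0) := by
    refine ProbabilityMeasure.tendsto_iff_tendsto_charFun.2 fun t => ?_
    have e0 : charFun (Q0 : Measure ℝ) t = Complex.exp (-((σ2 : ℝ) : ℂ) * t ^ 2 / 2) := by
      change charFun (gaussianReal 0 σ2) t = _
      rw [charFun_gaussianReal]
      congr 1
      push_cast
      ring
    rw [e0]
    refine (hmain t).congr fun n => ?_
    change _ = charFun (μ.map (fun ω => (∑ i ∈ Finset.range n, X i ω) / Real.sqrt n)) t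
    have e1 : (fun ω => (∑ i ∈ Finset.range n, X i ω) / Real.sqrt n) =
        fun ω => (Real.sqrt n)⁻¹ * (∑ i ∈ Finset.range n, X i ω) := by
      ext ω; rw [div_eq_inv_mul]
    rw [e1, charFun_map_mul_comp (hSm n).aemeasurable, div_eq_inv_mul]
  intro f hf ⟨C, hC⟩
  have h := (ProbabilityMeasure.tendsto_iff_forall_integral_tendsto.1 hQ)
    (BoundedContinuousFunction.ofNormedAddCommGroup f hf C hC)
  refine h.congr fun n => ?_
  change ∫ x, f x ∂(μ.map (fun ω => (∑ i ∈ Finset.range n, X i ω) / Real.sqrt n)) = _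
  exact integral_map (hZm n).aemeasurable hf.aestronglyMeasurable
end
end

section
/- (Cox–Grimmett) Let X₁, X₂, … be an associated sequence of mean-zero real random variables. Suppose there are finite constants c₁ > 0 and c₂ > 0 such that Var(X_j) ≥ c₁ and E|X_j|³ ≤ c₂ for all j ≥ 1, and suppose there is a function u : ℕ → ℝ with u(r) → 0 as r → ∞ such that for every r ≥ 1, sup_{j≥1} ∑_{i : |i−j| ≥ r} Cov(X_i, X_j) ≤ u(r). Then S_n/s_n converges in distribution to the standard normal law N(0,1) as n → ∞. -/
open MeasureTheory ProbabilityTheory Filter Topology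

noncomputable section

lemma cg_exp_taylor (x : ℝ) :
    ‖Complex.exp ((x : ℂ) * Complex.I) - (1 + (x : ℂ) * Complex.I - (x : ℂ) ^ 2 / 2)‖
      ≤ 4 * |x| ^ 3 := by
  rcases le_or_gt |x| 1 with h | h
  · have hn : ‖(x : ℂ) * Complex.I‖ = |x| := by simp
    have := Complex.exp_bound (x := (x : ℂ) * Complex.I) (by rw [hn]; exact h) (n := 3) (by norm_num)
    rw [hn] at this
    have e : ∑ m ∈ Finset.range 3, ((x : ℂ) * Complex.I) ^ m / (m.factorial : ℂ)
        = 1 + (x : ℂ) * Complex.I - (x : ℂ) ^ 2 / 2 := by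
      simp [Finset.sum_range_succ, Nat.factorial, mul_pow]
      ring
    rw [e] at this
    refine this.trans ?_
    have : 0 ≤ |x| ^ 3 := by positivity
    norm_num [Nat.factorial]
    linarith
  · have h1 : ‖Complex.exp ((x : ℂ) * Complex.I)‖ = 1 := Complex.norm_exp_ofReal_mul_I x
    have h2 : ‖(1 + (x : ℂ) * Complex.I - (x : ℂ) ^ 2 / 2)‖ ≤ 1 + |x| + |x| ^ 2 / 2 := by
      refine (norm_sub_le _ _).trans ?_
      have : ‖(1 + (x : ℂ) * Complex.I)‖ ≤ 1 + |x| := (norm_add_le _ _).trans (by simp)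
      have h3 : ‖(x : ℂ) ^ 2 / 2‖ = |x| ^ 2 / 2 := by simp
      rw [h3]; linarith
    refine (norm_sub_le _ _).trans ?_
    have h4 : |x| ≤ |x| ^ 3 := by nlinarith [sq_nonneg |x|, mul_pos (by linarith : 0 < |x|) (by linarith : 0 < |x|)]
    have h5 : |x| ^ 2 ≤ |x| ^ 3 := by nlinarith [sq_nonneg |x|]
    rw [h1]; linarith

lemma cg_exp_quad {y : ℝ} (hy : 0 ≤ y) : |1 - y - Real.exp (-y)| ≤ y ^ 2 := by
  have h0 := Real.add_one_le_exp (-y)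
  rw [abs_le]
  constructor
  · rcases le_or_gt y 1 with h | h
    · have := Real.norm_exp_sub_one_sub_id_le (x := -y) (by simpa [abs_of_nonneg hy] using h)
      rw [Real.norm_eq_abs] at this
      have := (abs_le.1 this).2
      simp [abs_of_nonneg hy] at this
      linarith
    · have : Real.exp (-y) ≤ 1 := by simpa using hy
      nlinarith
  · nlinarith [sq_nonneg y]

lemma cg_exp_lip {x y : ℝ} (hx : 0 ≤ x) (hxy : x ≤ y) :
    |Real.exp (-x) - Real.exp (-y)| ≤ y - x := by
  have h1 : Real.exp (-y) = Real.exp (-x) * Real.exp (-(y - x)) := by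
    rw [← Real.exp_add]; congr 1; ring
  have h2 := Real.add_one_le_exp (-(y - x))
  have h3 : Real.exp (-x) ≤ 1 := by simpa using hx
  have h4 : Real.exp (-y) ≤ Real.exp (-x) := by simpa using hxy
  have h5 := Real.exp_pos (-x)
  rw [abs_of_nonneg (by linarith), h1]
  nlinarith

lemma cg_assoc {Ω : Type*} [MeasurableSpace Ω] {μ : Measure Ω} [IsProbabilityMeasure μ]
    {X : ℕ → Ω → ℝ} (hassoc : IsAssociatedSeq μ X) (s t : Finset ℕ) {h g : ℝ → ℝ}
    (hh : Monotone h) (hg : Monotone g)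
    (h1 : MemLp (fun ω => h (∑ i ∈ s, X i ω)) 2 μ)
    (h2 : MemLp (fun ω => g (∑ i ∈ t, X i ω)) 2 μ) :
    0 ≤ covariance (fun ω => h (∑ i ∈ s, X i ω)) (fun ω => g (∑ i ∈ t, X i ω)) μ := by
  obtain ⟨q, hq⟩ := Finset.exists_nat_subset_range (s ∪ t)
  have key : ∀ r : Finset ℕ, r ⊆ s ∪ t → ∀ ω, (∑ i ∈ r, if hi : i < q then X ((⟨i, hi⟩ : Fin q) : ℕ) ω else 0)
      = ∑ i ∈ r, X i ω := by
    intro r hr ω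
    refine Finset.sum_congr rfl fun i hi => ?_
    have : i < q := by simpa using hq (hr hi)
    simp [this]
  have k1 := key s Finset.subset_union_left
  have k2 := key t Finset.subset_union_right
  have mono : ∀ (r : Finset ℕ) (f : ℝ → ℝ), Monotone f →
      CoordwiseMono (n := q) (fun x => f (∑ i ∈ r, if hi : i < q then x ⟨i, hi⟩ else 0)) := by
    intro r f hf x y hxy
    apply hf
    refine Finset.sum_le_sum fun i _ => ?_
    split_ifs
    · exact hxy _
    · exact le_rfl
  have := hassoc q (fun i => (i : ℕ)) _ _ (mono s h hh) (mono t g hg)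
  simp only [k1, k2] at this
  have := this (h1.integrable (by norm_num)) (h2.integrable (by norm_num)) (h1.integrable_mul h2)
  rw [covariance_eq_sub h1 h2]
  exact this

lemma cg_cov_lip {Ω : Type*} [MeasurableSpace Ω] {μ : Measure Ω} [IsProbabilityMeasure μ]
    {X : ℕ → Ω → ℝ} (hmeas : ∀ i, Measurable (X i)) (hL2 : ∀ i, MemLp (X i) 2 μ)
    (hassoc : IsAssociatedSeq μ X) (s t : Finset ℕ) {f g : ℝ → ℝ} {K : ℝ}
    (hfc : Continuous f) (hgc : Continuous g)
    (hfb : ∀ x, |f x| ≤ 1) (hgb : ∀ x, |g x| ≤ 1)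
    (hf : ∀ x y, |f x - f y| ≤ K * |x - y|) (hg : ∀ x y, |g x - g y| ≤ K * |x - y|) :
    |covariance (fun ω => f (∑ i ∈ s, X i ω)) (fun ω => g (∑ i ∈ t, X i ω)) μ| ≤
      K ^ 2 * covariance (fun ω => ∑ i ∈ s, X i ω) (fun ω => ∑ i ∈ t, X i ω) μ := by
  have mL : ∀ r : Finset ℕ, MemLp (fun ω => ∑ i ∈ r, X i ω) 2 μ :=
    fun r => memLp_finsetSum r (fun i _ => hL2 i)
  have mm : ∀ r : Finset ℕ, Measurable (fun ω => ∑ i ∈ r, X i ω) :=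
    fun r => Finset.measurable_fun_sum r (fun i _ => hmeas i)
  have mf : ∀ (r : Finset ℕ) (f : ℝ → ℝ), Continuous f → (∀ x, |f x| ≤ 1) →
      MemLp (fun ω => f (∑ i ∈ r, X i ω)) 2 μ := fun r f hf hb =>
    MemLp.of_bound (hf.measurable.comp (mm r)).aestronglyMeasurable 1
      (Eventually.of_forall fun ω => hb _)
  have mono : ∀ (f : ℝ → ℝ), (∀ x y, |f x - f y| ≤ K * |x - y|) → ∀ e : ℝ, |e| ≤ 1 →
      Monotone (fun x => K * x + e * f x) := by
    intro f hf e he x y hxy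
    have h1 := hf x y
    rw [abs_sub_comm x y, abs_of_nonneg (sub_nonneg.2 hxy)] at h1
    have h2 : |e * (f x - f y)| ≤ 1 * (K * (y - x)) := by
      rw [abs_mul]; exact mul_le_mul he h1 (abs_nonneg _) zero_le_one
    have := (abs_le.1 h2).2
    simp only
    nlinarith
  set A := fun ω => ∑ i ∈ s, X i ω with hA
  set B := fun ω => ∑ i ∈ t, X i ω with hB
  have hA2 := mL s
  have hB2 := mL t
  have hf2 := mf s f hfc hfb
  have hg2 := mf t g hgc hgb
  have main : ∀ e d : ℝ, |e| ≤ 1 → |d| ≤ 1 →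
      0 ≤ K ^ 2 * covariance A B μ + K * d * covariance A (fun ω => g (B ω)) μ
        + e * K * covariance (fun ω => f (A ω)) B μ
        + e * d * covariance (fun ω => f (A ω)) (fun ω => g (B ω)) μ := by
    intro e d he hd
    have a1 : MemLp (fun ω => K * A ω) 2 μ := hA2.const_mul K
    have a2 : MemLp (fun ω => e * f (A ω)) 2 μ := hf2.const_mul e
    have b1 : MemLp (fun ω => K * B ω) 2 μ := hB2.const_mul K
    have b2 : MemLp (fun ω => d * g (B ω)) 2 μ := hg2.const_mul d
    have := cg_assoc hassoc s t (mono f hf e he) (mono g hg d hd) (a1.add a2) (b1.add b2)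
    have e1 : covariance (fun ω => K * A ω + e * f (A ω)) (fun ω => K * B ω + d * g (B ω)) μ
      = K ^ 2 * covariance A B μ + K * d * covariance A (fun ω => g (B ω)) μ
        + e * K * covariance (fun ω => f (A ω)) B μ
        + e * d * covariance (fun ω => f (A ω)) (fun ω => g (B ω)) μ := by
      rw [show (fun ω => K * A ω + e * f (A ω)) = (fun ω => K * A ω) + (fun ω => e * f (A ω)) from rfl,
        show (fun ω => K * B ω + d * g (B ω)) = (fun ω => K * B ω) + (fun ω => d * g (B ω)) from rfl,
        covariance_add_left a1 a2 (b1.add b2), covariance_add_right a1 b1 b2,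
        covariance_add_right a2 b1 b2]
      simp only [covariance_const_mul_left, covariance_const_mul_right]
      ring
    rw [← e1]; exact this
  have p1 := main 1 1 (by simp) (by simp)
  have p2 := main 1 (-1) (by simp) (by simp)
  have p3 := main (-1) 1 (by simp) (by simp)
  have p4 := main (-1) (-1) (by simp) (by simp)
  change |covariance (fun ω => f (A ω)) (fun ω => g (B ω)) μ| ≤ K ^ 2 * covariance A B μ
  rw [abs_le]
  constructor <;> linarith

lemma cg_integrable_exp {Ω : Type*} [MeasurableSpace Ω] {μ : Measure Ω} [IsProbabilityMeasure μ]
    {A : Ω → ℝ} (hA : Measurable A) (a : ℝ) :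
    Integrable (fun ω => Complex.exp (((a * A ω : ℝ) : ℂ) * Complex.I)) μ := by
  refine Integrable.of_bound (C := 1) ?_ ?_
  · exact Measurable.aestronglyMeasurable (by fun_prop)
  · exact Eventually.of_forall fun ω => (Complex.norm_exp_ofReal_mul_I _).le

lemma cg_exp_split {Ω : Type*} [MeasurableSpace Ω] {μ : Measure Ω} [IsProbabilityMeasure μ]
    {A : Ω → ℝ} (hA : Measurable A) (a : ℝ) :
    ∫ ω, Complex.exp (((a * A ω : ℝ) : ℂ) * Complex.I) ∂μ
      = ((∫ ω, Real.cos (a * A ω) ∂μ : ℝ) : ℂ)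
        + ((∫ ω, Real.sin (a * A ω) ∂μ : ℝ) : ℂ) * Complex.I := by
  have h := integral_re_add_im (cg_integrable_exp (μ := μ) hA a)
  simp only [RCLike.re_to_complex, RCLike.im_to_complex, Complex.exp_ofReal_mul_I_re,
    Complex.exp_ofReal_mul_I_im] at h
  exact h.symm

lemma cg_cov_exp {Ω : Type*} [MeasurableSpace Ω] {μ : Measure Ω} [IsProbabilityMeasure μ]
    {X : ℕ → Ω → ℝ} (hmeas : ∀ i, Measurable (X i)) (hL2 : ∀ i, MemLp (X i) 2 μ)
    (hassoc : IsAssociatedSeq μ X) (s t : Finset ℕ) (a : ℝ) :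
    ‖∫ ω, Complex.exp (((a * (∑ i ∈ s, X i ω + ∑ i ∈ t, X i ω) : ℝ) : ℂ) * Complex.I) ∂μ
      - (∫ ω, Complex.exp (((a * (∑ i ∈ s, X i ω) : ℝ) : ℂ) * Complex.I) ∂μ)
        * (∫ ω, Complex.exp (((a * (∑ i ∈ t, X i ω) : ℝ) : ℂ) * Complex.I) ∂μ)‖
    ≤ 4 * a ^ 2 * covariance (fun ω => ∑ i ∈ s, X i ω) (fun ω => ∑ i ∈ t, X i ω) μ := by
  have mm : ∀ r : Finset ℕ, Measurable (fun ω => ∑ i ∈ r, X i ω) :=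
    fun r => Finset.measurable_fun_sum r (fun i _ => hmeas i)
  have mA := mm s
  have mB := mm t
  have lcos : ∀ x y, |Real.cos (a * x) - Real.cos (a * y)| ≤ |a| * |x - y| := by
    intro x y
    have := Real.abs_cos_sub_cos_le (a * x) (a * y)
    rwa [← mul_sub, abs_mul] at this
  have lsin : ∀ x y, |Real.sin (a * x) - Real.sin (a * y)| ≤ |a| * |x - y| := by
    intro x y
    have := Real.abs_sin_sub_sin_le (a * x) (a * y)
    rwa [← mul_sub, abs_mul] at this
  have ccos : Continuous fun x => Real.cos (a * x) := by fun_prop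
  have csin : Continuous fun x => Real.sin (a * x) := by fun_prop
  have bcos : ∀ x, |Real.cos (a * x)| ≤ 1 := fun x => Real.abs_cos_le_one _
  have bsin : ∀ x, |Real.sin (a * x)| ≤ 1 := fun x => Real.abs_sin_le_one _
  have q1 := cg_cov_lip hmeas hL2 hassoc s t ccos ccos bcos bcos lcos lcos
  have q2 := cg_cov_lip hmeas hL2 hassoc s t csin csin bsin bsin lsin lsin
  have q3 := cg_cov_lip hmeas hL2 hassoc s t ccos csin bcos bsin lcos lsin
  have q4 := cg_cov_lip hmeas hL2 hassoc s t csin ccos bsin bcos lsin lcos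
  set A := fun ω => ∑ i ∈ s, X i ω with hA
  set B := fun ω => ∑ i ∈ t, X i ω with hB
  have mf : ∀ (A : Ω → ℝ) (f : ℝ → ℝ), Measurable A → Continuous f → (∀ x, |f x| ≤ 1) →
      MemLp (fun ω => f (A ω)) 2 μ := fun A f hA hf hb =>
    MemLp.of_bound (hf.measurable.comp hA).aestronglyMeasurable 1
      (Eventually.of_forall fun ω => hb _)
  have cA := mf A _ mA ccos bcos
  have sA := mf A _ mA csin bsin
  have cB := mf B _ mB ccos bcos
  have sB := mf B _ mB csin bsin
  have r1 := covariance_eq_sub cA cB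
  have r2 := covariance_eq_sub sA sB
  have r3 := covariance_eq_sub cA sB
  have r4 := covariance_eq_sub sA cB
  have i1 : Integrable (fun ω => Real.cos (a * A ω) * Real.cos (a * B ω)) μ :=
    cA.integrable_mul cB
  have i2 : Integrable (fun ω => Real.sin (a * A ω) * Real.sin (a * B ω)) μ :=
    sA.integrable_mul sB
  have i3 : Integrable (fun ω => Real.cos (a * A ω) * Real.sin (a * B ω)) μ :=
    cA.integrable_mul sB
  have i4 : Integrable (fun ω => Real.sin (a * A ω) * Real.cos (a * B ω)) μ :=
    sA.integrable_mul cB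
  rw [sq_abs] at q1 q2 q3 q4
  have e0 := cg_exp_split (μ := μ) (mA.add mB) a
  simp only [Pi.add_apply, mul_add, Real.cos_add, Real.sin_add] at e0
  rw [integral_sub i1 i2, integral_add i4 i3] at e0
  change ‖∫ ω, Complex.exp (((a * (A ω + B ω) : ℝ) : ℂ) * Complex.I) ∂μ
      - (∫ ω, Complex.exp (((a * A ω : ℝ) : ℂ) * Complex.I) ∂μ)
        * (∫ ω, Complex.exp (((a * B ω : ℝ) : ℂ) * Complex.I) ∂μ)‖ ≤ 4 * a ^ 2 * covariance A B μ
  simp only [mul_add]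
  rw [e0, cg_exp_split mA, cg_exp_split mB]
  simp only [Pi.mul_def] at r1 r2 r3 r4
  have e5 : ∀ p1 p2 p3 p4 x y z w : ℝ, (((p1 - p2 : ℝ) : ℂ) + ((p4 + p3 : ℝ) : ℂ) * Complex.I)
      - ((x : ℂ) + (y : ℂ) * Complex.I) * ((z : ℂ) + (w : ℂ) * Complex.I)
      = (((p1 - x * z) - (p2 - y * w) : ℝ) : ℂ)
        + (((p4 - y * z) + (p3 - x * w) : ℝ) : ℂ) * Complex.I := by
    intros
    push_cast
    ring_nf
    simp only [Complex.I_sq]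
    ring
  rw [e5, ← r1, ← r2, ← r3, ← r4]
  refine (norm_add_le _ _).trans ?_
  rw [norm_mul, Complex.norm_I, mul_one, Complex.norm_real, Complex.norm_real, Real.norm_eq_abs,
    Real.norm_eq_abs]
  refine (add_le_add (abs_sub _ _) (abs_add_le _ _)).trans ?_
  linarith

lemma cg_step {Ω : Type*} [MeasurableSpace Ω] {μ : Measure Ω} [IsProbabilityMeasure μ]
    {X : ℕ → Ω → ℝ} (hmeas : ∀ i, Measurable (X i)) (hL2 : ∀ i, MemLp (X i) 2 μ)
    (hmean : ∀ i, ∫ ω, X i ω ∂μ = 0)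
    (hassoc : IsAssociatedSeq μ X) (s t : Finset ℕ) (a K : ℝ)
    (hint3 : Integrable (fun ω => |∑ i ∈ t, X i ω| ^ 3) μ)
    (hK3 : ∫ ω, |∑ i ∈ t, X i ω| ^ 3 ∂μ ≤ K)
    (hK2 : variance (fun ω => ∑ i ∈ t, X i ω) μ ≤ K) :
    ‖∫ ω, Complex.exp (((a * (∑ i ∈ s, X i ω + ∑ i ∈ t, X i ω) : ℝ) : ℂ) * Complex.I) ∂μ
      - (Real.exp (-(a ^ 2 * variance (fun ω => ∑ i ∈ s, X i ω + ∑ i ∈ t, X i ω) μ / 2)) : ℂ)‖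
    ≤ ‖∫ ω, Complex.exp (((a * (∑ i ∈ s, X i ω) : ℝ) : ℂ) * Complex.I) ∂μ
      - (Real.exp (-(a ^ 2 * variance (fun ω => ∑ i ∈ s, X i ω) μ / 2)) : ℂ)‖
      + (5 * a ^ 2 * covariance (fun ω => ∑ i ∈ s, X i ω) (fun ω => ∑ i ∈ t, X i ω) μ
        + 4 * |a| ^ 3 * K + a ^ 4 * K ^ 2) := by
  have mL : ∀ r : Finset ℕ, MemLp (fun ω => ∑ i ∈ r, X i ω) 2 μ :=
    fun r => memLp_finsetSum r (fun i _ => hL2 i)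
  have mm : ∀ r : Finset ℕ, Measurable (fun ω => ∑ i ∈ r, X i ω) :=
    fun r => Finset.measurable_fun_sum r (fun i _ => hmeas i)
  have hcov0 : 0 ≤ covariance (fun ω => ∑ i ∈ s, X i ω) (fun ω => ∑ i ∈ t, X i ω) μ :=
    cg_assoc hassoc s t (h := fun x => x) (g := fun x => x) monotone_id monotone_id (mL s) (mL t)
  have T1 := cg_cov_exp hmeas hL2 hassoc s t a
  have hB0 : ∫ ω, ∑ i ∈ t, X i ω ∂μ = 0 := by
    rw [integral_finsetSum _ (fun i _ => (hL2 i).integrable (by norm_num))]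
    simp [hmean]
  have mA := mm s
  have mB := mm t
  have hA2 := mL s
  have hB2 := mL t
  have hvar := variance_add hA2 hB2
  change variance (fun ω => ∑ i ∈ s, X i ω + ∑ i ∈ t, X i ω) μ = _ at hvar
  rw [hvar]
  set A := fun ω => ∑ i ∈ s, X i ω with hA
  set B := fun ω => ∑ i ∈ t, X i ω with hB
  change ‖∫ ω, Complex.exp (((a * (A ω + B ω) : ℝ) : ℂ) * Complex.I) ∂μ
      - (∫ ω, Complex.exp (((a * A ω : ℝ) : ℂ) * Complex.I) ∂μ)
        * (∫ ω, Complex.exp (((a * B ω : ℝ) : ℂ) * Complex.I) ∂μ)‖ ≤ 4 * a ^ 2 * covariance A B μ at T1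
  change ∫ ω, B ω ∂μ = 0 at hB0
  change ∫ ω, |B ω| ^ 3 ∂μ ≤ K at hK3
  change Integrable (fun ω => |B ω| ^ 3) μ at hint3
  have hV : variance B μ = ∫ ω, B ω ^ 2 ∂μ := variance_of_integral_eq_zero mB.aemeasurable hB0
  have hV0 : 0 ≤ variance B μ := variance_nonneg _ _
  have hVA : 0 ≤ variance A μ := variance_nonneg _ _
  set V := variance B μ with hVdef
  set W := variance A μ with hWdef
  set C := covariance A B μ with hCdef
  have iB : Integrable B μ := hB2.integrable (by norm_num)
  have iB2 : Integrable (fun ω => B ω ^ 2) μ := hB2.integrable_sq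
  have iE := cg_integrable_exp (μ := μ) mB a
  have T3 : ‖∫ ω, Complex.exp (((a * B ω : ℝ) : ℂ) * Complex.I) ∂μ
      - ((1 - a ^ 2 * V / 2 : ℝ) : ℂ)‖ ≤ 4 * |a| ^ 3 * K := by
    have i2 : Integrable (fun ω => (((a * B ω : ℝ) : ℂ) * Complex.I)) μ :=
      ((iB.const_mul a).ofReal).mul_const _
    have i3 : Integrable (fun ω => (((a * B ω : ℝ) : ℂ) ^ 2 / 2)) μ := by
      have := ((iB2.const_mul (a ^ 2 / 2)).ofReal (𝕜 := ℂ))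
      refine this.congr (Eventually.of_forall fun ω => ?_)
      simp; ring
    have i4 : Integrable (fun ω => 1 + ((a * B ω : ℝ) : ℂ) * Complex.I) μ :=
      (integrable_const _).add i2
    have i5 : Integrable (fun ω => 1 + ((a * B ω : ℝ) : ℂ) * Complex.I
      - ((a * B ω : ℝ) : ℂ) ^ 2 / 2) μ := i4.sub i3
    have e1 : ∫ ω, (1 + ((a * B ω : ℝ) : ℂ) * Complex.I - ((a * B ω : ℝ) : ℂ) ^ 2 / 2) ∂μ
        = ((1 - a ^ 2 * V / 2 : ℝ) : ℂ) := by
      rw [integral_sub i4 i3, integral_add (integrable_const _) i2,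
        integral_mul_const, integral_complex_ofReal, integral_const_mul, hB0]
      have : ∫ ω, ((a * B ω : ℝ) : ℂ) ^ 2 / 2 ∂μ = ((a ^ 2 / 2 * V : ℝ) : ℂ) := by
        rw [hV, ← integral_const_mul, ← integral_complex_ofReal]
        refine integral_congr_ae (Eventually.of_forall fun ω => ?_)
        simp; ring
      rw [this]
      simp
      ring
    rw [← e1, ← integral_sub iE i5]
    refine (norm_integral_le_integral_norm _).trans ?_
    have : ∫ ω, 4 * |a| ^ 3 * |B ω| ^ 3 ∂μ ≤ 4 * |a| ^ 3 * K := by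
      rw [integral_const_mul]
      gcongr
    refine le_trans ?_ this
    refine integral_mono (iE.sub i5).norm
      (hint3.const_mul _) fun ω => ?_
    refine (cg_exp_taylor (a * B ω)).trans_eq ?_
    rw [abs_mul]; ring
  have hy : 0 ≤ a ^ 2 * V / 2 := by positivity
  have T4 := cg_exp_quad hy
  have T4' : (a ^ 2 * V / 2) ^ 2 ≤ a ^ 4 * K ^ 2 := by
    have : V ^ 2 ≤ K ^ 2 := by gcongr
    have h4 : 0 ≤ a ^ 4 := by positivity
    have := mul_le_mul_of_nonneg_left this h4
    nlinarith [mul_nonneg h4 (sq_nonneg V)]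
  have T5 := cg_exp_lip hy (show a ^ 2 * V / 2 ≤ a ^ 2 * V / 2 + a ^ 2 * C from by
    have : 0 ≤ a ^ 2 * C := by positivity
    linarith)
  have nB : ‖∫ ω, Complex.exp (((a * B ω : ℝ) : ℂ) * Complex.I) ∂μ‖ ≤ 1 := by
    refine (norm_integral_le_integral_norm _).trans ?_
    simp only [Complex.norm_exp_ofReal_mul_I]
    simp
  have nA : Real.exp (-(a ^ 2 * W / 2)) ≤ 1 := by
    have : 0 ≤ a ^ 2 * W / 2 := by positivity
    simpa using this
  have hexp : Real.exp (-(a ^ 2 * (W + 2 * C + V) / 2))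
      = Real.exp (-(a ^ 2 * W / 2)) * Real.exp (-(a ^ 2 * V / 2 + a ^ 2 * C)) := by
    rw [← Real.exp_add]; congr 1; ring
  rw [hexp]
  change ‖∫ ω, Complex.exp (((a * (A ω + B ω) : ℝ) : ℂ) * Complex.I) ∂μ - _‖ ≤
    ‖(∫ ω, Complex.exp (((a * A ω : ℝ) : ℂ) * Complex.I) ∂μ) - _‖ + _
  generalize (∫ ω, Complex.exp (((a * (A ω + B ω) : ℝ) : ℂ) * Complex.I) ∂μ) = φ at *
  generalize (∫ ω, Complex.exp (((a * A ω : ℝ) : ℂ) * Complex.I) ∂μ) = φA at *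
  generalize (∫ ω, Complex.exp (((a * B ω : ℝ) : ℂ) * Complex.I) ∂μ) = φB at *
  have hEA := Real.exp_pos (-(a ^ 2 * W / 2))
  generalize Real.exp (-(a ^ 2 * W / 2)) = EA at *
  generalize Real.exp (-(a ^ 2 * V / 2 + a ^ 2 * C)) = E2 at *
  generalize Real.exp (-(a ^ 2 * V / 2)) = E1 at *
  have dec : φ - ((EA * E2 : ℝ) : ℂ) = (φ - φA * φB) + (φA - (EA : ℂ)) * φB
      + (EA : ℂ) * (φB - ((1 - a ^ 2 * V / 2 : ℝ) : ℂ))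
      + (((EA * (1 - a ^ 2 * V / 2 - E1) : ℝ) : ℂ) + ((EA * (E1 - E2) : ℝ) : ℂ)) := by
    push_cast; ring
  rw [dec]
  have u1 : ‖(φA - (EA : ℂ)) * φB‖ ≤ ‖φA - (EA : ℂ)‖ := by
    rw [norm_mul]; exact mul_le_of_le_one_right (norm_nonneg _) nB
  have nEA : ‖(EA : ℂ)‖ ≤ 1 := by
    rw [Complex.norm_real, Real.norm_eq_abs, abs_of_pos hEA]; exact nA
  have u2 : ‖(EA : ℂ) * (φB - ((1 - a ^ 2 * V / 2 : ℝ) : ℂ))‖ ≤ 4 * |a| ^ 3 * K := by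
    rw [norm_mul]; exact (mul_le_of_le_one_left (norm_nonneg _) nEA).trans T3
  have u3 : ‖((EA * (1 - a ^ 2 * V / 2 - E1) : ℝ) : ℂ)‖ ≤ a ^ 4 * K ^ 2 := by
    rw [Complex.norm_real, Real.norm_eq_abs, abs_mul, abs_of_pos hEA]
    exact ((mul_le_of_le_one_left (abs_nonneg _) nA).trans T4).trans T4'
  have u4 : ‖((EA * (E1 - E2) : ℝ) : ℂ)‖ ≤ a ^ 2 * C := by
    rw [Complex.norm_real, Real.norm_eq_abs, abs_mul, abs_of_pos hEA]
    refine ((mul_le_of_le_one_left (abs_nonneg _) nA).trans T5).trans ?_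
    linarith
  have v1 := norm_add_le ((φ - φA * φB) + (φA - (EA : ℂ)) * φB
      + (EA : ℂ) * (φB - ((1 - a ^ 2 * V / 2 : ℝ) : ℂ)))
      (((EA * (1 - a ^ 2 * V / 2 - E1) : ℝ) : ℂ) + ((EA * (E1 - E2) : ℝ) : ℂ))
  have v2 := norm_add₃_le (a := φ - φA * φB) (b := (φA - (EA : ℂ)) * φB)
      (c := (EA : ℂ) * (φB - ((1 - a ^ 2 * V / 2 : ℝ) : ℂ)))
  have v3 := norm_add_le ((EA * (1 - a ^ 2 * V / 2 - E1) : ℝ) : ℂ) ((EA * (E1 - E2) : ℝ) : ℂ)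
  linarith

lemma cg_moments {Ω : Type*} [MeasurableSpace Ω] {μ : Measure Ω} [IsProbabilityMeasure μ]
    {X : ℕ → Ω → ℝ} (hmeas : ∀ i, Measurable (X i)) (hL2 : ∀ i, MemLp (X i) 2 μ)
    (hmean : ∀ i, ∫ ω, X i ω ∂μ = 0) {c2 : ℝ} (hc2 : 0 < c2)
    (hint3 : ∀ j, Integrable (fun ω => |X j ω| ^ 3) μ)
    (hmom3 : ∀ j, ∫ ω, |X j ω| ^ 3 ∂μ ≤ c2) (t : Finset ℕ) (L : ℕ) (ht : t.card ≤ L) :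
    Integrable (fun ω => |∑ i ∈ t, X i ω| ^ 3) μ ∧
    ∫ ω, |∑ i ∈ t, X i ω| ^ 3 ∂μ ≤ (L : ℝ) ^ 3 * c2 + 1 ∧
    variance (fun ω => ∑ i ∈ t, X i ω) μ ≤ (L : ℝ) ^ 3 * c2 + 1 := by
  have hL2t : MemLp (fun ω => ∑ i ∈ t, X i ω) 2 μ := memLp_finsetSum t (fun i _ => hL2 i)
  have mt : Measurable (fun ω => ∑ i ∈ t, X i ω) :=
    Finset.measurable_fun_sum t (fun i _ => hmeas i)
  have hb : ∀ ω, |∑ i ∈ t, X i ω| ^ 3 ≤ (L : ℝ) ^ 2 * ∑ i ∈ t, |X i ω| ^ 3 := by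
    intro ω
    have h1 : |∑ i ∈ t, X i ω| ^ 3 ≤ (∑ i ∈ t, |X i ω|) ^ 3 := by
      gcongr; exact Finset.abs_sum_le_sum_abs _ _
    have h2 := pow_sum_le_card_mul_sum_pow (s := t) (f := fun i => |X i ω|) (fun i _ => abs_nonneg _) 2
    have h3 : (t.card : ℝ) ≤ L := by exact_mod_cast ht
    refine h1.trans (h2.trans ?_)
    gcongr
  have hi : Integrable (fun ω => (L : ℝ) ^ 2 * ∑ i ∈ t, |X i ω| ^ 3) μ :=
    (integrable_finsetSum t (fun i _ => hint3 i)).const_mul _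
  have h3 : Integrable (fun ω => |∑ i ∈ t, X i ω| ^ 3) μ := by
    refine hi.mono' (Measurable.aestronglyMeasurable (by fun_prop)) (Eventually.of_forall fun ω => ?_)
    rw [Real.norm_eq_abs, abs_of_nonneg (by positivity)]
    exact hb ω
  have h4 : ∫ ω, |∑ i ∈ t, X i ω| ^ 3 ∂μ ≤ (L : ℝ) ^ 3 * c2 := by
    refine (integral_mono h3 hi hb).trans ?_
    rw [integral_const_mul, integral_finsetSum _ (fun i _ => hint3 i)]
    have : ∑ i ∈ t, ∫ ω, |X i ω| ^ 3 ∂μ ≤ L * c2 := by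
      refine (Finset.sum_le_card_nsmul t _ c2 (fun i _ => hmom3 i)).trans ?_
      rw [nsmul_eq_mul]
      gcongr
    calc (L : ℝ) ^ 2 * ∑ i ∈ t, ∫ ω, |X i ω| ^ 3 ∂μ ≤ (L : ℝ) ^ 2 * (L * c2) := by gcongr
      _ = _ := by ring
  refine ⟨h3, by linarith, ?_⟩
  have h0 : ∫ ω, ∑ i ∈ t, X i ω ∂μ = 0 := by
    rw [integral_finsetSum _ (fun i _ => (hL2 i).integrable (by norm_num))]
    simp [hmean]
  rw [variance_of_integral_eq_zero mt.aemeasurable h0]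
  have : ∫ ω, (∑ i ∈ t, X i ω) ^ 2 ∂μ ≤ ∫ ω, (|∑ i ∈ t, X i ω| ^ 3 + 1) ∂μ := by
    refine integral_mono hL2t.integrable_sq (h3.add (integrable_const _)) fun ω => ?_
    simp only
    rw [← sq_abs]
    have := abs_nonneg (∑ i ∈ t, X i ω)
    generalize |∑ i ∈ t, X i ω| = y at *
    rcases le_total y 1 with h | h
    · nlinarith [pow_nonneg this 3]
    · nlinarith [sq_nonneg y]
  rw [integral_add h3 (integrable_const _)] at this
  simp at this
  linarith

lemma cg_cov_block {Ω : Type*} [MeasurableSpace Ω] {μ : Measure Ω} [IsProbabilityMeasure μ]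
    {X : ℕ → Ω → ℝ} (hL2 : ∀ i, MemLp (X i) 2 μ)
    (hassoc : IsAssociatedSeq μ X) {u : ℕ → ℝ}
    (husum : ∀ j r : ℕ, Summable
      (fun i : ℕ => if r ≤ ((i : ℤ) - (j : ℤ)).natAbs then cov μ (X i) (X j) else 0))
    (hubd : ∀ r : ℕ, 1 ≤ r → ∀ j : ℕ,
      (∑' i : ℕ, if r ≤ ((i : ℤ) - (j : ℤ)).natAbs then cov μ (X i) (X j) else 0) ≤ u r)
    (p q L : ℕ) (hq : q ≤ p + L) :
    covariance (fun ω => ∑ i ∈ Finset.range p, X i ω) (fun ω => ∑ i ∈ Finset.Ico p q, X i ω) μ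
      ≤ ∑ d ∈ Finset.range L, u (d + 1) := by
  have hc : ∀ i j, covariance (X i) (X j) μ = cov μ (X i) (X j) :=
    fun i j => covariance_eq_sub (hL2 i) (hL2 j)
  have h0 : ∀ i j, 0 ≤ cov μ (X i) (X j) := by
    intro i j
    rw [← hc]
    have := cg_assoc hassoc {i} {j} (h := fun x => x) (g := fun x => x) monotone_id monotone_id
      (by simpa using hL2 i) (by simpa using hL2 j)
    simpa using this
  have hnn : ∀ r j i : ℕ, 0 ≤ (if r ≤ ((i : ℤ) - (j : ℤ)).natAbs then cov μ (X i) (X j) else 0) := by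
    intro r j i
    split_ifs
    · exact h0 _ _
    · exact le_rfl
  have hu0 : ∀ r, 1 ≤ r → 0 ≤ u r := fun r hr =>
    (tsum_nonneg (hnn r 0)).trans (hubd r hr 0)
  rw [covariance_fun_sum_fun_sum' (fun i _ => hL2 i) (fun i _ => hL2 i), Finset.sum_comm]
  have h1 : ∀ j ∈ Finset.Ico p q, ∑ i ∈ Finset.range p, covariance (X i) (X j) μ ≤ u (j - p + 1) := by
    intro j hj
    have hj' := Finset.mem_Ico.1 hj
    refine le_trans ?_ (hubd (j - p + 1) (by omega) j)
    refine le_trans (le_of_eq ?_) ((husum j (j - p + 1)).sum_le_tsum (Finset.range p)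
      (fun i _ => hnn _ _ _))
    refine Finset.sum_congr rfl fun i hi => ?_
    have hi' := Finset.mem_range.1 hi
    rw [if_pos (by omega), hc]
  refine (Finset.sum_le_sum h1).trans ?_
  rw [Finset.sum_Ico_eq_sum_range]
  simp only [Nat.add_sub_cancel_left]
  exact Finset.sum_le_sum_of_subset_of_nonneg
    (Finset.range_subset_range.2 (by omega)) (fun i _ _ => hu0 _ (by omega))

lemma cg_var_lower {Ω : Type*} [MeasurableSpace Ω] {μ : Measure Ω} [IsProbabilityMeasure μ]
    {X : ℕ → Ω → ℝ} (hL2 : ∀ i, MemLp (X i) 2 μ)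
    (hassoc : IsAssociatedSeq μ X) {c1 : ℝ} (hvar : ∀ j, c1 ≤ variance (X j) μ) (n : ℕ) :
    n * c1 ≤ variance (fun ω => ∑ i ∈ Finset.range n, X i ω) μ := by
  induction n with
  | zero => simp
  | succ n ih =>
    have mL : MemLp (fun ω => ∑ i ∈ Finset.range n, X i ω) 2 μ :=
      memLp_finsetSum _ (fun i _ => hL2 i)
    have h1 := cg_assoc hassoc (Finset.range n) {n} (h := fun x => x) (g := fun x => x)
      monotone_id monotone_id mL (by simpa using hL2 n)
    simp only [Finset.sum_singleton] at h1
    have h2 := variance_add mL (hL2 n)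
    have e : (fun ω => ∑ i ∈ Finset.range (n + 1), X i ω)
        = (fun ω => ∑ i ∈ Finset.range n, X i ω) + X n := by
      funext ω
      simp [Finset.sum_range_succ]
    rw [e, h2]
    have h3 := hvar n
    change 0 ≤ covariance _ (X n) μ at h1
    rw [Nat.cast_add, Nat.cast_one]
    linarith

lemma cg_main_bound {Ω : Type*} [MeasurableSpace Ω] {μ : Measure Ω} [IsProbabilityMeasure μ]
    {X : ℕ → Ω → ℝ} (hmeas : ∀ i, Measurable (X i)) (hL2 : ∀ i, MemLp (X i) 2 μ)
    (hmean : ∀ i, ∫ ω, X i ω ∂μ = 0) (hassoc : IsAssociatedSeq μ X) {c2 : ℝ} (hc2 : 0 < c2)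
    (hint3 : ∀ j, Integrable (fun ω => |X j ω| ^ 3) μ)
    (hmom3 : ∀ j, ∫ ω, |X j ω| ^ 3 ∂μ ≤ c2) {u : ℕ → ℝ}
    (husum : ∀ j r : ℕ, Summable
      (fun i : ℕ => if r ≤ ((i : ℤ) - (j : ℤ)).natAbs then cov μ (X i) (X j) else 0))
    (hubd : ∀ r : ℕ, 1 ≤ r → ∀ j : ℕ,
      (∑' i : ℕ, if r ≤ ((i : ℤ) - (j : ℤ)).natAbs then cov μ (X i) (X j) else 0) ≤ u r)
    (n L : ℕ) (a : ℝ) (k : ℕ) :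
    ‖∫ ω, Complex.exp (((a * (∑ i ∈ Finset.range (min (k * L) n), X i ω) : ℝ) : ℂ)
          * Complex.I) ∂μ
      - (Real.exp (-(a ^ 2 * variance
          (fun ω => ∑ i ∈ Finset.range (min (k * L) n), X i ω) μ / 2)) : ℂ)‖
    ≤ k * (5 * a ^ 2 * (∑ d ∈ Finset.range L, u (d + 1))
        + 4 * |a| ^ 3 * ((L : ℝ) ^ 3 * c2 + 1) + a ^ 4 * ((L : ℝ) ^ 3 * c2 + 1) ^ 2) := by
  induction k with
  | zero =>
    have : variance (fun _ : Ω => (0 : ℝ)) μ = 0 := variance_zero μ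
    simp [this]
  | succ k ih =>
    have hb1 : min (k * L) n ≤ min ((k + 1) * L) n := by
      have : k * L ≤ (k + 1) * L := by gcongr; omega
      omega
    have hb2 : min ((k + 1) * L) n ≤ min (k * L) n + L := by
      have : (k + 1) * L = k * L + L := by ring
      omega
    generalize min ((k + 1) * L) n = q at *
    generalize min (k * L) n = p at *
    obtain ⟨m1, m2, m3⟩ := cg_moments hmeas hL2 hmean hc2 hint3 hmom3 (Finset.Ico p q) L
      (by simp; omega)
    have st := cg_step hmeas hL2 hmean hassoc (Finset.range p) (Finset.Ico p q) a _ m1 m2 m3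
    have cb := cg_cov_block hL2 hassoc husum hubd p q L hb2
    simp only [Finset.sum_range_add_sum_Ico _ hb1] at st
    refine st.trans ?_
    have := mul_le_mul_of_nonneg_left cb (show 0 ≤ 5 * a ^ 2 by positivity)
    rw [Nat.cast_add, Nat.cast_one]
    linarith

/-- **Cox–Grimmett CLT for associated sequences.** If `Var(Xⱼ) ≥ c₁ > 0`,
`E|Xⱼ|³ ≤ c₂ < ∞`, and the Cox coefficient `u(r) = sup_j ∑_{i : |i−j| ≥ r} Cov(Xᵢ, Xⱼ)`
tends to `0`, then `Sₙ/sₙ ⇝ N(0,1)`. -/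
theorem cox_grimmett_clt
    {Ω : Type*} [MeasurableSpace Ω] (μ : Measure Ω) [IsProbabilityMeasure μ]
    (X : ℕ → Ω → ℝ)
    (hmeas : ∀ i, Measurable (X i))
    (hL2 : ∀ i, MemLp (X i) 2 μ)
    (hmean : ∀ i, ∫ ω, X i ω ∂μ = 0)
    (hassoc : IsAssociatedSeq μ X)
    (S : ℕ → Ω → ℝ)
    (hS : ∀ n ω, S n ω = ∑ i ∈ Finset.range n, X i ω)
    (c1 c2 : ℝ) (hc1 : 0 < c1) (hc2 : 0 < c2)
    (hvar : ∀ j, c1 ≤ variance (X j) μ)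
    (hint3 : ∀ j, Integrable (fun ω => |X j ω| ^ 3) μ)
    (hmom3 : ∀ j, ∫ ω, |X j ω| ^ 3 ∂μ ≤ c2)
    (u : ℕ → ℝ)
    (hu : Tendsto u atTop (𝓝 0))
    (husum : ∀ j r : ℕ, Summable
      (fun i : ℕ => if r ≤ ((i : ℤ) - (j : ℤ)).natAbs then cov μ (X i) (X j) else 0))
    (hubd : ∀ r : ℕ, 1 ≤ r → ∀ j : ℕ,
      (∑' i : ℕ, if r ≤ ((i : ℤ) - (j : ℤ)).natAbs then cov μ (X i) (X j) else 0) ≤ u r) :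
    TendstoInDistrib μ
      (fun n ω => S n ω / Real.sqrt (variance (S n) μ))
      (gaussianReal 0 1) := by
  have hS' : ∀ n, S n = fun ω => ∑ i ∈ Finset.range n, X i ω := fun n => funext (hS n)
  have mS : ∀ n, Measurable (S n) := fun n => by
    rw [hS']; exact Finset.measurable_fun_sum _ (fun i _ => hmeas i)
  have mZ : ∀ n, Measurable (fun ω => S n ω / Real.sqrt (variance (S n) μ)) :=
    fun n => (mS n).div_const _
  have hchar : ∀ t : ℝ, Tendsto
      (fun n => charFun (μ.map (fun ω => S n ω / Real.sqrt (variance (S n) μ))) t) atTop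
      (𝓝 (charFun (gaussianReal 0 1) t)) := by
    intro t
    have hlim : charFun (gaussianReal 0 1) t = ((Real.exp (-(t ^ 2 / 2)) : ℝ) : ℂ) := by
      rw [charFun_gaussianReal]
      push_cast
      congr 1
      simp
    rw [hlim]
    have hbound : ∀ L n : ℕ, 1 ≤ L → L ≤ n →
        ‖charFun (μ.map (fun ω => S n ω / Real.sqrt (variance (S n) μ))) t
          - ((Real.exp (-(t ^ 2 / 2)) : ℝ) : ℂ)‖
        ≤ 2 * t ^ 2 / (L * c1) * (5 * (∑ d ∈ Finset.range L, u (d + 1))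
          + 4 * Real.sqrt (t ^ 2 / c1 / n) * ((L : ℝ) ^ 3 * c2 + 1)
          + t ^ 2 / c1 / n * ((L : ℝ) ^ 3 * c2 + 1) ^ 2) := by
      intro L n hL hLn
      have hLpos : (0 : ℝ) < L := by exact_mod_cast hL
      have hLn' : (L : ℝ) ≤ n := by exact_mod_cast hLn
      have hnpos : (0 : ℝ) < n := by linarith
      have hV := cg_var_lower hL2 hassoc hvar n
      rw [← hS' n] at hV
      have hVpos : 0 < variance (S n) μ := lt_of_lt_of_le (by positivity) hV
      have hmin : min ((n / L + 1) * L) n = n := by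
        have := Nat.lt_div_mul_add (a := n) (b := L) (by omega)
        have : (n / L + 1) * L = n / L * L + L := by ring
        omega
      have hb := cg_main_bound hmeas hL2 hmean hassoc hc2 hint3 hmom3 husum hubd n L
        (t / Real.sqrt (variance (S n) μ)) (n / L + 1)
      rw [hmin, ← hS' n] at hb
      simp only [← hS n] at hb
      have hU0 : 0 ≤ ∑ d ∈ Finset.range L, u (d + 1) := by
        have h1 := cg_cov_block hL2 hassoc husum hubd 0 0 L (by omega)
        have h2 := cg_assoc hassoc (Finset.range 0) (Finset.Ico 0 0) (h := fun x => x)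
          (g := fun x => x) monotone_id monotone_id (by simp) (by simp)
        exact h2.trans h1
      set V := variance (S n) μ with hVdef
      set a := t / Real.sqrt V with ha
      set U := ∑ d ∈ Finset.range L, u (d + 1)
      set K := (L : ℝ) ^ 3 * c2 + 1 with hK
      have hKpos : 0 < K := by positivity
      have ha2 : a ^ 2 = t ^ 2 / V := by
        rw [ha, div_pow, Real.sq_sqrt hVpos.le]
      have hae : a ^ 2 * V / 2 = t ^ 2 / 2 := by
        rw [ha2]; field_simp
      have hcf : charFun (μ.map (fun ω => S n ω / Real.sqrt V)) t
          = ∫ ω, Complex.exp (((a * S n ω : ℝ) : ℂ) * Complex.I) ∂μ := by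
        rw [charFun_apply_real, integral_map (mZ n).aemeasurable
          (Measurable.aestronglyMeasurable (by fun_prop))]
        refine integral_congr_ae (Eventually.of_forall fun ω => ?_)
        simp only [ha]
        congr 2
        push_cast
        ring
      rw [hae, ← hcf] at hb
      refine hb.trans ?_
      have hale : a ^ 2 ≤ t ^ 2 / c1 / n := by
        rw [ha2, div_div]
        gcongr
        linarith
      have habs : |a| ≤ Real.sqrt (t ^ 2 / c1 / n) := by
        rw [← Real.sqrt_sq_eq_abs]
        exact Real.sqrt_le_sqrt hale
      have hM : ((n / L + 1 : ℕ) : ℝ) ≤ 2 * n / L := by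
        have : ((n / L : ℕ) : ℝ) ≤ n / L := Nat.cast_div_le
        have h1 : (1 : ℝ) ≤ n / L := by rw [le_div_iff₀ hLpos]; linarith
        push_cast
        have : 2 * (n : ℝ) / L = n / L + n / L := by ring
        linarith
      have hMa : ((n / L + 1 : ℕ) : ℝ) * a ^ 2 ≤ 2 * t ^ 2 / (L * c1) := by
        calc ((n / L + 1 : ℕ) : ℝ) * a ^ 2 ≤ (2 * n / L) * (t ^ 2 / c1 / n) := by gcongr
          _ = _ := by field_simp
      have e3 : |a| ^ 3 = a ^ 2 * |a| := by rw [← sq_abs a]; ring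
      calc _ = (((n / L + 1 : ℕ) : ℝ) * a ^ 2) * (5 * U + 4 * |a| * K + a ^ 2 * K ^ 2) := by
            rw [e3]; ring
        _ ≤ _ := by gcongr
    have hces : Tendsto (fun L : ℕ => (L : ℝ)⁻¹ * ∑ d ∈ Finset.range L, u (d + 1)) atTop (𝓝 0) :=
      ((tendsto_add_atTop_iff_nat 1).2 hu).cesaro
    have hces' : Tendsto (fun L : ℕ => 2 * t ^ 2 / (L * c1) * (5 * ∑ d ∈ Finset.range L, u (d + 1)))
        atTop (𝓝 0) := by
      have := hces.const_mul (10 * t ^ 2 / c1)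
      rw [mul_zero] at this
      refine this.congr fun L => ?_
      rw [div_mul_eq_div_div]
      ring
    rw [Metric.tendsto_atTop]
    intro ε hε
    obtain ⟨L, hL1, hL2'⟩ := ((hces'.eventually (gt_mem_nhds hε)).and (eventually_ge_atTop 1)).exists
    have h0 : Tendsto (fun n : ℕ => t ^ 2 / c1 / (n : ℝ)) atTop (𝓝 0) :=
      tendsto_const_div_atTop_nhds_zero_nat _
    have hs0 : Tendsto (fun n : ℕ => Real.sqrt (t ^ 2 / c1 / (n : ℝ))) atTop (𝓝 0) := by
      have := (Real.continuous_sqrt.tendsto 0).comp h0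
      rw [Real.sqrt_zero] at this
      exact this
    have hfin : Tendsto (fun n : ℕ => 2 * t ^ 2 / (L * c1) * (5 * (∑ d ∈ Finset.range L, u (d + 1))
          + 4 * Real.sqrt (t ^ 2 / c1 / n) * ((L : ℝ) ^ 3 * c2 + 1)
          + t ^ 2 / c1 / n * ((L : ℝ) ^ 3 * c2 + 1) ^ 2)) atTop
        (𝓝 (2 * t ^ 2 / (L * c1) * (5 * (∑ d ∈ Finset.range L, u (d + 1))
          + 4 * 0 * ((L : ℝ) ^ 3 * c2 + 1)
          + 0 * ((L : ℝ) ^ 3 * c2 + 1) ^ 2))) :=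
      (((tendsto_const_nhds.add ((hs0.const_mul 4).mul_const _))).add
        (h0.mul_const _)).const_mul _
    have hlt : 2 * t ^ 2 / (L * c1) * (5 * (∑ d ∈ Finset.range L, u (d + 1))
          + 4 * 0 * ((L : ℝ) ^ 3 * c2 + 1)
          + 0 * ((L : ℝ) ^ 3 * c2 + 1) ^ 2) < ε := by
      simpa using hL1
    obtain ⟨N, hN⟩ := eventually_atTop.1
      ((hfin.eventually (gt_mem_nhds hlt)).and (eventually_ge_atTop L))
    refine ⟨N, fun n hn => ?_⟩
    rw [dist_eq_norm]
    exact (hbound L n hL2' (hN n hn).2).trans_lt (hN n hn).1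
  let P : ℕ → ProbabilityMeasure ℝ := fun n =>
    ⟨μ.map (fun ω => S n ω / Real.sqrt (variance (S n) μ)),
      Measure.isProbabilityMeasure_map (mZ n).aemeasurable⟩
  let P0 : ProbabilityMeasure ℝ := ⟨gaussianReal 0 1, inferInstance⟩
  have hP : Tendsto P atTop (𝓝 P0) := ProbabilityMeasure.tendsto_of_tendsto_charFun hchar
  rw [ProbabilityMeasure.tendsto_iff_forall_integral_tendsto] at hP
  intro f hf hfb
  obtain ⟨C, hC⟩ := hfb
  have h1 := hP (BoundedContinuousFunction.ofNormedAddCommGroup f hf C hC)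
  refine h1.congr fun n => ?_
  change ∫ x, f x ∂(μ.map (fun ω => S n ω / Real.sqrt (variance (S n) μ))) = _
  rw [integral_map (mZ n).aemeasurable hf.measurable.aestronglyMeasurable]
end
end

section
/- (Oliveira) Let X₁, X₂, … be an associated sequence of mean-zero, square-integrable real random variables with s_n² > 0 for all n. For each n let ℓ_n ≥ 1 be an integer, put m_n = ⌊n/ℓ_n⌋ and define the block sums Y_{j,ℓ_n} = ∑_{i=(j−1)ℓ_n+1}^{jℓ_n} X_i for j = 1,…,m_n. Assume m_n → ∞ and that: (a) (1/s_n²)·∑_{j=1}^{m_n} Var(Y_{j,ℓ_n}) → 1; (b) for every t ∈ ℝ, | E exp(i t S_n/s_n) − ∏_{j=1}^{m_n} E exp(i t Y_{j,ℓ_n}/s_n) | → 0; (c) for every ε > 0, (1/s_n²)·∑_{j=1}^{m_n} E[ Y_{j,ℓ_n}² · 1_{|Y_{j,ℓ_n}| ≥ ε s_n} ] → 0. Then S_n/s_n converges in distribution to the standard normal law N(0,1) as n → ∞. -/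
open MeasureTheory ProbabilityTheory Filter Topology

noncomputable section

lemma aux_taylor (x : ℝ) :
    ‖Complex.exp (Complex.I * x) - (1 + Complex.I * x - (x : ℂ) ^ 2 / 2)‖ ≤ 4 * |x| ^ 3 ∧
    ‖Complex.exp (Complex.I * x) - (1 + Complex.I * x - (x : ℂ) ^ 2 / 2)‖ ≤ 4 * x ^ 2 := by
  have hx0 : 0 ≤ |x| := abs_nonneg x
  rw [← sq_abs x]
  rcases le_or_gt |x| 1 with h | h
  · have hn : ‖Complex.I * (x : ℂ)‖ = |x| := by simp
    have h1 := Complex.exp_bound (x := Complex.I * x) (by rw [hn]; exact h) (n := 3) (by norm_num)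
    rw [hn] at h1
    have e : (∑ m ∈ Finset.range 3, (Complex.I * (x : ℂ)) ^ m / (m.factorial : ℂ))
        = 1 + Complex.I * x - (x : ℂ) ^ 2 / 2 := by
      simp [Finset.sum_range_succ, Nat.factorial, mul_pow]
      ring
    rw [e] at h1
    have h2 : |x| ^ 3 * (((3 : ℕ).succ : ℝ) * (((3 : ℕ).factorial : ℝ) * (3 : ℕ))⁻¹)
        ≤ |x| ^ 3 := by
      have : (((3 : ℕ).succ : ℝ) * (((3 : ℕ).factorial : ℝ) * (3 : ℕ))⁻¹) ≤ 1 := by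
        norm_num [Nat.factorial]
      exact mul_le_of_le_one_right (by positivity) this
    have h3 : |x| ^ 3 ≤ |x| ^ 2 := pow_le_pow_of_le_one hx0 h (by norm_num)
    have h4 : 0 ≤ |x| ^ 3 := by positivity
    constructor <;> linarith
  · have h1 : ‖Complex.exp (Complex.I * x) - (1 + Complex.I * x - (x : ℂ) ^ 2 / 2)‖
        ≤ 1 + (1 + |x| + |x| ^ 2 / 2) := by
      refine (norm_sub_le _ _).trans ?_
      rw [Complex.norm_exp_I_mul_ofReal]
      gcongr
      refine (norm_sub_le _ _).trans ?_
      gcongr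
      · refine (norm_add_le _ _).trans ?_
        simp
      · simp
    have h2 : 1 + (1 + |x| + |x| ^ 2 / 2) ≤ 4 * |x| ^ 2 := by nlinarith
    have h3 : |x| ^ 2 ≤ |x| ^ 3 := pow_le_pow_right₀ h.le (by norm_num)
    constructor <;> linarith

lemma aux_exp (a : ℝ) (ha : 0 ≤ a) : |1 - a - Real.exp (-a)| ≤ a ^ 2 := by
  have h1 := Real.add_one_le_exp (-a)
  have h2 := Real.add_one_le_exp a
  have h3 : Real.exp (-a) * Real.exp a = 1 := by rw [← Real.exp_add]; simp
  have h4 := Real.exp_pos (-a)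
  rw [abs_le]
  constructor
  · have h5 : Real.exp (-a) * (a + 1) ≤ 1 := by
      have := mul_le_mul_of_nonneg_left h2 h4.le
      rwa [h3] at this
    have h6 : 1 ≤ (1 - a + a ^ 2) * (a + 1) := by nlinarith [pow_nonneg ha 3]
    have : Real.exp (-a) ≤ 1 - a + a ^ 2 :=
      le_of_mul_le_mul_right (h5.trans h6) (by linarith)
    linarith
  · nlinarith [sq_nonneg a]

lemma aux_prod {ι : Type*} (s : Finset ι) (f g : ι → ℂ)
    (hf : ∀ i ∈ s, ‖f i‖ ≤ 1) (hg : ∀ i ∈ s, ‖g i‖ ≤ 1) :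
    ‖∏ i ∈ s, f i - ∏ i ∈ s, g i‖ ≤ ∑ i ∈ s, ‖f i - g i‖ := by
  classical
  induction s using Finset.induction_on with
  | empty => simp
  | insert a s ha ih =>
    rw [Finset.prod_insert ha, Finset.prod_insert ha, Finset.sum_insert ha]
    have ih' := ih (fun i hi => hf i (Finset.mem_insert_of_mem hi))
      (fun i hi => hg i (Finset.mem_insert_of_mem hi))
    have e : f a * ∏ i ∈ s, f i - g a * ∏ i ∈ s, g i
        = (f a - g a) * ∏ i ∈ s, f i + g a * (∏ i ∈ s, f i - ∏ i ∈ s, g i) := by ring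
    rw [e]
    refine (norm_add_le _ _).trans ?_
    rw [norm_mul, norm_mul]
    have h1 : ‖∏ i ∈ s, f i‖ ≤ 1 := by
      rw [norm_prod]
      exact Finset.prod_le_one (fun _ _ => norm_nonneg _)
        (fun i hi => hf i (Finset.mem_insert_of_mem hi))
    have h2 := hg a (Finset.mem_insert_self a s)
    exact add_le_add (mul_le_of_le_one_right (norm_nonneg _) h1)
      ((mul_le_of_le_one_left (norm_nonneg _) h2).trans ih')

lemma aux_term {Ω : Type*} [MeasurableSpace Ω] (μ : Measure Ω) [IsProbabilityMeasure μ]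
    (Z : Ω → ℝ) (hZm : Measurable Z) (hZ : MemLp Z 2 μ) (h0 : ∫ ω, Z ω ∂μ = 0)
    (t ε : ℝ) (hε : 0 < ε) :
    ‖(∫ ω, Complex.exp (Complex.I * Complex.ofReal (t * Z ω)) ∂μ)
        - (Real.exp (-(t ^ 2 * (∫ ω, Z ω ^ 2 ∂μ) / 2)) : ℂ)‖
      ≤ 4 * |t| ^ 3 * ε * (∫ ω, Z ω ^ 2 ∂μ)
        + 4 * t ^ 2 * (∫ ω in {ω | ε ≤ |Z ω|}, Z ω ^ 2 ∂μ)
        + t ^ 4 * (∫ ω, Z ω ^ 2 ∂μ) * (ε ^ 2 + ∫ ω in {ω | ε ≤ |Z ω|}, Z ω ^ 2 ∂μ) := by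
  have hA : MeasurableSet {ω | ε ≤ |Z ω|} := measurableSet_le measurable_const hZm.abs
  have hsq : Integrable (fun ω => Z ω ^ 2) μ := hZ.integrable_sq
  have hZi : Integrable Z μ := hZ.integrable (by norm_num)
  have hind : Integrable ({ω | ε ≤ |Z ω|}.indicator (fun ω => Z ω ^ 2)) μ := hsq.indicator hA
  rw [← integral_indicator hA]
  set v := ∫ ω, Z ω ^ 2 ∂μ with hv
  set L := ∫ ω, {ω | ε ≤ |Z ω|}.indicator (fun ω => Z ω ^ 2) ω ∂μ with hL
  have hv0 : 0 ≤ v := integral_nonneg fun _ => sq_nonneg _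
  have hvL : v ≤ ε ^ 2 + L := by
    have e : ε ^ 2 + L = ∫ ω, (ε ^ 2 + {ω | ε ≤ |Z ω|}.indicator (fun ω => Z ω ^ 2) ω) ∂μ := by
      rw [integral_add (integrable_const _) hind]; simp [hL]
    rw [e]
    refine integral_mono hsq ((integrable_const _).add hind) fun ω => ?_
    by_cases h : ε ≤ |Z ω|
    · simp only [Set.indicator, Set.mem_ofPred_eq, h, if_true]; nlinarith
    · simp only [Set.indicator, Set.mem_ofPred_eq, h, if_false]
      rw [← sq_abs (Z ω)]
      push Not at h
      nlinarith [abs_nonneg (Z ω)]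
  have hexp : Integrable (fun ω => Complex.exp (Complex.I * Complex.ofReal (t * Z ω))) μ := by
    refine Integrable.of_bound (C := 1) (by fun_prop) (ae_of_all _ fun ω => ?_)
    rw [Complex.norm_exp_I_mul_ofReal]
  have hlin : Integrable (fun ω => Complex.I * ((t * Z ω : ℝ) : ℂ)) μ :=
    ((hZi.const_mul t).ofReal).const_mul _
  have hquad : Integrable (fun ω => ((t * Z ω : ℝ) : ℂ) ^ 2 / 2) μ := by
    have : Integrable (fun ω => ((t ^ 2 / 2 * Z ω ^ 2 : ℝ) : ℂ)) μ :=
      (hsq.const_mul (t ^ 2 / 2)).ofReal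
    refine this.congr (ae_of_all _ fun ω => ?_)
    push_cast; ring
  have haff : Integrable (fun ω => 1 + Complex.I * ((t * Z ω : ℝ) : ℂ)) μ :=
    (integrable_const _).add hlin
  have hpoly : Integrable
      (fun ω => 1 + Complex.I * ((t * Z ω : ℝ) : ℂ) - ((t * Z ω : ℝ) : ℂ) ^ 2 / 2) μ :=
    haff.sub hquad
  have hint : ∫ ω, (1 + Complex.I * ((t * Z ω : ℝ) : ℂ) - ((t * Z ω : ℝ) : ℂ) ^ 2 / 2) ∂μ
      = ((1 - t ^ 2 * v / 2 : ℝ) : ℂ) := by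
    rw [integral_sub haff hquad,
      integral_add (integrable_const _) hlin]
    have e1 : ∫ ω, Complex.I * ((t * Z ω : ℝ) : ℂ) ∂μ = 0 := by
      rw [integral_const_mul, integral_complex_ofReal, integral_const_mul, h0]; simp
    have e2 : ∫ ω, ((t * Z ω : ℝ) : ℂ) ^ 2 / 2 ∂μ = ((t ^ 2 * v / 2 : ℝ) : ℂ) := by
      have : ∀ ω, ((t * Z ω : ℝ) : ℂ) ^ 2 / 2 = ((t ^ 2 / 2 * Z ω ^ 2 : ℝ) : ℂ) := by
        intro ω; push_cast; ring
      simp_rw [this]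
      rw [integral_complex_ofReal, integral_const_mul]
      push_cast; ring
    rw [e1, e2]
    simp
  have h1 : ‖(∫ ω, Complex.exp (Complex.I * Complex.ofReal (t * Z ω)) ∂μ)
      - ((1 - t ^ 2 * v / 2 : ℝ) : ℂ)‖ ≤ 4 * |t| ^ 3 * ε * v + 4 * t ^ 2 * L := by
    rw [← hint, ← integral_sub hexp hpoly]
    have e : 4 * |t| ^ 3 * ε * v + 4 * t ^ 2 * L = ∫ ω, (4 * |t| ^ 3 * ε * Z ω ^ 2
        + 4 * t ^ 2 * {ω | ε ≤ |Z ω|}.indicator (fun ω => Z ω ^ 2) ω) ∂μ := by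
      rw [integral_add (hsq.const_mul _) (hind.const_mul _), integral_const_mul,
        integral_const_mul]
    rw [e]
    refine norm_integral_le_of_norm_le ((hsq.const_mul _).add (hind.const_mul _))
      (ae_of_all _ fun ω => ?_)
    obtain ⟨b1, b2⟩ := aux_taylor (t * Z ω)
    by_cases h : ε ≤ |Z ω|
    · simp only [Set.indicator, Set.mem_ofPred_eq, h, if_true]
      refine b2.trans ?_
      have : 0 ≤ 4 * |t| ^ 3 * ε * Z ω ^ 2 := by positivity
      nlinarith
    · simp only [Set.indicator, Set.mem_ofPred_eq, h, if_false]
      refine b1.trans ?_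
      push Not at h
      rw [abs_mul, mul_pow, ← sq_abs (Z ω), mul_zero, add_zero]
      have : |Z ω| ^ 3 ≤ ε * |Z ω| ^ 2 := by
        rw [pow_succ' |Z ω| 2]; gcongr
      have h3 : 0 ≤ |t| ^ 3 := by positivity
      nlinarith [mul_le_mul_of_nonneg_left this h3]
  have h2 : ‖((1 - t ^ 2 * v / 2 : ℝ) : ℂ) - (Real.exp (-(t ^ 2 * v / 2)) : ℂ)‖
      ≤ t ^ 4 * v * (ε ^ 2 + L) := by
    rw [← Complex.ofReal_sub, Complex.norm_real, Real.norm_eq_abs]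
    refine (aux_exp _ (by positivity)).trans ?_
    have : t ^ 4 * v * v ≤ t ^ 4 * v * (ε ^ 2 + L) := by gcongr
    have h4 : 0 ≤ t ^ 4 * v * v := by positivity
    nlinarith
  calc _ ≤ _ := norm_sub_le_norm_sub_add_norm_sub _ ((1 - t ^ 2 * v / 2 : ℝ) : ℂ) _
    _ ≤ _ := add_le_add h1 h2

lemma aux_sum {Ω : Type*} [MeasurableSpace Ω] (μ : Measure Ω) [IsProbabilityMeasure μ]
    (J : Finset ℕ) (Y : ℕ → Ω → ℝ) (hYm : ∀ j, Measurable (Y j)) (hY : ∀ j, MemLp (Y j) 2 μ)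
    (h0 : ∀ j, ∫ ω, Y j ω ∂μ = 0) (w : ℝ) (hw : 0 < w)
    (t ε : ℝ) (hε : 0 < ε) (V L : ℝ)
    (hV : V = (∑ j ∈ J, variance (Y j) μ) / w)
    (hL : L = (∑ j ∈ J, ∫ ω in {ω | ε * Real.sqrt w ≤ |Y j ω|}, (Y j ω) ^ 2 ∂μ) / w) :
    ‖(∏ j ∈ J, ∫ ω, Complex.exp (Complex.I *
                Complex.ofReal (t * Y j ω / Real.sqrt w)) ∂μ)
        - (Real.exp (-(t ^ 2 * V / 2)) : ℂ)‖
      ≤ 4 * |t| ^ 3 * ε * V + 4 * t ^ 2 * L + t ^ 4 * V * (ε ^ 2 + L) := by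
  have hs : 0 < Real.sqrt w := Real.sqrt_pos.2 hw
  have hsq : Real.sqrt w ^ 2 = w := Real.sq_sqrt hw.le
  set Z : ℕ → Ω → ℝ := fun j ω => Y j ω / Real.sqrt w with hZ
  set v : ℕ → ℝ := fun j => ∫ ω, Z j ω ^ 2 ∂μ with hv
  set l : ℕ → ℝ := fun j => ∫ ω in {ω | ε ≤ |Z j ω|}, Z j ω ^ 2 ∂μ with hl
  have hv0 : ∀ j, 0 ≤ v j := fun j => integral_nonneg fun _ => sq_nonneg _
  have hl0 : ∀ j, 0 ≤ l j := fun j => integral_nonneg fun _ => sq_nonneg _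
  have hV' : V = ∑ j ∈ J, v j := by
    rw [hV, Finset.sum_div]
    refine Finset.sum_congr rfl fun j _ => ?_
    rw [variance_of_integral_eq_zero (hYm j).aemeasurable (h0 j)]
    simp only [hv, hZ, div_pow, hsq, integral_div]
  have hset : ∀ j, {ω | ε ≤ |Z j ω|} = {ω | ε * Real.sqrt w ≤ |Y j ω|} := by
    intro j; ext ω
    simp only [hZ, Set.mem_ofPred_eq, abs_div, abs_of_pos hs, le_div_iff₀ hs]
  have hL' : L = ∑ j ∈ J, l j := by
    rw [hL, Finset.sum_div]
    refine Finset.sum_congr rfl fun j _ => ?_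
    simp only [hl, hset]
    simp only [hZ, div_pow, hsq, integral_div]
  have hexp : (Real.exp (-(t ^ 2 * V / 2)) : ℂ)
      = ∏ j ∈ J, (Real.exp (-(t ^ 2 * v j / 2)) : ℂ) := by
    rw [← Complex.ofReal_prod, ← Real.exp_sum, hV', Finset.sum_neg_distrib, Finset.mul_sum,
      Finset.sum_div]
  rw [hexp]
  refine (aux_prod J _ _ ?_ ?_).trans ?_
  · intro j _
    refine (norm_integral_le_integral_norm _).trans ?_
    simp only [Complex.norm_exp_I_mul_ofReal]
    simp
  · intro j _
    rw [Complex.norm_real, Real.norm_eq_abs, abs_of_pos (Real.exp_pos _), Real.exp_le_one_iff]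
    have := hv0 j
    have : 0 ≤ t ^ 2 * v j / 2 := by positivity
    linarith
  · have hterm : ∀ j ∈ J, ‖(∫ ω, Complex.exp (Complex.I *
                Complex.ofReal (t * Y j ω / Real.sqrt w)) ∂μ)
                - (Real.exp (-(t ^ 2 * v j / 2)) : ℂ)‖
          ≤ 4 * |t| ^ 3 * ε * v j + 4 * t ^ 2 * l j + t ^ 4 * v j * (ε ^ 2 + L) := by
      intro j hj
      have hb := aux_term μ (Z j) ((hYm j).div_const _)
        (by simpa only [hZ, div_eq_inv_mul] using (hY j).const_mul (Real.sqrt w)⁻¹)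
        (by simp only [hZ, integral_div, h0 j, zero_div]) t ε hε
      have hlL : l j ≤ L := by
        rw [hL']; exact Finset.single_le_sum (fun i _ => hl0 i) hj
      have e : ∀ ω, t * Y j ω / Real.sqrt w = t * Z j ω := fun ω => mul_div_assoc _ _ _
      simp only [e]
      refine hb.trans ?_
      have := hv0 j
      change 4 * |t| ^ 3 * ε * v j + 4 * t ^ 2 * l j + t ^ 4 * v j * (ε ^ 2 + l j) ≤ _
      gcongr
    refine (Finset.sum_le_sum hterm).trans (le_of_eq ?_)
    rw [Finset.sum_add_distrib, Finset.sum_add_distrib, ← Finset.mul_sum, ← Finset.mul_sum,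
      ← Finset.sum_mul, ← Finset.mul_sum, ← hV', ← hL']

/-- **Oliveira's CLT for associated sequences (Theorem 4.4 of Oliveira).**
With blocks `Y_{j,ℓₙ}` of length `ℓₙ`, `mₙ = ⌊n/ℓₙ⌋ → ∞`, under the variance normalization
(a), the characteristic-function factorization (b) and the Lindeberg condition (c),
`Sₙ/sₙ ⇝ N(0,1)`. -/
theorem oliveira_clt
    {Ω : Type*} [MeasurableSpace Ω] (μ : Measure Ω) [IsProbabilityMeasure μ]
    (X : ℕ → Ω → ℝ)
    (hmeas : ∀ i, Measurable (X i))
    (hL2 : ∀ i, MemLp (X i) 2 μ)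
    (hmean : ∀ i, ∫ ω, X i ω ∂μ = 0)
    (hassoc : IsAssociatedSeq μ X)
    (S : ℕ → Ω → ℝ)
    (hS : ∀ n ω, S n ω = ∑ i ∈ Finset.range n, X i ω)
    (hspos : ∀ n, 1 ≤ n → 0 < variance (S n) μ)
    (ℓ m : ℕ → ℕ)
    (hℓ1 : ∀ n, 1 ≤ ℓ n)
    (hm : ∀ n, m n = n / ℓ n)
    (hm_top : Tendsto m atTop atTop)
    -- block sums Y_{j,ℓₙ} = ∑_{i=(j−1)ℓₙ+1}^{jℓₙ} Xᵢ = S_{jℓₙ} − S_{(j−1)ℓₙ}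
    (Y : ℕ → ℕ → Ω → ℝ)
    (hY : ∀ j n ω, Y j n ω = S (j * ℓ n) ω - S ((j - 1) * ℓ n) ω)
    -- (a)
    (ha : Tendsto
      (fun n => (∑ j ∈ Finset.Icc 1 (m n), variance (Y j n) μ) / variance (S n) μ)
      atTop (𝓝 1))
    -- (b)
    (hb : ∀ t : ℝ,
      Tendsto
        (fun n =>
          ‖(∫ ω, Complex.exp (Complex.I *
              Complex.ofReal (t * S n ω / Real.sqrt (variance (S n) μ))) ∂μ)
            - ∏ j ∈ Finset.Icc 1 (m n),
              ∫ ω, Complex.exp (Complex.I *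
                Complex.ofReal (t * Y j n ω / Real.sqrt (variance (S n) μ))) ∂μ‖)
        atTop (𝓝 0))
    -- (c)
    (hc : ∀ ε : ℝ, 0 < ε →
      Tendsto
        (fun n => (∑ j ∈ Finset.Icc 1 (m n),
            ∫ ω in {ω | ε * Real.sqrt (variance (S n) μ) ≤ |Y j n ω|}, (Y j n ω) ^ 2 ∂μ) /
          variance (S n) μ)
        atTop (𝓝 0)) :
    TendstoInDistrib μ
      (fun n ω => S n ω / Real.sqrt (variance (S n) μ))
      (gaussianReal 0 1) := by
  have hSfun : ∀ n, S n = fun ω => ∑ i ∈ Finset.range n, X i ω := fun n => funext (hS n)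
  have hSm : ∀ n, Measurable (S n) := by
    intro n; rw [hSfun]; exact Finset.measurable_fun_sum _ fun i _ => hmeas i
  have hS2 : ∀ n, MemLp (S n) 2 μ := by
    intro n; rw [hSfun]; exact memLp_finsetSum _ fun i _ => hL2 i
  have hS0 : ∀ n, ∫ ω, S n ω ∂μ = 0 := by
    intro n
    simp only [hS]
    rw [integral_finsetSum _ fun i _ => (hL2 i).integrable (by norm_num)]
    simp [hmean]
  have hYfun : ∀ j n, Y j n = fun ω => S (j * ℓ n) ω - S ((j - 1) * ℓ n) ω :=
    fun j n => funext (hY j n)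
  have hYm : ∀ j n, Measurable (Y j n) := by
    intro j n; rw [hYfun]; exact (hSm _).sub (hSm _)
  have hY2 : ∀ j n, MemLp (Y j n) 2 μ := by
    intro j n; rw [hYfun]; exact (hS2 _).sub (hS2 _)
  have hY0 : ∀ j n, ∫ ω, Y j n ω ∂μ = 0 := by
    intro j n
    simp only [hY]
    rw [integral_sub ((hS2 _).integrable (by norm_num)) ((hS2 _).integrable (by norm_num)),
      hS0, hS0, sub_zero]
  -- product of block characteristic functions
  have hprod : ∀ t : ℝ, Tendsto (fun n => ∏ j ∈ Finset.Icc 1 (m n),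
              ∫ ω, Complex.exp (Complex.I *
                Complex.ofReal (t * Y j n ω / Real.sqrt (variance (S n) μ))) ∂μ)
        atTop (𝓝 ((Real.exp (-(t ^ 2 * 1 / 2)) : ℝ) : ℂ)) := by
    intro t
    have hg : Tendsto (fun n => ((Real.exp (-(t ^ 2 *
        ((∑ j ∈ Finset.Icc 1 (m n), variance (Y j n) μ) / variance (S n) μ) / 2)) : ℝ) : ℂ))
        atTop (𝓝 ((Real.exp (-(t ^ 2 * 1 / 2)) : ℝ) : ℂ)) := by
      have hcont : Continuous fun x : ℝ => ((Real.exp (-(t ^ 2 * x / 2)) : ℝ) : ℂ) := by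
        fun_prop
      exact (hcont.tendsto 1).comp ha
    refine (tendsto_iff_of_dist ?_).2 hg
    rw [Metric.tendsto_nhds]
    intro δ hδ
    obtain ⟨ε, hε, hεδ⟩ : ∃ ε : ℝ, 0 < ε ∧
        4 * |t| ^ 3 * ε * 1 + 4 * t ^ 2 * 0 + t ^ 4 * 1 * (ε ^ 2 + 0) < δ := by
      have hcont : Continuous fun ε : ℝ =>
          4 * |t| ^ 3 * ε * 1 + 4 * t ^ 2 * 0 + t ^ 4 * 1 * (ε ^ 2 + 0) := by fun_prop
      have h1 := (hcont.tendsto 0).eventually_lt_const (u := δ) (by simpa using hδ)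
      have h2 : ∀ᶠ ε : ℝ in 𝓝[>] 0, 0 < ε := self_mem_nhdsWithin
      exact (h2.and (h1.filter_mono nhdsWithin_le_nhds)).exists
    have hcε := hc ε hε
    have hlim := ((ha.const_mul (4 * |t| ^ 3 * ε)).add (hcε.const_mul (4 * t ^ 2))).add
      ((ha.const_mul (t ^ 4)).mul (hcε.const_add (ε ^ 2)))
    filter_upwards [hlim.eventually_lt_const hεδ, eventually_ge_atTop 1] with n hn hn1
    rw [Real.dist_eq, sub_zero, abs_of_nonneg dist_nonneg, dist_eq_norm]
    exact (aux_sum μ (Finset.Icc 1 (m n)) (fun j => Y j n) (fun j => hYm j n)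
      (fun j => hY2 j n) (fun j => hY0 j n) _ (hspos n hn1) t ε hε _ _ rfl rfl).trans_lt hn
  have hchar : ∀ t : ℝ, Tendsto (fun n => ∫ ω, Complex.exp (Complex.I *
              Complex.ofReal (t * S n ω / Real.sqrt (variance (S n) μ))) ∂μ)
        atTop (𝓝 ((Real.exp (-(t ^ 2 * 1 / 2)) : ℝ) : ℂ)) := by
    intro t
    refine (tendsto_iff_of_dist ?_).2 (hprod t)
    simp only [dist_eq_norm]
    exact hb t
  have hZm : ∀ n, Measurable (fun ω => S n ω / Real.sqrt (variance (S n) μ)) :=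
    fun n => (hSm n).div_const _
  let P : ℕ → ProbabilityMeasure ℝ := fun n =>
    ⟨μ.map (fun ω => S n ω / Real.sqrt (variance (S n) μ)),
      Measure.isProbabilityMeasure_map (hZm n).aemeasurable⟩
  let G : ProbabilityMeasure ℝ := ⟨gaussianReal 0 1, inferInstance⟩
  have hPG : Tendsto P atTop (𝓝 G) := by
    refine ProbabilityMeasure.tendsto_iff_tendsto_charFun.2 fun t => ?_
    have e1 : charFun (G : Measure ℝ) t = ((Real.exp (-(t ^ 2 * 1 / 2)) : ℝ) : ℂ) := by
      change charFun (gaussianReal 0 1) t = _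
      rw [charFun_gaussianReal]
      push_cast
      congr 1
      simp
    rw [e1]
    refine (hchar t).congr fun n => ?_
    change _ = charFun (μ.map (fun ω => S n ω / Real.sqrt (variance (S n) μ))) t
    rw [charFun_apply_real, integral_map (hZm n).aemeasurable (by fun_prop)]
    refine integral_congr_ae (ae_of_all _ fun ω => ?_)
    simp only
    congr 1
    push_cast
    ring
  intro f hf ⟨C, hC⟩
  have := ProbabilityMeasure.tendsto_iff_forall_integral_tendsto.1 hPG
    (BoundedContinuousFunction.ofNormedAddCommGroup f hf C (by simpa using hC))
  refine this.congr fun n => ?_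
  change ∫ x, f x ∂(μ.map (fun ω => S n ω / Real.sqrt (variance (S n) μ))) = _
  rw [integral_map (hZm n).aemeasurable hf.aestronglyMeasurable]
end
end

section
/- (Completed Oliveira theorem) Let X₁, X₂, … be an associated sequence of mean-zero, square-integrable real random variables. Assume: (a) u(1) < ∞ and u(r) → 0 as r → ∞, where u(r) = sup_{j≥1} ∑_{i : |i−j| ≥ r} Cov(X_i, X_j); (b) inf_{n≥1} s_n²/n > 0; (c) for every ε > 0, (1/s_n²)·∑_{j=1}^{n} E[ X_j² · 1_{|X_j| ≥ ε s_n} ] → 0 as n → ∞; (d) for all integer sequences (t_n) and (u_n) with 0 ≤ t_n ≤ u_n ≤ n and (u_n − t_n)/n → 0, one has (1/s_n²)·∑_{i=t_n+1}^{u_n} Var(X_i) → 0 as n → ∞. Then S_n/s_n converges in distribution to the standard normal law N(0,1) as n → ∞. -/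
open MeasureTheory ProbabilityTheory Filter Topology

noncomputable section

/-- Positive quadrant-type dependence used for the Newman inequality. -/
def PAssoc {Ω : Type*} [MeasurableSpace Ω] (μ : Measure Ω) (U V : Ω → ℝ) : Prop :=
  ∀ f g : ℝ → ℝ, Monotone f → Monotone g → MemLp (fun ω => f (U ω)) 2 μ →
    MemLp (fun ω => g (V ω)) 2 μ → 0 ≤ covariance (fun ω => f (U ω)) (fun ω => g (V ω)) μ

section A

variable {Ω : Type*} [MeasurableSpace Ω] {μ : Measure Ω} [IsProbabilityMeasure μ]

lemma mono_of_lip {L : ℝ} {f : ℝ → ℝ} (hf : ∀ x y, |f x - f y| ≤ L * |x - y|) :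
    Monotone (fun x => L * x + f x) := by
  intro x y hxy
  have h := (abs_le.1 (hf y x)).1
  rw [abs_of_nonneg (by linarith : 0 ≤ y - x)] at h
  simp only
  linarith

lemma memLp_lip {f : ℝ → ℝ}
    {C : ℝ} (hC : ∀ x, |f x| ≤ C) {U : Ω → ℝ} (hU : MemLp U 2 μ) (hc : Continuous f) :
    MemLp (fun ω => f (U ω)) 2 μ :=
  MemLp.of_bound (hc.comp_aestronglyMeasurable hU.1) C (ae_of_all _ fun ω => by
    simpa using hC (U ω))

lemma cov_lip_lower {U V : Ω → ℝ} (hP : PAssoc μ U V) (hU : MemLp U 2 μ) (hV : MemLp V 2 μ)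
    {L : ℝ} {f g : ℝ → ℝ}
    (hf : ∀ x y, |f x - f y| ≤ L * |x - y|) (hg : ∀ x y, |g x - g y| ≤ L * |x - y|)
    (hfm : MemLp (fun ω => f (U ω)) 2 μ) (hgm : MemLp (fun ω => g (V ω)) 2 μ) :
    - (L ^ 2 * covariance U V μ) ≤ covariance (fun ω => f (U ω)) (fun ω => g (V ω)) μ := by
  have hLU : MemLp (L • U) 2 μ := hU.const_smul L
  have hLV : MemLp (L • V) 2 μ := hV.const_smul L
  have e1 := hP _ _ (mono_of_lip hf) (mono_of_lip hg) (hLU.add hfm) (hLV.add hgm)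
  have e2 := hP (fun x => L * x + (- f x)) (fun x => L * x + (- g x))
    (mono_of_lip (fun x y => by
      rw [show -f x - -f y = -(f x - f y) by ring, abs_neg]; exact hf x y))
    (mono_of_lip (fun x y => by
      rw [show -g x - -g y = -(g x - g y) by ring, abs_neg]; exact hg x y))
    (hLU.add hfm.neg) (hLV.add hgm.neg)
  change 0 ≤ covariance (L • U + (fun ω => f (U ω))) (L • V + (fun ω => g (V ω))) μ at e1
  change 0 ≤ covariance (L • U + -(fun ω => f (U ω))) (L • V + -(fun ω => g (V ω))) μ at e2
  rw [covariance_add_left hLU hfm (hLV.add hgm), covariance_add_right hLU hLV hgm,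
    covariance_add_right hfm hLV hgm] at e1
  rw [covariance_add_left hLU hfm.neg (hLV.add hgm.neg), covariance_add_right hLU hLV hgm.neg,
    covariance_add_right hfm.neg hLV hgm.neg] at e2
  simp only [covariance_neg_left, covariance_neg_right, covariance_smul_left,
    covariance_smul_right] at e1 e2
  nlinarith

lemma cov_lip {U V : Ω → ℝ} (hP : PAssoc μ U V) (hU : MemLp U 2 μ) (hV : MemLp V 2 μ)
    {L : ℝ} {f g : ℝ → ℝ}
    (hf : ∀ x y, |f x - f y| ≤ L * |x - y|) (hg : ∀ x y, |g x - g y| ≤ L * |x - y|)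
    (hfm : MemLp (fun ω => f (U ω)) 2 μ) (hgm : MemLp (fun ω => g (V ω)) 2 μ) :
    |covariance (fun ω => f (U ω)) (fun ω => g (V ω)) μ| ≤ L ^ 2 * covariance U V μ := by
  have h1 := cov_lip_lower hP hU hV hf hg hfm hgm
  have h2 := cov_lip_lower (g := fun x => - g x) hP hU hV hf (fun x y => by
      rw [show -g x - -g y = -(g x - g y) by ring, abs_neg]; exact hg x y) hfm hgm.neg
  rw [covariance_fun_neg_right] at h2
  rw [abs_le]; constructor <;> linarith

lemma cos_lip (t x y : ℝ) : |Real.cos (t * x) - Real.cos (t * y)| ≤ |t| * |x - y| := by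
  rw [← abs_mul, mul_sub]
  have := Real.lipschitzWith_cos.dist_le_mul (t * x) (t * y)
  simpa [Real.dist_eq] using this

lemma sin_lip (t x y : ℝ) : |Real.sin (t * x) - Real.sin (t * y)| ≤ |t| * |x - y| := by
  rw [← abs_mul, mul_sub]
  have := Real.lipschitzWith_sin.dist_le_mul (t * x) (t * y)
  simpa [Real.dist_eq] using this

/-- the characteristic function of `U` at `t`. -/
def chf (μ : Measure Ω) (U : Ω → ℝ) (t : ℝ) : ℂ := ∫ ω, Complex.exp (((t * U ω : ℝ) : ℂ) * Complex.I) ∂μ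

lemma memLp_cos {U : Ω → ℝ} (hU : MemLp U 2 μ) (t : ℝ) :
    MemLp (fun ω => Real.cos (t * U ω)) 2 μ :=
  memLp_lip (f := fun x => Real.cos (t * x)) (C := 1)
    (fun x => Real.abs_cos_le_one _) hU (by fun_prop)

lemma memLp_sin {U : Ω → ℝ} (hU : MemLp U 2 μ) (t : ℝ) :
    MemLp (fun ω => Real.sin (t * U ω)) 2 μ :=
  memLp_lip (f := fun x => Real.sin (t * x)) (C := 1)
    (fun x => Real.abs_sin_le_one _) hU (by fun_prop)

lemma chf_eq {U : Ω → ℝ} (hU : MemLp U 2 μ) (t : ℝ) :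
    chf μ U t = ((∫ ω, Real.cos (t * U ω) ∂μ : ℝ) : ℂ)
      + ((∫ ω, Real.sin (t * U ω) ∂μ : ℝ) : ℂ) * Complex.I := by
  have h1 : Integrable (fun ω => Real.cos (t * U ω)) μ := (memLp_cos hU t).integrable (by norm_num)
  have h2 : Integrable (fun ω => Real.sin (t * U ω)) μ := (memLp_sin hU t).integrable (by norm_num)
  unfold chf
  rw [← integral_complex_ofReal, ← integral_complex_ofReal, ← integral_mul_const, ← integral_add h1.ofReal
    (h2.ofReal.mul_const _)]
  congr with ω
  rw [Complex.exp_mul_I]; simp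

lemma norm_chf_le (U : Ω → ℝ) (t : ℝ) : ‖chf μ U t‖ ≤ 1 := by
  unfold chf
  refine (norm_integral_le_integral_norm _).trans ?_
  simp only [Complex.norm_exp_ofReal_mul_I]
  simp

lemma newman_two {U V : Ω → ℝ} (hP : PAssoc μ U V) (hU : MemLp U 2 μ) (hV : MemLp V 2 μ)
    (t : ℝ) : ‖chf μ (fun ω => U ω + V ω) t - chf μ U t * chf μ V t‖
      ≤ 4 * t ^ 2 * covariance U V μ := by
  rw [chf_eq (U := fun ω => U ω + V ω) (hU.add hV) t, chf_eq hU, chf_eq hV]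
  have cU := memLp_cos hU t
  have cV := memLp_cos hV t
  have sU := memLp_sin hU t
  have sV := memLp_sin hV t
  have a1 := cov_lip hP hU hV (cos_lip t) (cos_lip t) cU cV
  have a2 := cov_lip hP hU hV (sin_lip t) (sin_lip t) sU sV
  have a3 := cov_lip hP hU hV (cos_lip t) (sin_lip t) cU sV
  have a4 := cov_lip hP hU hV (sin_lip t) (cos_lip t) sU cV
  rw [sq_abs] at a1 a2 a3 a4
  have ec : ∫ ω, Real.cos (t * (U ω + V ω)) ∂μ
      = (∫ ω, Real.cos (t * U ω) * Real.cos (t * V ω) ∂μ)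
        - ∫ ω, Real.sin (t * U ω) * Real.sin (t * V ω) ∂μ := by
    have := integral_sub (cU.integrable_mul cV) (sU.integrable_mul sV)
    simp only [Pi.mul_apply] at this
    rw [← this]
    congr with ω
    rw [mul_add, Real.cos_add]
  have es : ∫ ω, Real.sin (t * (U ω + V ω)) ∂μ
      = (∫ ω, Real.sin (t * U ω) * Real.cos (t * V ω) ∂μ)
        + ∫ ω, Real.cos (t * U ω) * Real.sin (t * V ω) ∂μ := by
    have := integral_add (sU.integrable_mul cV) (cU.integrable_mul sV)
    simp only [Pi.mul_apply] at this
    rw [← this]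
    congr with ω
    rw [mul_add, Real.sin_add]
  have b1 := covariance_eq_sub cU cV
  have b2 := covariance_eq_sub sU sV
  have b3 := covariance_eq_sub cU sV
  have b4 := covariance_eq_sub sU cV
  simp only [Pi.mul_apply] at b1 b2 b3 b4
  set C1 := covariance (fun ω => Real.cos (t * U ω)) (fun ω => Real.cos (t * V ω)) μ
  set C2 := covariance (fun ω => Real.sin (t * U ω)) (fun ω => Real.sin (t * V ω)) μ
  set C3 := covariance (fun ω => Real.cos (t * U ω)) (fun ω => Real.sin (t * V ω)) μ
  set C4 := covariance (fun ω => Real.sin (t * U ω)) (fun ω => Real.cos (t * V ω)) μ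
  have key : ∀ a b c d : ℝ, (((∫ ω, Real.cos (t * (U ω + V ω)) ∂μ : ℝ) : ℂ)
      + ((∫ ω, Real.sin (t * (U ω + V ω)) ∂μ : ℝ) : ℂ) * Complex.I) -
      (((∫ ω, Real.cos (t * U ω) ∂μ : ℝ) : ℂ)
      + ((∫ ω, Real.sin (t * U ω) ∂μ : ℝ) : ℂ) * Complex.I) *
      (((∫ ω, Real.cos (t * V ω) ∂μ : ℝ) : ℂ)
      + ((∫ ω, Real.sin (t * V ω) ∂μ : ℝ) : ℂ) * Complex.I) =
      ((C1 - C2 : ℝ) : ℂ) + ((C3 + C4 : ℝ) : ℂ) * Complex.I := by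
    intro _ _ _ _
    rw [ec, es, b1, b2, b3, b4]
    apply Complex.ext <;> simp <;> ring
  rw [key 0 0 0 0]
  refine (norm_add_le _ _).trans ?_
  rw [norm_mul, Complex.norm_I, mul_one, Complex.norm_real, Complex.norm_real, Real.norm_eq_abs,
    Real.norm_eq_abs]
  have := abs_sub C1 C2
  have := abs_add_le C3 C4
  linarith

lemma newman {Y : ℕ → Ω → ℝ} (hY : ∀ k, MemLp (Y k) 2 μ)
    (hP : ∀ m, PAssoc μ (fun ω => ∑ k ∈ Finset.range m, Y k ω) (Y m)) (t : ℝ) (m : ℕ) :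
    ‖chf μ (fun ω => ∑ k ∈ Finset.range m, Y k ω) t - ∏ k ∈ Finset.range m, chf μ (Y k) t‖
      ≤ 2 * t ^ 2 * (variance (fun ω => ∑ k ∈ Finset.range m, Y k ω) μ
        - ∑ k ∈ Finset.range m, variance (Y k) μ) := by
  induction m with
  | zero =>
    simp only [chf, Finset.range_zero, Finset.sum_empty, Finset.prod_empty, sub_zero]
    have := variance_nonneg (fun _ : Ω => (0 : ℝ)) μ
    simpa using by positivity
  | succ m ih =>
    have hU : MemLp (fun ω => ∑ k ∈ Finset.range m, Y k ω) 2 μ :=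
      memLp_finsetSum _ (fun k _ => hY k)
    simp only [Finset.sum_range_succ, Finset.prod_range_succ]
    rw [variance_fun_add hU (hY m)]
    have h1 := newman_two (hP m) hU (hY m) t
    have h2 : ‖chf μ (fun ω => ∑ k ∈ Finset.range m, Y k ω) t * chf μ (Y m) t
      - (∏ k ∈ Finset.range m, chf μ (Y k) t) * chf μ (Y m) t‖ ≤ 
      2 * t ^ 2 * (variance (fun ω => ∑ k ∈ Finset.range m, Y k ω) μ
        - ∑ k ∈ Finset.range m, variance (Y k) μ) := by
      rw [← sub_mul, norm_mul]
      exact (mul_le_of_le_one_right (norm_nonneg _) (norm_chf_le _ _)).trans ih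
    have h3 := norm_sub_le_norm_sub_add_norm_sub
      (chf μ (fun ω => ∑ k ∈ Finset.range m, Y k ω + Y m ω) t)
      (chf μ (fun ω => ∑ k ∈ Finset.range m, Y k ω) t * chf μ (Y m) t)
      ((∏ k ∈ Finset.range m, chf μ (Y k) t) * chf μ (Y m) t)
    linarith

end A

section B

variable {Ω : Type*} [MeasurableSpace Ω] {μ : Measure Ω} [IsProbabilityMeasure μ]

/-- Taylor remainder of the exponential on the imaginary axis. -/
def trem (y : ℝ) : ℂ := Complex.exp ((y : ℂ) * Complex.I) - 1 - (y : ℂ) * Complex.I + (y : ℂ) ^ 2 / 2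

lemma trem_big (y : ℝ) (hy : 1 < |y|) : ‖trem y‖ ≤ 4 * y ^ 2 := by
  unfold trem
  have h1 : ‖Complex.exp ((y : ℂ) * Complex.I)‖ = 1 := Complex.norm_exp_ofReal_mul_I y
  have h2 : ‖(y : ℂ) * Complex.I‖ = |y| := by simp
  have h3 : ‖(y : ℂ) ^ 2 / 2‖ = y ^ 2 / 2 := by simp
  have a := norm_add_le (Complex.exp ((y : ℂ) * Complex.I) - 1 - (y : ℂ) * Complex.I) ((y : ℂ) ^ 2 / 2)
  have b := norm_sub_le (Complex.exp ((y : ℂ) * Complex.I) - 1) ((y : ℂ) * Complex.I)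
  have c := norm_sub_le (Complex.exp ((y : ℂ) * Complex.I)) 1
  rw [norm_one] at c
  have := sq_abs y
  nlinarith

lemma trem_small (y : ℝ) (hy : |y| ≤ 1) : ‖trem y‖ ≤ |y| ^ 3 := by
  have h2 : ‖(y : ℂ) * Complex.I‖ = |y| := by simp
  have h := Complex.exp_bound (x := (y : ℂ) * Complex.I) (by rw [h2]; exact hy) (n := 3) (by norm_num)
  rw [h2] at h
  have e : Complex.exp ((y : ℂ) * Complex.I) - ∑ m ∈ Finset.range 3, ((y : ℂ) * Complex.I) ^ m / (m.factorial : ℂ)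
      = trem y := by
    unfold trem
    simp [Finset.sum_range_succ, mul_pow]
    ring
  rw [e] at h
  refine h.trans ?_
  norm_num [Nat.factorial]
  nlinarith [pow_nonneg (abs_nonneg y) 3]

lemma trem_two (y : ℝ) : ‖trem y‖ ≤ 4 * y ^ 2 := by
  rcases le_or_gt |y| 1 with h | h
  · refine (trem_small y h).trans ?_
    rw [← sq_abs y]
    nlinarith [sq_nonneg |y|]
  · exact trem_big y h

lemma trem_three (y : ℝ) : ‖trem y‖ ≤ 4 * |y| ^ 3 := by
  rcases le_or_gt |y| 1 with h | h
  · refine (trem_small y h).trans ?_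
    nlinarith [pow_nonneg (abs_nonneg y) 3]
  · refine (trem_big y h).trans ?_
    rw [← sq_abs y]
    nlinarith [sq_nonneg |y|]

lemma trem_bound (t δ y : ℝ) (hδ : 0 ≤ δ) :
    ‖trem (t * y)‖ ≤ 4 * |t| ^ 3 * δ * y ^ 2
      + 4 * t ^ 2 * ({x : ℝ | δ ≤ |x|}.indicator (fun x => x ^ 2) y) := by
  by_cases h : δ ≤ |y|
  · rw [Set.indicator_of_mem (by exact h)]
    have := trem_two (t * y)
    have : 0 ≤ 4 * |t| ^ 3 * δ * y ^ 2 := by positivity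
    nlinarith
  · rw [Set.indicator_of_notMem (by exact h)]
    have h1 := trem_three (t * y)
    push Not at h
    rw [abs_mul, mul_pow] at h1
    have h2 : |y| ^ 3 ≤ δ * y ^ 2 := by
      rw [← sq_abs y]; nlinarith [sq_nonneg |y|]
    have : 0 ≤ 4 * |t| ^ 3 := by positivity
    nlinarith

lemma chf_taylor {Y : Ω → ℝ} (hm : Measurable Y) (hY : MemLp Y 2 μ) (h0 : ∫ ω, Y ω ∂μ = 0)
    (t δ : ℝ) (hδ : 0 ≤ δ) :
    ‖chf μ Y t - ((1 - t ^ 2 * variance Y μ / 2 : ℝ) : ℂ)‖ ≤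
      4 * |t| ^ 3 * δ * variance Y μ + 4 * t ^ 2 * ∫ ω in {ω | δ ≤ |Y ω|}, (Y ω) ^ 2 ∂μ := by
  have hv : variance Y μ = ∫ ω, (Y ω) ^ 2 ∂μ := variance_of_integral_eq_zero hm.aemeasurable h0
  have hsq : Integrable (fun ω => (Y ω) ^ 2) μ := hY.integrable_sq
  have hi : Integrable Y μ := hY.integrable (by norm_num)
  have hexp : Integrable (fun ω => Complex.exp (((t * Y ω : ℝ) : ℂ) * Complex.I)) μ := by
    refine Integrable.of_bound (C := 1) (by fun_prop) (ae_of_all _ fun ω => ?_)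
    rw [Complex.norm_exp_ofReal_mul_I]
  have hset : MeasurableSet {ω | δ ≤ |Y ω|} := measurableSet_le measurable_const (by fun_prop)
  have hind : (fun ω => {x : ℝ | δ ≤ |x|}.indicator (fun x => x ^ 2) (Y ω))
      = {ω | δ ≤ |Y ω|}.indicator (fun ω => (Y ω) ^ 2) := by
    ext ω; simp [Set.indicator]
  have hindi : Integrable (fun ω => {x : ℝ | δ ≤ |x|}.indicator (fun x => x ^ 2) (Y ω)) μ := by
    rw [hind]; exact hsq.indicator hset
  have e : chf μ Y t - ((1 - t ^ 2 * variance Y μ / 2 : ℝ) : ℂ) = ∫ ω, trem (t * Y ω) ∂μ := by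
    have : (fun ω => trem (t * Y ω)) = fun ω => Complex.exp (((t * Y ω : ℝ) : ℂ) * Complex.I) - 1
       - ((t * Y ω : ℝ) : ℂ) * Complex.I + ((t ^ 2 / 2 * (Y ω) ^ 2 : ℝ) : ℂ) := by
      ext ω; unfold trem; push_cast; ring
    rw [this, integral_add, integral_sub, integral_sub hexp (integrable_const _), integral_mul_const,
      integral_complex_ofReal, integral_complex_ofReal, integral_const_mul, integral_const_mul, h0, ← hv]
    · simp [chf]; ring
    · exact hexp.sub (integrable_const _)
    · exact ((hi.const_mul t).ofReal).mul_const _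
    · exact (hexp.sub (integrable_const _)).sub (((hi.const_mul t).ofReal).mul_const _)
    · exact (hsq.const_mul _).ofReal
  rw [e]
  calc ‖∫ ω, trem (t * Y ω) ∂μ‖ ≤ ∫ ω, (4 * |t| ^ 3 * δ * (Y ω) ^ 2
      + 4 * t ^ 2 * ({x : ℝ | δ ≤ |x|}.indicator (fun x => x ^ 2) (Y ω))) ∂μ := by
        apply norm_integral_le_of_norm_le
        · exact (hsq.const_mul _).add (hindi.const_mul _)
        · exact ae_of_all _ fun ω => trem_bound t δ (Y ω) hδ
    _ = _ := by
        rw [integral_add (hsq.const_mul _) (hindi.const_mul _), integral_const_mul, integral_const_mul,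
          hv, hind, integral_indicator hset]

lemma exp_neg_bound (x : ℝ) (hx : 0 ≤ x) : |Real.exp (-x) - (1 - x)| ≤ x ^ 2 := by
  rcases le_or_gt x 1 with h | h
  · have := Real.abs_exp_sub_one_sub_id_le (x := -x) (by rw [abs_neg, abs_of_nonneg hx]; exact h)
    rw [show Real.exp (-x) - (1 - x) = Real.exp (-x) - 1 - -x by ring]
    simpa using this
  · have h1 := Real.add_one_le_exp (-x)
    have h2 : Real.exp (-x) ≤ 1 := Real.exp_le_one_iff.2 (by linarith)
    rw [abs_of_nonneg (by linarith)]
    nlinarith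

lemma prod_diff (a b : ℕ → ℂ) (ha : ∀ k, ‖a k‖ ≤ 1) (hb : ∀ k, ‖b k‖ ≤ 1) (m : ℕ) :
    ‖∏ k ∈ Finset.range m, a k - ∏ k ∈ Finset.range m, b k‖
      ≤ ∑ k ∈ Finset.range m, ‖a k - b k‖ := by
  induction m with
  | zero => simp
  | succ m ih =>
    rw [Finset.prod_range_succ, Finset.prod_range_succ, Finset.sum_range_succ]
    have hA : ‖∏ k ∈ Finset.range m, a k‖ ≤ 1 := by
      rw [norm_prod]; exact Finset.prod_le_one (fun _ _ => norm_nonneg _) (fun k _ => ha k)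
    rw [show (∏ k ∈ Finset.range m, a k) * a m - (∏ k ∈ Finset.range m, b k) * b m
      = (∏ k ∈ Finset.range m, a k) * (a m - b m) +
        (∏ k ∈ Finset.range m, a k - ∏ k ∈ Finset.range m, b k) * b m by ring]
    refine (norm_add_le _ _).trans ?_
    rw [norm_mul, norm_mul]
    have h1 := mul_le_of_le_one_left (norm_nonneg (a m - b m)) hA
    have h2 := mul_le_of_le_one_right
      (norm_nonneg (∏ k ∈ Finset.range m, a k - ∏ k ∈ Finset.range m, b k)) (hb m)
    linarith

lemma var_le_lind {Y : Ω → ℝ} (hm : Measurable Y) (hY : MemLp Y 2 μ) (h0 : ∫ ω, Y ω ∂μ = 0)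
    (δ : ℝ) : variance Y μ ≤ δ ^ 2 + ∫ ω in {ω | δ ≤ |Y ω|}, (Y ω) ^ 2 ∂μ := by
  have hv : variance Y μ = ∫ ω, (Y ω) ^ 2 ∂μ := variance_of_integral_eq_zero hm.aemeasurable h0
  have hsq : Integrable (fun ω => (Y ω) ^ 2) μ := hY.integrable_sq
  have hset : MeasurableSet {ω | δ ≤ |Y ω|} := measurableSet_le measurable_const (by fun_prop)
  rw [hv, ← integral_indicator hset]
  calc _ ≤ ∫ ω, (δ ^ 2 + {ω | δ ≤ |Y ω|}.indicator (fun ω => (Y ω) ^ 2) ω) ∂μ := by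
        apply integral_mono hsq ((integrable_const _).add (hsq.indicator hset))
        intro ω
        change (Y ω) ^ 2 ≤ δ ^ 2 + {ω | δ ≤ |Y ω|}.indicator (fun ω => (Y ω) ^ 2) ω
        by_cases h : δ ≤ |Y ω|
        · rw [Set.indicator_of_mem (by exact h)]; nlinarith [sq_nonneg δ]
        · rw [Set.indicator_of_notMem (by exact h)]
          push Not at h
          rw [← sq_abs (Y ω)]
          nlinarith [abs_nonneg (Y ω)]
    _ = _ := by
        rw [integral_add (integrable_const _) (hsq.indicator hset)]; simp

lemma lindeberg {Y : ℕ → Ω → ℝ} (hm : ∀ k, Measurable (Y k)) (hY : ∀ k, MemLp (Y k) 2 μ)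
    (h0 : ∀ k, ∫ ω, Y k ω ∂μ = 0) (t δ : ℝ) (hδ : 0 ≤ δ) (m : ℕ) (Λ A : ℝ)
    (hΛ : ∑ k ∈ Finset.range m, ∫ ω in {ω | δ ≤ |Y k ω|}, (Y k ω) ^ 2 ∂μ = Λ)
    (hA : ∑ k ∈ Finset.range m, variance (Y k) μ = A) (hA1 : A ≤ 1) :
    ‖∏ k ∈ Finset.range m, chf μ (Y k) t - ((Real.exp (- (t ^ 2 * A / 2)) : ℝ) : ℂ)‖
      ≤ 4 * |t| ^ 3 * δ + 4 * t ^ 2 * Λ + t ^ 4 * (δ ^ 2 + Λ) := by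
  have hi : ∀ k, 0 ≤ ∫ ω in {ω | δ ≤ |Y k ω|}, (Y k ω) ^ 2 ∂μ := fun k =>
    integral_nonneg fun ω => sq_nonneg _
  have hΛ0 : 0 ≤ Λ := by rw [← hΛ]; exact Finset.sum_nonneg fun k _ => hi k
  have hexp : ((Real.exp (- (t ^ 2 * A / 2)) : ℝ) : ℂ)
      = ∏ k ∈ Finset.range m, ((Real.exp (- (t ^ 2 * variance (Y k) μ / 2)) : ℝ) : ℂ) := by
    rw [← Complex.ofReal_prod, ← Real.exp_sum, ← hA]
    congr 2
    rw [Finset.mul_sum, Finset.sum_div, Finset.sum_neg_distrib]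
  rw [hexp]
  refine (prod_diff _ _ (fun k => norm_chf_le _ _) (fun k => ?_) m).trans ?_
  · rw [Complex.norm_real, Real.norm_eq_abs, abs_of_nonneg (Real.exp_nonneg _)]
    apply Real.exp_le_one_iff.2
    have := variance_nonneg (Y k) μ
    have : 0 ≤ t ^ 2 * variance (Y k) μ := by positivity
    linarith
  have hterm : ∀ k ∈ Finset.range m, ‖chf μ (Y k) t
      - ((Real.exp (- (t ^ 2 * variance (Y k) μ / 2)) : ℝ) : ℂ)‖ ≤
      4 * |t| ^ 3 * δ * variance (Y k) μ + 4 * t ^ 2 * (∫ ω in {ω | δ ≤ |Y k ω|}, (Y k ω) ^ 2 ∂μ)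
        + t ^ 4 * (δ ^ 2 + Λ) * variance (Y k) μ := by
    intro k hk
    have hv0 := variance_nonneg (Y k) μ
    have h1 := chf_taylor (hm k) (hY k) (h0 k) t δ hδ
    have h2 := exp_neg_bound (t ^ 2 * variance (Y k) μ / 2) (by positivity)
    have h3 : variance (Y k) μ ≤ δ ^ 2 + Λ := by
      refine (var_le_lind (hm k) (hY k) (h0 k) δ).trans ?_
      rw [← hΛ]
      gcongr
      exact Finset.single_le_sum (f := fun k => ∫ ω in {ω | δ ≤ |Y k ω|}, (Y k ω) ^ 2 ∂μ)
        (fun k _ => hi k) hk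
    have h4 : (t ^ 2 * variance (Y k) μ / 2) ^ 2 ≤ t ^ 4 * (δ ^ 2 + Λ) * variance (Y k) μ := by
      have : variance (Y k) μ * variance (Y k) μ ≤ (δ ^ 2 + Λ) * variance (Y k) μ := by gcongr
      have h5 : 0 ≤ t ^ 4 := by positivity
      have h6 : 0 ≤ variance (Y k) μ * variance (Y k) μ := by positivity
      nlinarith
    have h5 := norm_sub_le_norm_sub_add_norm_sub (chf μ (Y k) t)
      ((1 - t ^ 2 * variance (Y k) μ / 2 : ℝ) : ℂ)
      ((Real.exp (- (t ^ 2 * variance (Y k) μ / 2)) : ℝ) : ℂ)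
    rw [← Complex.ofReal_sub _ (Real.exp _), Complex.norm_real, Real.norm_eq_abs, abs_sub_comm] at h5
    linarith
  refine (Finset.sum_le_sum hterm).trans ?_
  rw [Finset.sum_add_distrib, Finset.sum_add_distrib, ← Finset.mul_sum, ← Finset.mul_sum,
    ← Finset.mul_sum, hA, hΛ]
  have e1 : 4 * |t| ^ 3 * δ * A ≤ 4 * |t| ^ 3 * δ := mul_le_of_le_one_right (by positivity) hA1
  have e2 : t ^ 4 * (δ ^ 2 + Λ) * A ≤ t ^ 4 * (δ ^ 2 + Λ) :=
    mul_le_of_le_one_right (by positivity) hA1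
  linarith

end B

section C

variable {Ω : Type*} [MeasurableSpace Ω] {μ : Measure Ω} [IsProbabilityMeasure μ]

lemma cov_eq_covariance {U V : Ω → ℝ} (hU : MemLp U 2 μ) (hV : MemLp V 2 μ) :
    cov μ U V = covariance U V μ := by
  rw [covariance_eq_sub hU hV]; rfl

lemma passoc_of_assoc {X : ℕ → Ω → ℝ} (hassoc : IsAssociatedSeq μ X) (n : ℕ) (a b : ℕ → ℝ)
    (ha : ∀ i, 0 ≤ a i) (hb : ∀ i, 0 ≤ b i) :
    PAssoc μ (fun ω => ∑ i ∈ Finset.range n, a i * X i ω)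
      (fun ω => ∑ i ∈ Finset.range n, b i * X i ω) := by
  intro f g hf hg hfm hgm
  rw [← cov_eq_covariance hfm hgm]
  simp only [Finset.sum_range] at hfm hgm ⊢
  refine hassoc n (fun i => (i : ℕ)) (fun x => f (∑ i : Fin n, a i * x i))
    (fun x => g (∑ i : Fin n, b i * x i)) ?_ ?_ (hfm.integrable (by norm_num))
    (hgm.integrable (by norm_num)) (hfm.integrable_mul hgm)
  · intro x y hxy
    exact hf (Finset.sum_le_sum fun i _ => mul_le_mul_of_nonneg_left (hxy i) (ha i))
  · intro x y hxy
    exact hg (Finset.sum_le_sum fun i _ => mul_le_mul_of_nonneg_left (hxy i) (hb i))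

lemma covariance_nonneg_of_assoc {X : ℕ → Ω → ℝ} (hassoc : IsAssociatedSeq μ X)
    (hL2 : ∀ i, MemLp (X i) 2 μ) (i j : ℕ) : 0 ≤ covariance (X i) (X j) μ := by
  have h := hassoc 2 ![i, j] (fun x => x 0) (fun x => x 1) (fun x y h => h 0) (fun x y h => h 1)
    (by simpa using (hL2 i).integrable (by norm_num))
    (by simpa using (hL2 j).integrable (by norm_num))
    (by
      have h3 : Integrable (fun ω => X i ω * X j ω) μ := (hL2 i).integrable_mul (hL2 j)
      simpa using h3)
  rw [← cov_eq_covariance (hL2 i) (hL2 j)]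
  simpa using h

/-- normalized block sums -/
def blk (X : ℕ → Ω → ℝ) (n p : ℕ) (s : ℝ) (k : ℕ) (ω : Ω) : ℝ :=
  ∑ i ∈ Finset.range n, (if i / p = k then s⁻¹ else 0) * X i ω

lemma sum_blk (X : ℕ → Ω → ℝ) (n p : ℕ) (s : ℝ) (m : ℕ) (ω : Ω) :
    ∑ k ∈ Finset.range m, blk X n p s k ω
      = ∑ i ∈ Finset.range n, (∑ k ∈ Finset.range m, if i / p = k then s⁻¹ else 0) * X i ω := by
  unfold blk
  rw [Finset.sum_comm]
  simp only [Finset.sum_mul]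

lemma sum_blk_all (X : ℕ → Ω → ℝ) (n p : ℕ) (s : ℝ) (ω : Ω) :
    ∑ k ∈ Finset.range n, blk X n p s k ω = (∑ i ∈ Finset.range n, X i ω) / s := by
  rw [sum_blk, div_eq_inv_mul, Finset.mul_sum]
  refine Finset.sum_congr rfl fun i hi => ?_
  rw [Finset.sum_ite_eq, if_pos]
  rw [Finset.mem_range] at hi ⊢
  exact (Nat.div_le_self i p).trans_lt hi

lemma blk_passoc {X : ℕ → Ω → ℝ} (hassoc : IsAssociatedSeq μ X) (n p : ℕ) (s : ℝ) (hs : 0 < s)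
    (m : ℕ) : PAssoc μ (fun ω => ∑ k ∈ Finset.range m, blk X n p s k ω) (blk X n p s m) := by
  simp only [sum_blk]
  have hs' : 0 ≤ s⁻¹ := by positivity
  exact passoc_of_assoc hassoc n _ _
    (fun i => Finset.sum_nonneg fun k _ => by split_ifs <;> simp [hs'])
    (fun i => by split_ifs <;> simp [hs'])

lemma blk_memLp {X : ℕ → Ω → ℝ} (hL2 : ∀ i, MemLp (X i) 2 μ) (n p : ℕ) (s : ℝ) (k : ℕ) :
    MemLp (blk X n p s k) 2 μ :=
  memLp_finsetSum _ fun i _ => (hL2 i).const_mul _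

lemma blk_meas {X : ℕ → Ω → ℝ} (h : ∀ i, Measurable (X i)) (n p : ℕ) (s : ℝ) (k : ℕ) :
    Measurable (blk X n p s k) :=
  Finset.measurable_fun_sum _ fun i _ => (h i).const_mul _

lemma blk_mean {X : ℕ → Ω → ℝ} (hL2 : ∀ i, MemLp (X i) 2 μ) (hmean : ∀ i, ∫ ω, X i ω ∂μ = 0)
    (n p : ℕ) (s : ℝ) (k : ℕ) : ∫ ω, blk X n p s k ω ∂μ = 0 := by
  unfold blk
  rw [integral_finsetSum]
  · refine Finset.sum_eq_zero fun i _ => ?_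
    rw [integral_const_mul, hmean, mul_zero]
  · intro i _
    exact ((hL2 i).integrable (by norm_num)).const_mul _

lemma var_lin {X : ℕ → Ω → ℝ} (hL2 : ∀ i, MemLp (X i) 2 μ) (n : ℕ) (a : ℕ → ℝ) :
    variance (fun ω => ∑ i ∈ Finset.range n, a i * X i ω) μ
      = ∑ i ∈ Finset.range n, ∑ j ∈ Finset.range n, a i * a j * covariance (X i) (X j) μ := by
  rw [variance_fun_sum' (fun i _ => (hL2 i).const_mul (a i))]
  refine Finset.sum_congr rfl fun i _ => Finset.sum_congr rfl fun j _ => ?_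
  rw [covariance_const_mul_left, covariance_const_mul_right]; ring

lemma off_eq {X : ℕ → Ω → ℝ} (hL2 : ∀ i, MemLp (X i) 2 μ) (n p : ℕ) (s : ℝ) :
    variance (fun ω => (∑ i ∈ Finset.range n, X i ω) / s) μ
      - ∑ k ∈ Finset.range n, variance (blk X n p s k) μ
      = (∑ i ∈ Finset.range n, ∑ j ∈ Finset.range n,
          if j / p = i / p then 0 else covariance (X j) (X i) μ) / s ^ 2 := by
  have e1 : (fun ω => (∑ i ∈ Finset.range n, X i ω) / s)
      = fun ω => ∑ i ∈ Finset.range n, (fun _ => s⁻¹ : ℕ → ℝ) i * X i ω := by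
    ext ω; rw [div_eq_inv_mul, Finset.mul_sum]
  rw [e1, var_lin hL2]
  have e2 : ∀ k, variance (blk X n p s k) μ = ∑ i ∈ Finset.range n, ∑ j ∈ Finset.range n,
      (if i / p = k then s⁻¹ else 0) * (if j / p = k then s⁻¹ else 0)
        * covariance (X i) (X j) μ := fun k =>
    var_lin hL2 n (fun i => if i / p = k then s⁻¹ else 0)
  simp only [e2]
  have e3 : ∑ k ∈ Finset.range n, ∑ i ∈ Finset.range n, ∑ j ∈ Finset.range n,
      (if i / p = k then s⁻¹ else 0) * (if j / p = k then s⁻¹ else 0) * covariance (X i) (X j) μ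
      = ∑ i ∈ Finset.range n, ∑ j ∈ Finset.range n, ∑ k ∈ Finset.range n,
      (if i / p = k then s⁻¹ else 0) * (if j / p = k then s⁻¹ else 0)
        * covariance (X i) (X j) μ := by
    rw [Finset.sum_comm]
    refine Finset.sum_congr rfl fun i _ => ?_
    rw [Finset.sum_comm]
  rw [e3, ← Finset.sum_sub_distrib, Finset.sum_div]
  refine Finset.sum_congr rfl fun i hi => ?_
  rw [← Finset.sum_sub_distrib, Finset.sum_div]
  refine Finset.sum_congr rfl fun j hj => ?_
  rw [Finset.mem_range] at hi
  have hk : i / p ∈ Finset.range n := Finset.mem_range.2 ((Nat.div_le_self i p).trans_lt hi)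
  rw [Finset.sum_eq_single_of_mem _ hk]
  · rw [if_pos rfl, covariance_comm (X j)]
    split_ifs with h
    · simp
    · simp; ring
  · intro k _ hk
    rw [if_neg (Ne.symm hk)]; simp

lemma sum_mod (F : ℕ → ℝ) (p K : ℕ) :
    ∑ i ∈ Finset.range (p * K), F (i % p) = K * ∑ q ∈ Finset.range p, F q := by
  induction K with
  | zero => simp
  | succ K ih =>
    rw [mul_add, mul_one, Finset.sum_range_add, ih]
    have : ∑ x ∈ Finset.range p, F ((p * K + x) % p) = ∑ q ∈ Finset.range p, F q := by
      refine Finset.sum_congr rfl fun q hq => ?_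
      rw [Nat.mul_add_mod, Nat.mod_eq_of_lt (Finset.mem_range.1 hq)]
    rw [this]; push_cast; ring

lemma sum_mod_le (F : ℕ → ℝ) (hF : ∀ q, 0 ≤ F q) (p n : ℕ) (hp : 0 < p) :
    ∑ i ∈ Finset.range n, F (i % p) ≤ ((n / p : ℕ) + 1 : ℝ) * ∑ q ∈ Finset.range p, F q := by
  have := sum_mod F p (n / p + 1)
  push_cast at this
  rw [← this]
  apply Finset.sum_le_sum_of_subset_of_nonneg
  · intro i hi
    rw [Finset.mem_range] at hi ⊢
    exact hi.trans (Nat.lt_mul_div_succ n hp)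
  · intro i _ _; exact hF _

lemma dist_blk (i j p : ℕ) (hp : 0 < p) (h : ¬ j / p = i / p) :
    min (i % p + 1) (p - i % p) ≤ ((j : ℤ) - (i : ℤ)).natAbs := by
  have hi := Nat.div_add_mod i p
  have hj := Nat.div_add_mod j p
  have hi' := Nat.mod_lt i hp
  have hj' := Nat.mod_lt j hp
  rcases lt_or_gt_of_ne h with h | h
  · have : p * (j / p + 1) ≤ p * (i / p) := Nat.mul_le_mul_left p h
    rw [mul_add, mul_one] at this
    omega
  · have : p * (i / p + 1) ≤ p * (j / p) := Nat.mul_le_mul_left p h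
    rw [mul_add, mul_one] at this
    omega

lemma off_bound (c : ℕ → ℕ → ℝ) (hc : ∀ i j, 0 ≤ c i j) (u : ℕ → ℝ)
    (hu : ∀ r : ℕ, 1 ≤ r → ∀ i n : ℕ, (∑ j ∈ Finset.range n,
      if r ≤ ((j : ℤ) - (i : ℤ)).natAbs then c j i else 0) ≤ u r) (n p : ℕ) (hp : 0 < p) :
    ∑ i ∈ Finset.range n, ∑ j ∈ Finset.range n, (if j / p = i / p then 0 else c j i)
      ≤ 2 * ((n / p : ℕ) + 1 : ℝ) * ∑ q ∈ Finset.range p, |u (q + 1)| := by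
  have h1 : ∀ i ∈ Finset.range n, ∑ j ∈ Finset.range n, (if j / p = i / p then 0 else c j i)
      ≤ |u (i % p + 1)| + |u (p - i % p)| := by
    intro i _
    have hi' := Nat.mod_lt i hp
    calc _ ≤ ∑ j ∈ Finset.range n,
        if min (i % p + 1) (p - i % p) ≤ ((j : ℤ) - (i : ℤ)).natAbs then c j i else 0 := by
          refine Finset.sum_le_sum fun j _ => ?_
          by_cases h : j / p = i / p
          · rw [if_pos h]; split_ifs
            · exact hc _ _
            · exact le_rfl
          · rw [if_neg h, if_pos (dist_blk i j p hp h)]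
      _ ≤ u (min (i % p + 1) (p - i % p)) := hu _ (by omega) i n
      _ ≤ _ := by
        rcases min_choice (i % p + 1) (p - i % p) with h | h <;> rw [h]
        · have := le_abs_self (u (i % p + 1)); have := abs_nonneg (u (p - i % p)); linarith
        · have := le_abs_self (u (p - i % p)); have := abs_nonneg (u (i % p + 1)); linarith
  refine (Finset.sum_le_sum h1).trans ?_
  refine (sum_mod_le (fun q => |u (q + 1)| + |u (p - q)|) (fun q => by positivity) p n hp).trans ?_
  rw [Finset.sum_add_distrib]
  have : ∑ q ∈ Finset.range p, |u (p - q)| = ∑ q ∈ Finset.range p, |u (q + 1)| := by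
    rw [← Finset.sum_range_reflect (fun q => |u (q + 1)|)]
    refine Finset.sum_congr rfl fun q hq => ?_
    rw [Finset.mem_range] at hq
    congr 2; omega
  rw [this]
  apply le_of_eq; ring

lemma max_ineq (I : Finset ℕ) (p : ℕ) (hp : 0 < p) (hI : I.card ≤ p) (x : ℕ → ℝ) (δ : ℝ)
    (hδ : 0 < δ) (h : δ ≤ |∑ i ∈ I, x i|) :
    (∑ i ∈ I, x i) ^ 2 ≤ p ^ 2 * ∑ i ∈ I, (if δ / p ≤ |x i| then (x i) ^ 2 else 0) := by
  have hpR : (0 : ℝ) < p := by exact_mod_cast hp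
  have hne : I.Nonempty := by
    rw [Finset.nonempty_iff_ne_empty]; rintro rfl
    simp at h; linarith
  obtain ⟨i, hi, hmax⟩ := Finset.exists_max_image I (fun i => |x i|) hne
  have h1 : |∑ i ∈ I, x i| ≤ p * |x i| := by
    calc _ ≤ ∑ i ∈ I, |x i| := Finset.abs_sum_le_sum_abs _ _
      _ ≤ I.card • |x i| := Finset.sum_le_card_nsmul _ _ _ hmax
      _ ≤ _ := by
        rw [nsmul_eq_mul]
        gcongr
  have h2 : δ / p ≤ |x i| := by rw [div_le_iff₀ hpR]; linarith
  calc (∑ i ∈ I, x i) ^ 2 = |∑ i ∈ I, x i| ^ 2 := (sq_abs _).symm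
    _ ≤ (p * |x i|) ^ 2 := by gcongr
    _ = p ^ 2 * (x i) ^ 2 := by rw [mul_pow, sq_abs]
    _ ≤ _ := by
      gcongr
      have := Finset.single_le_sum (f := fun i => (if δ / p ≤ |x i| then (x i) ^ 2 else 0))
        (fun i _ => by split_ifs <;> positivity) hi
      simpa [h2] using this

lemma card_blk (n p k : ℕ) (hp : 0 < p) :
    ((Finset.range n).filter (fun i => i / p = k)).card ≤ p := by
  have : (Finset.range n).filter (fun i => i / p = k) ⊆ Finset.Ico (p * k) (p * k + p) := by
    intro i hi
    rw [Finset.mem_filter] at hi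
    have := Nat.div_add_mod i p
    have := Nat.mod_lt i hp
    rw [Finset.mem_Ico, ← hi.2]
    omega
  simpa using Finset.card_le_card this

lemma lind_blk {X : ℕ → Ω → ℝ} (hm : ∀ i, Measurable (X i)) (hL2 : ∀ i, MemLp (X i) 2 μ)
    (n p : ℕ) (hp : 0 < p) (s : ℝ) (hs : 0 < s) (δ : ℝ) (hδ : 0 < δ) :
    ∑ k ∈ Finset.range n, ∫ ω in {ω | δ ≤ |blk X n p s k ω|}, (blk X n p s k ω) ^ 2 ∂μ
      ≤ p ^ 2 * ((∑ j ∈ Finset.range n, ∫ ω in {ω | δ / p * s ≤ |X j ω|}, (X j ω) ^ 2 ∂μ) / s ^ 2) := by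
  have hset : ∀ j, MeasurableSet {ω | δ / p * s ≤ |X j ω|} := fun j =>
    measurableSet_le measurable_const (by have := hm j; fun_prop)
  have hint : ∀ j, Integrable ({ω | δ / p * s ≤ |X j ω|}.indicator fun ω => (X j ω) ^ 2) μ := fun j =>
    (hL2 j).integrable_sq.indicator (hset j)
  have hk : ∀ k ∈ Finset.range n,
      ∫ ω in {ω | δ ≤ |blk X n p s k ω|}, (blk X n p s k ω) ^ 2 ∂μ ≤
      p ^ 2 * ∑ j ∈ Finset.range n, if j / p = k then
        (∫ ω in {ω | δ / p * s ≤ |X j ω|}, (X j ω) ^ 2 ∂μ) / s ^ 2 else 0 := by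
    intro k _
    have hbm := blk_meas hm n p s k
    have hsetb : MeasurableSet {ω | δ ≤ |blk X n p s k ω|} :=
      measurableSet_le measurable_const (by fun_prop)
    rw [← integral_indicator hsetb]
    rw [← Finset.sum_filter]
    have e : p ^ 2 * ∑ j ∈ (Finset.range n).filter (fun j => j / p = k),
        (∫ ω in {ω | δ / p * s ≤ |X j ω|}, (X j ω) ^ 2 ∂μ) / s ^ 2
        = ∫ ω, p ^ 2 * ∑ j ∈ (Finset.range n).filter (fun j => j / p = k),
          ({ω | δ / p * s ≤ |X j ω|}.indicator (fun ω => (X j ω) ^ 2) ω) / s ^ 2 ∂μ := by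
      rw [integral_const_mul, integral_finsetSum _ (fun j _ => (hint j).div_const _)]
      simp only [integral_div, integral_indicator (hset _)]
    rw [e]
    apply integral_mono ((blk_memLp hL2 n p s k).integrable_sq.indicator hsetb)
    · exact (integrable_finsetSum _ (fun j _ => (hint j).div_const _)).const_mul _
    intro ω
    simp only
    by_cases h : δ ≤ |blk X n p s k ω|
    · rw [Set.indicator_of_mem (by exact h)]
      have eb : blk X n p s k ω = ∑ i ∈ (Finset.range n).filter (fun j => j / p = k), X i ω / s := by
        unfold blk
        rw [Finset.sum_filter]
        refine Finset.sum_congr rfl fun i _ => ?_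
        split_ifs
        · rw [div_eq_inv_mul]
        · simp
      rw [eb] at h ⊢
      refine (max_ineq _ p hp (card_blk n p k hp) _ δ hδ h).trans (le_of_eq ?_)
      congr 1
      refine Finset.sum_congr rfl fun i _ => ?_
      have : δ / p ≤ |X i ω / s| ↔ δ / p * s ≤ |X i ω| := by
        rw [abs_div, abs_of_pos hs, le_div_iff₀ hs]
      simp only [Set.indicator, Set.mem_ofPred_eq, this]
      split_ifs
      · rw [div_pow]
      · simp
    · rw [Set.indicator_of_notMem (by exact h)]
      have : ∀ j, 0 ≤ {ω | δ / p * s ≤ |X j ω|}.indicator (fun ω => (X j ω) ^ 2) ω := fun j =>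
        Set.indicator_nonneg (fun _ _ => sq_nonneg _) _
      exact mul_nonneg (by positivity) (Finset.sum_nonneg fun j _ => div_nonneg (this j) (by positivity))
  refine (Finset.sum_le_sum hk).trans (le_of_eq ?_)
  rw [← Finset.mul_sum, Finset.sum_comm, Finset.sum_div]
  congr 1
  refine Finset.sum_congr rfl fun j hj => ?_
  rw [Finset.sum_ite_eq, if_pos]
  rw [Finset.mem_range] at hj ⊢
  exact (Nat.div_le_self j p).trans_lt hj

end C

section D

variable {Ω : Type*} [MeasurableSpace Ω] {μ : Measure Ω} [IsProbabilityMeasure μ]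

lemma exp_lip (a b : ℝ) (ha : 0 ≤ a) (hab : a ≤ b) :
    |Real.exp (-a) - Real.exp (-b)| ≤ b - a := by
  have h1 : Real.exp (-b) ≤ Real.exp (-a) := Real.exp_le_exp.2 (by linarith)
  rw [abs_of_nonneg (by linarith)]
  have h2 := Real.add_one_le_exp (-(b - a))
  have h3 : Real.exp (-b) = Real.exp (-a) * Real.exp (-(b - a)) := by
    rw [← Real.exp_add]; congr 1; ring
  have h4 : Real.exp (-a) ≤ 1 := Real.exp_le_one_iff.2 (by linarith)
  have h5 := Real.exp_pos (-a)
  rw [h3]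
  nlinarith

set_option maxHeartbeats 1000000 in
lemma key {X : ℕ → Ω → ℝ} (hmeas : ∀ i, Measurable (X i)) (hL2 : ∀ i, MemLp (X i) 2 μ)
    (hmean : ∀ i, ∫ ω, X i ω ∂μ = 0) (hassoc : IsAssociatedSeq μ X) (u : ℕ → ℝ)
    (hu : ∀ r : ℕ, 1 ≤ r → ∀ i n : ℕ, (∑ j ∈ Finset.range n,
      if r ≤ ((j : ℤ) - (i : ℤ)).natAbs then covariance (X j) (X i) μ else 0) ≤ u r)
    (c : ℝ) (hc : 0 < c) (n p : ℕ) (hp : 0 < p) (hpn : p ≤ n) (s : ℝ) (hs : 0 < s)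
    (hs2 : variance (fun ω => ∑ i ∈ Finset.range n, X i ω) μ = s ^ 2) (hcs : c * n ≤ s ^ 2)
    (t δ : ℝ) (hδ : 0 < δ) :
    ‖chf μ (fun ω => (∑ i ∈ Finset.range n, X i ω) / s) t
      - ((Real.exp (-(t ^ 2 / 2)) : ℝ) : ℂ)‖ ≤
      3 * t ^ 2 * (4 / c * ((p : ℝ)⁻¹ * ∑ q ∈ Finset.range p, |u (q + 1)|))
      + (4 * |t| ^ 3 * δ + t ^ 4 * δ ^ 2)
      + (4 * t ^ 2 + t ^ 4) * (p ^ 2 * ((∑ j ∈ Finset.range n,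
        ∫ ω in {ω | δ / p * s ≤ |X j ω|}, (X j ω) ^ 2 ∂μ) / s ^ 2)) := by
  have hpR : (0 : ℝ) < p := by exact_mod_cast hp
  have hnR : (p : ℝ) ≤ n := by exact_mod_cast hpn
  have hs2' : 0 < s ^ 2 := by positivity
  have hcov : ∀ i j, 0 ≤ covariance (X i) (X j) μ := covariance_nonneg_of_assoc hassoc hL2
  have hoff := off_eq (μ := μ) hL2 n p s
  have hob := off_bound (fun i j => covariance (X i) (X j) μ) hcov u hu n p hp
  have hv : variance (fun ω => (∑ i ∈ Finset.range n, X i ω) / s) μ = 1 := by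
    have : (fun ω => (∑ i ∈ Finset.range n, X i ω) / s)
        = fun ω => s⁻¹ * (∑ i ∈ Finset.range n, X i ω) := by
      ext ω; rw [div_eq_inv_mul]
    rw [this, variance_const_mul, hs2]
    field_simp
  have hN := newman (μ := μ) (Y := blk X n p s) (blk_memLp hL2 n p s)
    (blk_passoc hassoc n p s hs) t n
  have hL := fun h => lindeberg (μ := μ) (Y := blk X n p s) (blk_meas hmeas n p s)
    (blk_memLp hL2 n p s) (blk_mean hL2 hmean n p s) t δ hδ.le n _ _ rfl rfl h
  have hΛ := lind_blk (μ := μ) hmeas hL2 n p hp s hs δ hδ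
  simp only [sum_blk_all] at hN
  rw [hv] at hN hoff
  set A := ∑ k ∈ Finset.range n, variance (blk X n p s k) μ with hA
  set Λ := ∑ k ∈ Finset.range n, ∫ ω in {ω | δ ≤ |blk X n p s k ω|}, (blk X n p s k ω) ^ 2 ∂μ
  set L := p ^ 2 * ((∑ j ∈ Finset.range n,
        ∫ ω in {ω | δ / p * s ≤ |X j ω|}, (X j ω) ^ 2 ∂μ) / s ^ 2)
  set U := ∑ q ∈ Finset.range p, |u (q + 1)|
  have hU : 0 ≤ U := Finset.sum_nonneg fun _ _ => abs_nonneg _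
  have hA0 : 0 ≤ A := Finset.sum_nonneg fun _ _ => variance_nonneg _ _
  have h0 : 0 ≤ 1 - A := by
    rw [hoff]
    refine div_nonneg (Finset.sum_nonneg fun i _ => Finset.sum_nonneg fun j _ => ?_) hs2'.le
    split_ifs
    · exact le_rfl
    · exact hcov _ _
  have h1 : 1 - A ≤ 4 / c * ((p : ℝ)⁻¹ * U) := by
    rw [hoff, div_le_iff₀ hs2']
    refine hob.trans ?_
    have hd : ((n / p : ℕ) : ℝ) ≤ n / p := Nat.cast_div_le
    have hd2 : (1 : ℝ) ≤ n / p := by rw [le_div_iff₀ hpR]; linarith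
    calc 2 * (((n / p : ℕ) : ℝ) + 1) * U ≤ 2 * ((n : ℝ) / p + n / p) * U := by gcongr
      _ = 4 / c * ((p : ℝ)⁻¹ * U) * (c * n) := by field_simp; ring
      _ ≤ _ := by gcongr
  have hL' := hL (by linarith)
  have hE : ‖((Real.exp (-(t ^ 2 * A / 2)) : ℝ) : ℂ) - ((Real.exp (-(t ^ 2 / 2)) : ℝ) : ℂ)‖
      ≤ t ^ 2 * (1 - A) := by
    rw [← Complex.ofReal_sub, Complex.norm_real, Real.norm_eq_abs]
    have ht : 0 ≤ t ^ 2 * (1 - A) := mul_nonneg (sq_nonneg t) h0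
    have ht2 : 0 ≤ t ^ 2 * A / 2 := div_nonneg (mul_nonneg (sq_nonneg t) hA0) (by norm_num)
    have ht3 : t ^ 2 * (1 - A) = t ^ 2 - t ^ 2 * A := by ring
    refine (exp_lip _ _ ht2 (by linarith)).trans (by linarith)
  have htri := norm_sub_le_norm_sub_add_norm_sub
    (chf μ (fun ω => (∑ i ∈ Finset.range n, X i ω) / s) t)
    (∏ k ∈ Finset.range n, chf μ (blk X n p s k) t) ((Real.exp (-(t ^ 2 / 2)) : ℝ) : ℂ)
  have htri2 := norm_sub_le_norm_sub_add_norm_sub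
    (∏ k ∈ Finset.range n, chf μ (blk X n p s k) t)
    ((Real.exp (-(t ^ 2 * A / 2)) : ℝ) : ℂ) ((Real.exp (-(t ^ 2 / 2)) : ℝ) : ℂ)
  have m1 : 3 * t ^ 2 * (1 - A) ≤ 3 * t ^ 2 * (4 / c * ((p : ℝ)⁻¹ * U)) := by gcongr
  have m2 : (4 * t ^ 2 + t ^ 4) * Λ ≤ (4 * t ^ 2 + t ^ 4) * L := by gcongr
  linarith

lemma chf_tendsto {X : ℕ → Ω → ℝ} (hmeas : ∀ i, Measurable (X i)) (hL2 : ∀ i, MemLp (X i) 2 μ)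
    (hmean : ∀ i, ∫ ω, X i ω ∂μ = 0) (hassoc : IsAssociatedSeq μ X) (u : ℕ → ℝ)
    (hu0 : Tendsto u atTop (𝓝 0))
    (hu : ∀ r : ℕ, 1 ≤ r → ∀ i n : ℕ, (∑ j ∈ Finset.range n,
      if r ≤ ((j : ℤ) - (i : ℤ)).natAbs then covariance (X j) (X i) μ else 0) ≤ u r)
    (c : ℝ) (hc : 0 < c) (V : ℕ → ℝ)
    (hV : ∀ n, variance (fun ω => ∑ i ∈ Finset.range n, X i ω) μ = V n)
    (hcV : ∀ n : ℕ, 1 ≤ n → c ≤ V n / n)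
    (hlin : ∀ ε : ℝ, 0 < ε → Tendsto (fun n => (∑ j ∈ Finset.range n,
            ∫ ω in {ω | ε * Real.sqrt (V n) ≤ |X j ω|}, (X j ω) ^ 2 ∂μ) / V n) atTop (𝓝 0))
    (t : ℝ) :
    Tendsto (fun n => chf μ (fun ω => (∑ i ∈ Finset.range n, X i ω) / Real.sqrt (V n)) t) atTop
      (𝓝 ((Real.exp (-(t ^ 2 / 2)) : ℝ) : ℂ)) := by
  rw [Metric.tendsto_atTop]
  intro ε hε
  have hces : Tendsto (fun p : ℕ => 3 * t ^ 2 * (4 / c * ((p : ℝ)⁻¹ *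
      ∑ q ∈ Finset.range p, |u (q + 1)|))) atTop (𝓝 0) := by
    have h1 : Tendsto (fun q => |u (q + 1)|) atTop (𝓝 0) := by
      have := ((tendsto_add_atTop_iff_nat 1).2 hu0).abs
      simpa using this
    have := (h1.cesaro.const_mul (4 / c)).const_mul (3 * t ^ 2)
    simpa using this
  obtain ⟨p, hp1, hp⟩ := ((hces.eventually (gt_mem_nhds (show (0:ℝ) < ε / 3 by positivity))).and
    (eventually_ge_atTop 1)).exists
  have hdel : Tendsto (fun δ : ℝ => 4 * |t| ^ 3 * δ + t ^ 4 * δ ^ 2) (𝓝[>] 0) (𝓝 0) := by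
    have : Continuous (fun δ : ℝ => 4 * |t| ^ 3 * δ + t ^ 4 * δ ^ 2) := by fun_prop
    have h2 := this.tendsto 0
    simp only [mul_zero, ne_eq, OfNat.ofNat_ne_zero, not_false_eq_true, zero_pow, add_zero] at h2
    exact h2.mono_left nhdsWithin_le_nhds
  obtain ⟨δ, hδ1, hδ⟩ := ((hdel.eventually (gt_mem_nhds (show (0:ℝ) < ε / 3 by positivity))).and
    self_mem_nhdsWithin).exists
  have hδ : 0 < δ := hδ
  have hpR : (0 : ℝ) < p := by exact_mod_cast hp
  have hlin' := ((hlin (δ / p) (by positivity)).const_mul ((p : ℝ) ^ 2)).const_mul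
    (4 * t ^ 2 + t ^ 4)
  simp only [mul_zero] at hlin'
  obtain ⟨N, hN⟩ := eventually_atTop.1
    (hlin'.eventually (gt_mem_nhds (show (0:ℝ) < ε / 3 by positivity)))
  refine ⟨max N p, fun n hn => ?_⟩
  have hnN := hN n (le_of_max_le_left hn)
  have hnp : p ≤ n := le_of_max_le_right hn
  have hnR : (0 : ℝ) < n := by exact_mod_cast (by omega : 0 < n)
  have hcn := hcV n (by omega)
  rw [le_div_iff₀ hnR] at hcn
  have hVn : 0 < V n := lt_of_lt_of_le (by positivity) hcn
  have hsq : Real.sqrt (V n) ^ 2 = V n := Real.sq_sqrt hVn.le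
  have := key hmeas hL2 hmean hassoc u hu c hc n p hp hnp (Real.sqrt (V n)) (Real.sqrt_pos.2 hVn)
    (by rw [hsq, hV]) (by rw [hsq]; exact hcn) t δ hδ
  rw [hsq] at this
  rw [dist_eq_norm]
  linarith

lemma levy_fin (Z : ℕ → Ω → ℝ) (hZ : ∀ n, Measurable (Z n))
    (h : ∀ t, Tendsto (fun n => chf μ (Z n) t) atTop (𝓝 ((Real.exp (-(t ^ 2 / 2)) : ℝ) : ℂ))) :
    TendstoInDistrib μ Z (gaussianReal 0 1) := by
  intro f hf hfb
  obtain ⟨C, hC⟩ := hfb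
  let P : ℕ → ProbabilityMeasure ℝ := fun n =>
    ⟨μ.map (Z n), Measure.isProbabilityMeasure_map (hZ n).aemeasurable⟩
  let G : ProbabilityMeasure ℝ := ⟨gaussianReal 0 1, inferInstance⟩
  have hT : Tendsto P atTop (𝓝 G) := by
    apply ProbabilityMeasure.tendsto_of_tendsto_charFun
    intro t
    have e1 : charFun (G : Measure ℝ) t = ((Real.exp (-(t ^ 2 / 2)) : ℝ) : ℂ) := by
      change charFun (gaussianReal 0 1) t = _
      rw [charFun_gaussianReal]
      push_cast
      congr 1
      simp
      try ring
    have e2 : ∀ n, charFun (P n : Measure ℝ) t = chf μ (Z n) t := by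
      intro n
      change charFun (μ.map (Z n)) t = _
      rw [charFun_apply_real, integral_map (hZ n).aemeasurable (by fun_prop)]
      unfold chf
      push_cast
      rfl
    simp only [e1, e2]
    exact h t
  rw [ProbabilityMeasure.tendsto_iff_forall_integral_tendsto] at hT
  have := hT (BoundedContinuousFunction.ofNormedAddCommGroup f hf C hC)
  have e3 : ∀ n, ∫ x, f x ∂(P n : Measure ℝ) = ∫ ω, f (Z n ω) ∂μ := fun n =>
    integral_map (hZ n).aemeasurable hf.aestronglyMeasurable
  simp only [BoundedContinuousFunction.coe_ofNormedAddCommGroup, e3] at this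
  exact this

end D

/-- **Completed Oliveira theorem (Theorem 4.8 of Oliveira, completed with condition (d)).**
If the Cox coefficient `u(r) = sup_j ∑_{i : |i−j| ≥ r} Cov(Xᵢ, Xⱼ)` satisfies `u(1) < ∞` and
`u(r) → 0`, if `inf_n sₙ²/n > 0`, if the Lindeberg condition (c) holds, and if the additional
condition (d) on partial variance sums holds, then `Sₙ/sₙ ⇝ N(0,1)`. -/
theorem completed_oliveira_clt
    {Ω : Type*} [MeasurableSpace Ω] (μ : Measure Ω) [IsProbabilityMeasure μ]
    (X : ℕ → Ω → ℝ)
    (hmeas : ∀ i, Measurable (X i))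
    (hL2 : ∀ i, MemLp (X i) 2 μ)
    (hmean : ∀ i, ∫ ω, X i ω ∂μ = 0)
    (hassoc : IsAssociatedSeq μ X)
    (S : ℕ → Ω → ℝ)
    (hS : ∀ n ω, S n ω = ∑ i ∈ Finset.range n, X i ω)
    -- (a) : u(1) < ∞ and u(r) → 0, with u a real-valued bound for the Cox coefficients
    (u : ℕ → ℝ)
    (hu : Tendsto u atTop (𝓝 0))
    (husum : ∀ j r : ℕ, Summable
      (fun i : ℕ => if r ≤ ((i : ℤ) - (j : ℤ)).natAbs then cov μ (X i) (X j) else 0))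
    (hubd : ∀ r : ℕ, 1 ≤ r → ∀ j : ℕ,
      (∑' i : ℕ, if r ≤ ((i : ℤ) - (j : ℤ)).natAbs then cov μ (X i) (X j) else 0) ≤ u r)
    -- (b) : inf_n sₙ²/n > 0
    (hb : ∃ c : ℝ, 0 < c ∧ ∀ n : ℕ, 1 ≤ n → c ≤ variance (S n) μ / n)
    -- (c) : Lindeberg-type condition on the individual variables
    (hc : ∀ ε : ℝ, 0 < ε →
      Tendsto
        (fun n => (∑ j ∈ Finset.range n,
            ∫ ω in {ω | ε * Real.sqrt (variance (S n) μ) ≤ |X j ω|}, (X j ω) ^ 2 ∂μ) /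
          variance (S n) μ)
        atTop (𝓝 0))
    -- (d) : negligibility of partial variance sums over short index ranges
    (hd : ∀ t v : ℕ → ℕ, (∀ n, t n ≤ v n) → (∀ n, v n ≤ n) →
      Tendsto (fun n => ((v n : ℝ) - (t n : ℝ)) / n) atTop (𝓝 0) →
      Tendsto
        (fun n => (∑ i ∈ Finset.Ico (t n) (v n), variance (X i) μ) / variance (S n) μ)
        atTop (𝓝 0)) :
    TendstoInDistrib μ
      (fun n ω => S n ω / Real.sqrt (variance (S n) μ))
      (gaussianReal 0 1) := by
  obtain ⟨c, hc0, hcV⟩ := hb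
  have hSf : ∀ n, S n = fun ω => ∑ i ∈ Finset.range n, X i ω := fun n => funext (hS n)
  have hmS : ∀ n, Measurable (S n) := fun n => by
    rw [hSf]
    exact Finset.measurable_fun_sum _ fun i _ => hmeas i
  refine levy_fin _ (fun n => (hmS n).div_const _) fun t => ?_
  have key := chf_tendsto hmeas hL2 hmean hassoc u hu ?_ c hc0 (fun n => variance (S n) μ)
    (fun n => by rw [hSf n]) hcV hc t
  · simpa only [hS] using key
  · intro r hr i n
    refine le_trans ?_ (hubd r hr i)
    have hcv : ∀ j, covariance (X j) (X i) μ = cov μ (X j) (X i) := fun j =>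
      (cov_eq_covariance (hL2 j) (hL2 i)).symm
    simp only [hcv]
    refine (husum i r).sum_le_tsum _ fun j _ => ?_
    split_ifs
    · rw [← hcv]; exact covariance_nonneg_of_assoc hassoc hL2 j i
    · exact le_rfl
end
end

section
/- (Hoeffding covariance formula) Let (X, Y) be a pair of real random variables with E(X²) < ∞ and E(Y²) < ∞. Then Cov(X, Y) = ∫_{−∞}^{+∞} ∫_{−∞}^{+∞} H(x, y) dx dy, where H(x, y) = P(X > x, Y > y) − P(X > x)·P(Y > y). -/
open MeasureTheory ProbabilityTheory Filter Topology

noncomputable section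

/-- The kernel `1_{x < t} - 1_{x < 0}`. -/
def hoefK (x t : ℝ) : ℝ := (Set.Iio t).indicator 1 x - (Set.Iio (0:ℝ)).indicator 1 x

lemma hoefK_eq (x t : ℝ) :
    hoefK x t = (Set.Ico 0 t).indicator 1 x - (Set.Ico t 0).indicator 1 x := by
  simp only [hoefK, Set.indicator_apply, Set.mem_Iio, Set.mem_Ico, Pi.one_apply]
  split_ifs <;> grind

lemma hoefK_abs (x t : ℝ) :
    ‖hoefK x t‖ = (Set.Ico 0 t).indicator 1 x + (Set.Ico t 0).indicator 1 x := by
  rw [hoefK_eq]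
  simp only [Set.indicator_apply, Set.mem_Ico, Pi.one_apply]
  split_ifs <;> first | (exfalso; grind) | norm_num

lemma ind_int (a b : ℝ) : Integrable ((Set.Ico a b).indicator (1 : ℝ → ℝ)) volume := by
  rw [integrable_indicator_iff measurableSet_Ico]
  exact integrableOn_const (by simp) (by simp)

lemma ind_integral (a b : ℝ) :
    ∫ x, (Set.Ico a b).indicator (1 : ℝ → ℝ) x = max (b - a) 0 := by
  rw [integral_indicator_one measurableSet_Ico]
  simp [Measure.real, ENNReal.toReal_ofReal']

lemma hoefK_integrable (t : ℝ) : Integrable (fun x => hoefK x t) volume := by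
  simp only [hoefK_eq]
  exact (ind_int _ _).sub (ind_int _ _)

lemma hoefK_integral (t : ℝ) : ∫ x, hoefK x t = t := by
  simp only [hoefK_eq]
  rw [integral_sub (ind_int _ _) (ind_int _ _), ind_integral, ind_integral]
  rcases le_total t 0 with h | h <;> simp [h]

lemma hoefK_integral_norm (t : ℝ) : ∫ x, ‖hoefK x t‖ = |t| := by
  simp only [hoefK_abs]
  rw [integral_add (ind_int _ _) (ind_int _ _), ind_integral, ind_integral]
  rcases le_total t 0 with h | h <;> simp [h, abs_of_nonneg, abs_of_nonpos]

lemma hoefK_measurable : Measurable (fun p : ℝ × ℝ => hoefK p.1 p.2) := by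
  have h1 : Measurable ({p : ℝ × ℝ | p.1 < p.2}.indicator (1 : ℝ × ℝ → ℝ)) :=
    measurable_one.indicator (measurableSet_lt measurable_fst measurable_snd)
  have h2 : Measurable ({p : ℝ × ℝ | p.1 < 0}.indicator (1 : ℝ × ℝ → ℝ)) :=
    measurable_one.indicator (measurableSet_lt measurable_fst measurable_const)
  exact h1.sub h2

lemma hoefK_le (x t : ℝ) : ‖hoefK x t‖ ≤ 1 := by
  rw [hoefK_abs]
  simp only [Set.indicator_apply, Set.mem_Ico, Pi.one_apply]
  split_ifs <;> first | (exfalso; grind) | norm_num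

section
variable {Ω : Type*} [MeasurableSpace Ω] (μ : Measure Ω) [IsProbabilityMeasure μ]

lemma hoef_prod_integrable (X Z : Ω → ℝ) (hX : Measurable X) (hZ : Measurable Z)
    (hXZ : Integrable (fun ω => X ω * Z ω) μ) :
    Integrable (fun p : ℝ × Ω => hoefK p.1 (X p.2) * Z p.2) (volume.prod μ) := by
  have hk : Measurable (fun p : ℝ × Ω => hoefK p.1 (X p.2)) := by
    have h0 : Measurable (fun p : ℝ × Ω => (p.1, X p.2)) := by fun_prop
    exact hoefK_measurable.comp h0
  have hz : Measurable (fun p : ℝ × Ω => Z p.2) := by fun_prop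
  have hm : AEStronglyMeasurable (fun p : ℝ × Ω => hoefK p.1 (X p.2) * Z p.2)
      (volume.prod μ) := (hk.mul hz).aestronglyMeasurable
  refine (integrable_prod_iff' hm).mpr ⟨?_, ?_⟩
  · exact Eventually.of_forall fun ω => (hoefK_integrable (X ω)).mul_const (Z ω)
  · have h2 : (fun ω => ∫ x, ‖hoefK x (X ω) * Z ω‖) = fun ω => ‖X ω * Z ω‖ := by
      funext ω
      simp only [norm_mul, integral_mul_const, hoefK_integral_norm, Real.norm_eq_abs (X ω)]
    exact h2 ▸ hXZ.norm

lemma hoef_fubini (X Z : Ω → ℝ) (hX : Measurable X) (hZ : Measurable Z)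
    (hXZ : Integrable (fun ω => X ω * Z ω) μ) :
    Integrable (fun x => ∫ ω, hoefK x (X ω) * Z ω ∂μ) volume ∧
    ∫ x, ∫ ω, hoefK x (X ω) * Z ω ∂μ = ∫ ω, X ω * Z ω ∂μ := by
  have h := hoef_prod_integrable μ X Z hX hZ hXZ
  refine ⟨h.integral_prod_left, ?_⟩
  rw [integral_integral_swap h]
  simp only [integral_mul_const, hoefK_integral]

lemma hoefK_X_meas (X : Ω → ℝ) (hX : Measurable X) (x : ℝ) :
    Measurable (fun ω => hoefK x (X ω)) :=
  hoefK_measurable.comp (measurable_const.prodMk hX)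

lemma hoef_H (X Y : Ω → ℝ) (hX : Measurable X) (hY : Measurable Y) (x y : ℝ) :
    (μ {ω | x < X ω ∧ y < Y ω}).toReal
          - (μ {ω | x < X ω}).toReal * (μ {ω | y < Y ω}).toReal =
    ∫ ω, hoefK y (Y ω) * hoefK x (X ω) ∂μ
      - (∫ ω, hoefK y (Y ω) ∂μ) * ∫ ω, hoefK x (X ω) ∂μ := by
  set A := {ω | x < X ω} with hA
  set B := {ω | y < Y ω} with hB
  have mA : MeasurableSet A := measurableSet_lt measurable_const hX
  have mB : MeasurableSet B := measurableSet_lt measurable_const hY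
  have hAB : {ω | x < X ω ∧ y < Y ω} = A ∩ B := rfl
  have i (S : Set Ω) (mS : MeasurableSet S) : Integrable (S.indicator (1 : Ω → ℝ)) μ :=
    (integrable_const (1:ℝ)).indicator mS
  have e (S : Set Ω) (mS : MeasurableSet S) : ∫ ω, S.indicator (1 : Ω → ℝ) ω ∂μ = (μ S).toReal :=
    integral_indicator_one mS
  set c := (Set.Iio (0:ℝ)).indicator (1 : ℝ → ℝ) x with hc
  set d := (Set.Iio (0:ℝ)).indicator (1 : ℝ → ℝ) y with hd
  have kx (ω) : hoefK x (X ω) = A.indicator 1 ω - c := rfl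
  have ky (ω) : hoefK y (Y ω) = B.indicator 1 ω - d := rfl
  have kk (ω) : hoefK y (Y ω) * hoefK x (X ω) =
      (A ∩ B).indicator 1 ω - c * B.indicator 1 ω - d * A.indicator 1 ω + d * c := by
    rw [kx, ky, Set.inter_indicator_one, Pi.mul_apply]; ring
  simp only [kk]
  simp only [kx, ky]
  have j1 : Integrable (fun ω => (A ∩ B).indicator (1 : Ω → ℝ) ω
      - c * B.indicator (1 : Ω → ℝ) ω) μ := (i _ (mA.inter mB)).sub ((i _ mB).const_mul c)
  have j2 : Integrable (fun ω => (A ∩ B).indicator (1 : Ω → ℝ) ω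
      - c * B.indicator (1 : Ω → ℝ) ω - d * A.indicator (1 : Ω → ℝ) ω) μ :=
    j1.sub ((i _ mA).const_mul d)
  rw [integral_add j2 (integrable_const _),
    integral_sub j1 ((i _ mA).const_mul d),
    integral_sub (i _ (mA.inter mB)) ((i _ mB).const_mul c),
    integral_sub (i _ mA) (integrable_const _), integral_sub (i _ mB) (integrable_const _),
    integral_const_mul, integral_const_mul, e _ (mA.inter mB), e _ mA, e _ mB, hAB]
  simp only [integral_const, probReal_univ, one_smul]
  ring

end

/-- **Hoeffding's covariance formula.** For a square-integrable pair `(X, Y)`,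
`Cov(X, Y) = ∫∫ (P(X > x, Y > y) − P(X > x) P(Y > y)) dx dy`. -/
theorem hoeffding_covariance_formula
    {Ω : Type*} [MeasurableSpace Ω] (μ : Measure Ω) [IsProbabilityMeasure μ]
    (X Y : Ω → ℝ)
    (hX : Measurable X) (hY : Measurable Y)
    (hXL2 : MemLp X 2 μ) (hYL2 : MemLp Y 2 μ) :
    cov μ X Y =
      ∫ x : ℝ, ∫ y : ℝ,
        ((μ {ω | x < X ω ∧ y < Y ω}).toReal
          - (μ {ω | x < X ω}).toReal * (μ {ω | y < Y ω}).toReal) := by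
  have iX : Integrable X μ := hXL2.integrable (by norm_num)
  have iY : Integrable Y μ := hYL2.integrable (by norm_num)
  have iXY : Integrable (fun ω => X ω * Y ω) μ := hXL2.integrable_mul hYL2
  obtain ⟨fX, eX⟩ := hoef_fubini μ X (fun _ => 1) hX measurable_const (by simpa using iX)
  obtain ⟨fY, eY⟩ := hoef_fubini μ Y (fun _ => 1) hY measurable_const (by simpa using iY)
  simp only [mul_one] at fX eX fY eY
  have inner (x : ℝ) : (∫ y : ℝ, ((μ {ω | x < X ω ∧ y < Y ω}).toReal
          - (μ {ω | x < X ω}).toReal * (μ {ω | y < Y ω}).toReal)) =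
      ∫ ω, hoefK x (X ω) * Y ω ∂μ - (∫ ω, Y ω ∂μ) * ∫ ω, hoefK x (X ω) ∂μ := by
    have mk := hoefK_X_meas X hX x
    obtain ⟨f, e⟩ := hoef_fubini μ Y (fun ω => hoefK x (X ω)) hY mk
      (iY.mul_bdd (c := 1) mk.aestronglyMeasurable (Eventually.of_forall fun ω => hoefK_le _ _))
    simp only [hoef_H μ X Y hX hY]
    rw [integral_sub f (fY.mul_const _), e, integral_mul_const, eY]
    simp only [mul_comm]
  simp only [inner]
  obtain ⟨f, e⟩ := hoef_fubini μ X Y hX hY iXY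
  rw [integral_sub f (fX.const_mul _), e, integral_const_mul, eX, cov]
  ring
end
end

section
/- (Newman's covariance inequality) Let X and Y be real random variables with finite variance such that the pair (X, Y) is associated, and let f, g : ℝ → ℂ be continuously differentiable functions with bounded derivatives f′ and g′. Then |Cov(f(X), g(Y))| ≤ ‖f′‖_∞ · ‖g′‖_∞ · Cov(X, Y), where Cov(f(X), g(Y)) = E[f(X)g(Y)] − E[f(X)]·E[g(Y)]. -/
open MeasureTheory ProbabilityTheory Filter Topology

noncomputable section

/-- Hoeffding kernel. -/
def hk (a x : ℝ) : ℝ := (if x ≤ a then 1 else 0) - (if x ≤ 0 then 1 else 0)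

lemma hk_eq (a x : ℝ) :
    hk a x = (Set.Ioc 0 a).indicator (fun _ => (1:ℝ)) x
      - (Set.Ioc a 0).indicator (fun _ => (1:ℝ)) x := by
  unfold hk
  simp only [Set.indicator, Set.mem_Ioc]
  split_ifs <;> first | (norm_num; done) | (exfalso; grind)

lemma hk_abs (a x : ℝ) : |hk a x| = (Set.uIoc 0 a).indicator (fun _ => (1:ℝ)) x := by
  unfold hk
  simp only [Set.indicator, Set.mem_uIoc]
  split_ifs <;> first | (norm_num; done) | (exfalso; grind)

lemma hk_abs_le (a x : ℝ) : |hk a x| ≤ 1 := by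
  rw [hk_abs]
  exact Set.indicator_le_self' (fun _ _ => zero_le_one) x

lemma hk_meas : Measurable (fun p : ℝ × ℝ => hk p.1 p.2) := by
  unfold hk
  refine Measurable.sub ?_ ?_
  · exact Measurable.ite (measurableSet_le measurable_snd measurable_fst)
      measurable_const measurable_const
  · exact Measurable.ite (measurableSet_le measurable_snd measurable_const)
      measurable_const measurable_const

lemma hk_meas1 (a : ℝ) : Measurable (hk a) := hk_meas.comp (measurable_const.prodMk measurable_id)

lemma hk_int (a : ℝ) : Integrable (hk a) := by
  have h : Integrable ((Set.uIoc 0 a).indicator (fun _ => (1:ℝ))) := by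
    rw [integrable_indicator_iff measurableSet_uIoc]
    exact (integrableOn_const (by simp [Set.uIoc]))
  exact h.mono (hk_meas1 a).aestronglyMeasurable
    (Eventually.of_forall fun x => by rw [← hk_abs]; simp)

lemma hk_int_abs (a : ℝ) : ∫ x, |hk a x| = |a| := by
  simp_rw [hk_abs]
  rw [integral_indicator measurableSet_uIoc]
  simp [Set.uIoc, Measure.real, max_sub_min_eq_abs]

lemma hk_integral (f u : ℝ → ℂ) (hu : Continuous u) (hfu : ∀ x, HasDerivAt f (u x) x) (a : ℝ) :
    ∫ x, u x * (hk a x : ℂ) = f a - f 0 := by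
  have h1 : ∫ x in (0:ℝ)..a, u x = f a - f 0 :=
    intervalIntegral.integral_eq_sub_of_hasDerivAt (fun x _ => hfu x) (hu.intervalIntegrable _ _)
  rw [← h1, intervalIntegral]
  have e : ∀ x, u x * (hk a x : ℂ) = (Set.Ioc 0 a).indicator u x - (Set.Ioc a 0).indicator u x := by
    intro x
    rw [hk_eq]
    simp only [Set.indicator]
    split_ifs <;> simp
  simp_rw [e]
  rw [integral_sub, integral_indicator measurableSet_Ioc, integral_indicator measurableSet_Ioc]
  · rw [integrable_indicator_iff measurableSet_Ioc]
    exact (hu.integrableOn_Icc).mono_set Set.Ioc_subset_Icc_self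
  · rw [integrable_indicator_iff measurableSet_Ioc]
    exact (hu.integrableOn_Icc).mono_set Set.Ioc_subset_Icc_self

section
variable {Ω : Type*} [MeasurableSpace Ω] (μ : Measure Ω) [IsProbabilityMeasure μ] (X Y : Ω → ℝ)

def hH (p : ℝ × ℝ) : ℝ := cov μ (fun ω => hk (X ω) p.1) (fun ω => hk (Y ω) p.2)

lemma hk_int_one (hX : Measurable X) (hX1 : Integrable X μ) :
    Integrable (fun q : Ω × ℝ => hk (X q.1) q.2) (μ.prod volume) := by
  have hm : Measurable (fun q : Ω × ℝ => hk (X q.1) q.2) :=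
    hk_meas.comp ((hX.comp measurable_fst).prodMk measurable_snd)
  rw [integrable_prod_iff hm.aestronglyMeasurable]
  refine ⟨Eventually.of_forall fun ω => hk_int (X ω), ?_⟩
  simp only [Real.norm_eq_abs, hk_int_abs]
  exact hX1.abs

lemma hk_int_two (hX : Measurable X) (hY : Measurable Y)
    (hXY : Integrable (fun ω => X ω * Y ω) μ) :
    Integrable (fun q : Ω × (ℝ × ℝ) => hk (X q.1) q.2.1 * hk (Y q.1) q.2.2)
      (μ.prod (volume.prod volume)) := by
  have hm : Measurable (fun q : Ω × (ℝ × ℝ) => hk (X q.1) q.2.1 * hk (Y q.1) q.2.2) :=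
    (hk_meas.comp ((hX.comp measurable_fst).prodMk (measurable_fst.comp measurable_snd))).mul
      (hk_meas.comp ((hY.comp measurable_fst).prodMk (measurable_snd.comp measurable_snd)))
  rw [integrable_prod_iff hm.aestronglyMeasurable]
  refine ⟨Eventually.of_forall fun ω => (hk_int (X ω)).mul_prod (hk_int (Y ω)), ?_⟩
  have : ∀ ω, ∫ p : ℝ × ℝ, ‖hk (X ω) p.1 * hk (Y ω) p.2‖ ∂(volume.prod volume)
      = |X ω * Y ω| := by
    intro ω
    simp only [norm_mul, Real.norm_eq_abs]
    rw [integral_prod_mul (fun x => |hk (X ω) x|) (fun y => |hk (Y ω) y|), hk_int_abs, hk_int_abs,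
      abs_mul]
  simp only [this]
  exact hXY.abs

lemma hH_int (hX : Measurable X) (hY : Measurable Y) (hX1 : Integrable X μ) (hY1 : Integrable Y μ)
    (hXY : Integrable (fun ω => X ω * Y ω) μ) : Integrable (hH μ X Y) (volume.prod volume) := by
  unfold hH cov
  exact (hk_int_two μ X Y hX hY hXY).integral_prod_right.sub
    ((hk_int_one μ X hX hX1).integral_prod_right.mul_prod
      (hk_int_one μ Y hY hY1).integral_prod_right)

lemma hH_nonneg (hX : Measurable X) (hY : Measurable Y) (h : IsAssociated μ ![X, Y])
    (p : ℝ × ℝ) : 0 ≤ hH μ X Y p := by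
  have hmono : ∀ x a b : ℝ, a ≤ b → hk a x ≤ hk b x := by
    intro x a b hab
    unfold hk
    gcongr
    split_ifs <;> first | (norm_num; done) | (exfalso; linarith)
  have iX : ∀ (Z : Ω → ℝ), Measurable Z → ∀ x, Measurable (fun ω => hk (Z ω) x) := fun Z hZ x =>
    hk_meas.comp (hZ.prodMk measurable_const)
  refine h (fun z => hk (z 0) p.1) (fun z => hk (z 1) p.2) (fun a b hab => hmono _ _ _ (hab 0))
    (fun a b hab => hmono _ _ _ (hab 1)) ?_ ?_ ?_
  · exact Integrable.of_bound (iX X hX p.1).aestronglyMeasurable 1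
      (Eventually.of_forall fun ω => hk_abs_le _ _)
  · exact Integrable.of_bound (iX Y hY p.2).aestronglyMeasurable 1
      (Eventually.of_forall fun ω => hk_abs_le _ _)
  · refine Integrable.of_bound ((iX X hX p.1).mul (iX Y hY p.2)).aestronglyMeasurable 1
      (Eventually.of_forall fun ω => ?_)
    rw [norm_mul]
    exact mul_le_one₀ (hk_abs_le _ _) (norm_nonneg _) (hk_abs_le _ _)

lemma hf_memLp (hX : Measurable X) (hX2 : MemLp X 2 μ) (f u : ℝ → ℂ) (C : ℝ)
    (hfu : ∀ x, HasDerivAt f (u x) x) (hC : ∀ x, ‖u x‖ ≤ C) :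
    MemLp (fun ω => f (X ω) - f 0) 2 μ := by
  have hfc : Continuous f := continuous_iff_continuousAt.2 fun x => (hfu x).continuousAt
  refine hX2.of_le_mul (c := C)
    ((hfc.measurable.comp hX).sub measurable_const).aestronglyMeasurable
    (Eventually.of_forall fun ω => ?_)
  have := Convex.norm_image_sub_le_of_norm_hasDerivWithin_le (f := f) (f' := u) (s := Set.univ)
    (C := C) (x := 0) (y := X ω) (fun x _ => (hfu x).hasDerivWithinAt) (fun x _ => hC x) convex_univ
    trivial trivial
  simpa using this

lemma hoeffding (hX : Measurable X) (hY : Measurable Y) (hX2 : MemLp X 2 μ) (hY2 : MemLp Y 2 μ)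
    (f g u v : ℝ → ℂ) (C D : ℝ) (hu : Continuous u) (hv : Continuous v)
    (hfu : ∀ x, HasDerivAt f (u x) x) (hgv : ∀ x, HasDerivAt g (v x) x)
    (hC : ∀ x, ‖u x‖ ≤ C) (hD : ∀ x, ‖v x‖ ≤ D) :
    (∫ ω, f (X ω) * g (Y ω) ∂μ) - (∫ ω, f (X ω) ∂μ) * (∫ ω, g (Y ω) ∂μ)
      = ∫ p : ℝ × ℝ, u p.1 * v p.2 * (hH μ X Y p : ℂ) ∂(volume.prod volume) := by
  have hX1 := hX2.integrable one_le_two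
  have hY1 := hY2.integrable one_le_two
  have hXY : Integrable (fun ω => X ω * Y ω) μ := hX2.integrable_mul hY2
  have hF2 := hf_memLp μ X hX hX2 f u C hfu hC
  have hG2 := hf_memLp μ Y hY hY2 g v D hgv hD
  have hF1 := hF2.integrable one_le_two
  have hG1 := hG2.integrable one_le_two
  have hFG : Integrable (fun ω => (f (X ω) - f 0) * (g (Y ω) - g 0)) μ := hF2.integrable_mul hG2
  -- shift
  have addc : ∀ (F : Ω → ℂ) (c : ℂ), Integrable F μ →
      ∫ ω, (F ω + c) ∂μ = (∫ ω, F ω ∂μ) + c := by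
    intro F c hF
    rw [integral_add hF (integrable_const c)]; simp
  have e1 : ∫ ω, f (X ω) ∂μ = (∫ ω, (f (X ω) - f 0) ∂μ) + f 0 := by
    rw [← addc _ _ hF1]; simp
  have e2 : ∫ ω, g (Y ω) ∂μ = (∫ ω, (g (Y ω) - g 0) ∂μ) + g 0 := by
    rw [← addc _ _ hG1]; simp
  have e3 : ∫ ω, f (X ω) * g (Y ω) ∂μ = (∫ ω, (f (X ω) - f 0) * (g (Y ω) - g 0) ∂μ)
      + (f 0 * ∫ ω, (g (Y ω) - g 0) ∂μ) + (∫ ω, (f (X ω) - f 0) ∂μ) * g 0 + f 0 * g 0 := by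
    have j1 : Integrable (fun ω => (f (X ω) - f 0) * (g (Y ω) - g 0) + f 0 * (g (Y ω) - g 0)) μ :=
      hFG.add (hG1.const_mul _)
    have j2 : Integrable (fun ω => (f (X ω) - f 0) * (g (Y ω) - g 0) + f 0 * (g (Y ω) - g 0)
        + (f (X ω) - f 0) * g 0) μ := j1.add (hF1.mul_const _)
    rw [← integral_const_mul, ← integral_mul_const, ← integral_add hFG (hG1.const_mul _),
      ← integral_add j1 (hF1.mul_const _), ← addc _ _ j2]
    congr 1; ext ω; ring
  have main : (∫ ω, (f (X ω) - f 0) * (g (Y ω) - g 0) ∂μ)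
      = ∫ p : ℝ × ℝ, u p.1 * v p.2 * ((∫ ω, hk (X ω) p.1 * hk (Y ω) p.2 ∂μ : ℝ) : ℂ)
          ∂(volume.prod volume) := by
    have hI : Integrable (fun q : Ω × (ℝ × ℝ) =>
        (u q.2.1 * v q.2.2) * ((hk (X q.1) q.2.1 * hk (Y q.1) q.2.2 : ℝ) : ℂ))
        (μ.prod (volume.prod volume)) := by
      refine (hk_int_two μ X Y hX hY hXY).ofReal.bdd_mul (c := C * D) ?_ ?_
      · exact ((hu.comp (continuous_fst)).mul (hv.comp continuous_snd)).measurable.comp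
          measurable_snd |>.aestronglyMeasurable
      · refine Eventually.of_forall fun q => ?_
        rw [norm_mul]
        exact mul_le_mul (hC _) (hD _) (norm_nonneg _) ((norm_nonneg _).trans (hC 0))
    have := integral_integral_swap (f := fun (ω : Ω) (p : ℝ × ℝ) =>
      (u p.1 * v p.2) * ((hk (X ω) p.1 * hk (Y ω) p.2 : ℝ) : ℂ)) hI
    calc _ = _ := ?_
      _ = _ := this
      _ = _ := ?_
    · congr 1; ext ω
      rw [← hk_integral f u hu hfu, ← hk_integral g v hv hgv, ← integral_prod_mul]
      congr 1; ext p; push_cast; ring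
    · congr 1; ext p
      rw [integral_const_mul, integral_complex_ofReal]
  have one : ∀ (Z : Ω → ℝ), Measurable Z → Integrable Z μ → ∀ (f u : ℝ → ℂ) (C : ℝ),
      Continuous u → (∀ x, HasDerivAt f (u x) x) → (∀ x, ‖u x‖ ≤ C) →
      (∫ ω, (f (Z ω) - f 0) ∂μ) = ∫ x, u x * ((∫ ω, hk (Z ω) x ∂μ : ℝ) : ℂ) := by
    intro Z hZ hZ1 f u C hu hfu hC
    have hI : Integrable (fun q : Ω × ℝ => u q.2 * ((hk (Z q.1) q.2 : ℝ) : ℂ))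
        (μ.prod volume) := by
      refine (hk_int_one μ Z hZ hZ1).ofReal.bdd_mul (c := C) ?_ ?_
      · exact (hu.measurable.comp measurable_snd).aestronglyMeasurable
      · exact Eventually.of_forall fun q => hC _
    have := integral_integral_swap (f := fun (ω : Ω) (x : ℝ) => u x * ((hk (Z ω) x : ℝ) : ℂ)) hI
    calc _ = _ := ?_
      _ = _ := this
      _ = _ := ?_
    · congr 1; ext ω
      rw [← hk_integral f u hu hfu]
    · congr 1; ext p
      rw [integral_const_mul, integral_complex_ofReal]
  have bd : ∀ (w : ℝ × ℝ → ℝ), Integrable w (volume.prod volume) →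
      Integrable (fun p : ℝ × ℝ => u p.1 * v p.2 * (w p : ℂ)) (volume.prod volume) := by
    intro w hw
    refine hw.ofReal.bdd_mul (c := C * D) ?_ ?_
    · exact ((hu.comp (continuous_fst)).mul (hv.comp continuous_snd)).aestronglyMeasurable
    · refine Eventually.of_forall fun q => ?_
      rw [norm_mul]
      exact mul_le_mul (hC _) (hD _) (norm_nonneg _) ((norm_nonneg _).trans (hC 0))
  have prodE : (∫ ω, (f (X ω) - f 0) ∂μ) * (∫ ω, (g (Y ω) - g 0) ∂μ)
      = ∫ p : ℝ × ℝ, u p.1 * v p.2 * (((∫ ω, hk (X ω) p.1 ∂μ) * (∫ ω, hk (Y ω) p.2 ∂μ) : ℝ) : ℂ)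
          ∂(volume.prod volume) := by
    rw [one X hX hX1 f u C hu hfu hC, one Y hY hY1 g v D hv hgv hD, ← integral_prod_mul]
    congr 1; ext p; push_cast; ring
  have i1 := bd _ (hk_int_two μ X Y hX hY hXY).integral_prod_right
  have i2 := bd _ ((hk_int_one μ X hX hX1).integral_prod_right.mul_prod
      (hk_int_one μ Y hY hY1).integral_prod_right)
  have fin : (∫ ω, (f (X ω) - f 0) * (g (Y ω) - g 0) ∂μ)
      - (∫ ω, (f (X ω) - f 0) ∂μ) * (∫ ω, (g (Y ω) - g 0) ∂μ)
      = ∫ p : ℝ × ℝ, u p.1 * v p.2 * (hH μ X Y p : ℂ) ∂(volume.prod volume) := by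
    rw [main, prodE, ← integral_sub i1 i2]
    congr 1; ext p; unfold hH cov; push_cast; ring
  rw [← fin, e1, e2, e3]; ring

end

/-- **Newman's covariance inequality.** If `(X, Y)` is associated with finite variances and
`f, g : ℝ → ℂ` are `C¹` with bounded derivatives, then
`|Cov(f(X), g(Y))| ≤ ‖f′‖_∞ ‖g′‖_∞ Cov(X, Y)`. -/
theorem newman_covariance_inequality
    {Ω : Type*} [MeasurableSpace Ω] (μ : Measure Ω) [IsProbabilityMeasure μ]
    (X Y : Ω → ℝ)
    (hX : Measurable X) (hY : Measurable Y)
    (hXL2 : MemLp X 2 μ) (hYL2 : MemLp Y 2 μ)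
    (hassoc : IsAssociated μ ![X, Y])
    (f g : ℝ → ℂ)
    (hf : ContDiff ℝ 1 f) (hg : ContDiff ℝ 1 g)
    (hf' : ∃ C, ∀ x, ‖deriv f x‖ ≤ C) (hg' : ∃ C, ∀ x, ‖deriv g x‖ ≤ C) :
    ‖(∫ ω, f (X ω) * g (Y ω) ∂μ)
        - (∫ ω, f (X ω) ∂μ) * (∫ ω, g (Y ω) ∂μ)‖
      ≤ (⨆ x : ℝ, ‖deriv f x‖) * (⨆ x : ℝ, ‖deriv g x‖) * cov μ X Y := by
  have hX1 := hXL2.integrable one_le_two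
  have hY1 := hYL2.integrable one_le_two
  have hXY : Integrable (fun ω => X ω * Y ω) μ := hXL2.integrable_mul hYL2
  have bf : BddAbove (Set.range fun x => ‖deriv f x‖) := by
    obtain ⟨C, hC⟩ := hf'
    exact ⟨C, by rintro _ ⟨x, rfl⟩; exact hC x⟩
  have bg : BddAbove (Set.range fun x => ‖deriv g x‖) := by
    obtain ⟨C, hC⟩ := hg'
    exact ⟨C, by rintro _ ⟨x, rfl⟩; exact hC x⟩
  have hC : ∀ x, ‖deriv f x‖ ≤ ⨆ x : ℝ, ‖deriv f x‖ := le_ciSup bf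
  have hD : ∀ x, ‖deriv g x‖ ≤ ⨆ x : ℝ, ‖deriv g x‖ := le_ciSup bg
  set C := ⨆ x : ℝ, ‖deriv f x‖
  set D := ⨆ x : ℝ, ‖deriv g x‖
  have hcov : cov μ X Y = ∫ p, hH μ X Y p ∂(volume.prod volume) := by
    have := hoeffding μ X Y hX hY hXL2 hYL2 (fun x => (x : ℂ)) (fun x => (x : ℂ)) (fun _ => 1)
      (fun _ => 1) 1 1 continuous_const continuous_const
      (fun x => (hasDerivAt_id x).ofReal_comp) (fun x => (hasDerivAt_id x).ofReal_comp)
      (by simp) (by simp)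
    simp only [one_mul, ← Complex.ofReal_mul, integral_complex_ofReal] at this
    unfold cov
    exact_mod_cast this
  rw [hoeffding μ X Y hX hY hXL2 hYL2 f g (deriv f) (deriv g) C D
    (hf.continuous_deriv le_rfl) (hg.continuous_deriv le_rfl)
    (fun x => (hf.differentiable one_ne_zero x).hasDerivAt)
    (fun x => (hg.differentiable one_ne_zero x).hasDerivAt) hC hD, hcov, ← integral_const_mul]
  refine norm_integral_le_of_norm_le ((hH_int μ X Y hX hY hX1 hY1 hXY).const_mul _)
    (Eventually.of_forall fun p => ?_)
  rw [norm_mul, norm_mul, Complex.norm_real, Real.norm_of_nonneg (hH_nonneg μ X Y hX hY hassoc p)]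
  exact mul_le_mul_of_nonneg_right
    (mul_le_mul (hC _) (hD _) (norm_nonneg _) ((norm_nonneg _).trans (hC 0)))
    (hH_nonneg μ X Y hX hY hassoc p)
end
end
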